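/- Let K be a totally real number field and let L be an O_K-lattice of rank n. Then L is represented by some unimodular O_K-lattice L' of rank n + 3 whose ambient quadratic K-space L' ⊗_{O_K} K is isometric to K^{n+3} equipped with the sum-of-squares quadratic form x₁² + ⋯ + x_{n+3}². -/

import Mathlib

open scoped TensorProduct

noncomputable section

open NumberField

structure OKLattice (K : Type) [Field K] : Type 1 where
  carrier : Type
  [addCommGroup : AddCommGroup carrier]
  [module : Module (𝓞 K) carrier]
  [finite : Module.Finite (𝓞 K) carrier]
  [torsionFree : NoZeroSMulDivisors (𝓞 K) carrier]
  form : carrier →ₗ[𝓞 K] carrier →ₗ[𝓞 K] 𝓞 K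
  symm : ∀ x y, form x y = form y x
  posDef : ∀ v : carrier, v ≠ 0 → ∀ σ : K →+* ℝ, 0 < σ (algebraMap (𝓞 K) K (form v v))

attribute [instance] OKLattice.addCommGroup OKLattice.module OKLattice.finite
  OKLattice.torsionFree

namespace OKLattice

variable {K : Type} [Field K]

/-- The rank of an `O_K`-lattice: the `K`-dimension of `L ⊗ K`. -/
def rank (L : OKLattice K) : ℕ :=
  Module.finrank K (K ⊗[𝓞 K] L.carrier)

/-- `L.Represents L'` : `L'` is represented by `L`. -/
def Represents (L L' : OKLattice K) : Prop :=
  ∃ σ : L'.carrier →ₗ[𝓞 K] L.carrier, ∀ x, L.form (σ x) (σ x) = L'.form x x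

/-- `L` is `n`-universal. -/
def IsUniversal (L : OKLattice K) (n : ℕ) : Prop :=
  ∀ L' : OKLattice K, L'.rank = n → L.Represents L'

/-- `L` is unimodular. -/
def IsUnimodular (L : OKLattice K) : Prop :=
  Function.Bijective ⇑L.form

end OKLattice

/-- `U_K(n)`: the minimal rank of an `n`-universal `O_K`-lattice. -/
def minUnivRank (K : Type) [Field K] (n : ℕ) : ℕ :=
  sInf {m | ∃ L : OKLattice K, L.IsUniversal n ∧ L.rank = m}

/-- `K` is totally real: every embedding into `ℂ` has image contained in `ℝ`. -/
def TotallyReal (K : Type) [Field K] : Prop :=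
  ∀ φ : K →+* ℂ, ∀ x : K, (φ x).im = 0

open IsDedekindDomain

namespace LocalSquares

section

variable {F : Type} [Field F] [NumberField F] (p : HeightOneSpectrum (𝓞 F))

lemma valuation_natCast_le_one (n : ℕ) : p.valuation F (n : F) ≤ 1 := by
  have := p.valuation_le_one (K := F) (n : 𝓞 F)
  simpa using this

lemma valuation_four_pos : 0 < p.valuation F (4 : F) := by
  rw [zero_lt_iff]
  simp

lemma valuation_four_le_one : p.valuation F (4 : F) ≤ 1 := by
  simpa using valuation_natCast_le_one p 4

lemma valuation_two_le_one : p.valuation F (2 : F) ≤ 1 := by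
  simpa using valuation_natCast_le_one p 2

lemma valuation_four_eq : p.valuation F (4 : F) = p.valuation F 2 ^ 2 := by
  rw [← map_pow]; norm_num

/-- The elements of `Fˣ` which are squares up to a factor that is congruent to `1` to a precision
beyond `4` at `p`, that is, the squares of the completion at `p`. -/
def LocSq : Subgroup Fˣ where
  carrier := {c | ∃ x : F, p.valuation F ((c : F) * x ^ 2 - 1) < p.valuation F 4}
  one_mem' := ⟨1, by simpa using valuation_four_pos p⟩
  mul_mem' := by
    rintro a b ⟨x, hx⟩ ⟨y, hy⟩
    refine ⟨x * y, ?_⟩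
    have h1 : p.valuation F ((a : F) * x ^ 2) ≤ 1 := by
      have : (a : F) * x ^ 2 = (a * x ^ 2 - 1) + 1 := by ring
      rw [this]
      refine (Valuation.map_add _ _ _).trans (max_le (hx.le.trans (valuation_four_le_one p)) ?_)
      simp
    have : ((a * b : Fˣ) : F) * (x * y) ^ 2 - 1
        = (a * x ^ 2) * (b * y ^ 2 - 1) + (a * x ^ 2 - 1) := by
      push_cast; ring
    rw [this]
    refine (Valuation.map_add _ _ _).trans_lt (max_lt ?_ hx)
    rw [map_mul]
    exact (mul_le_of_le_one_left' h1).trans_lt hy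
  inv_mem' := by
    rintro a ⟨x, hx⟩
    refine ⟨a * x, ?_⟩
    have : ((a⁻¹ : Fˣ) : F) * (a * x) ^ 2 - 1 = a * x ^ 2 - 1 := by
      have := a.ne_zero
      push_cast
      field_simp
    rw [this]
    exact hx

variable {p}

lemma mem_locSq {c : Fˣ} :
    c ∈ LocSq p ↔ ∃ x : F, p.valuation F ((c : F) * x ^ 2 - 1) < p.valuation F 4 := Iff.rfl

lemma sq_mem_locSq (u : Fˣ) : u ^ 2 ∈ LocSq p :=
  ⟨((u⁻¹ : Fˣ) : F), by
    have : ((u ^ 2 : Fˣ) : F) * ((u⁻¹ : Fˣ) : F) ^ 2 - 1 = 0 := by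
      have := u.ne_zero
      push_cast
      field_simp
      ring
    rw [this]
    simpa using valuation_four_pos p⟩

lemma mul_self_mem_locSq (u : Fˣ) : u * u ∈ LocSq p := by
  rw [← pow_two]; exact sq_mem_locSq u

lemma mem_locSq_of_isSquare {u : Fˣ} (hu : IsSquare u) : u ∈ LocSq p := by
  obtain ⟨v, rfl⟩ := hu
  exact mul_self_mem_locSq v

lemma mem_locSq_of_sub_one_lt {u : Fˣ} (h : p.valuation F ((u : F) - 1) < p.valuation F 4) :
    u ∈ LocSq p := ⟨1, by simpa using h⟩

lemma mul_sq_mem_locSq_iff {a u : Fˣ} : a * u ^ 2 ∈ LocSq p ↔ a ∈ LocSq p :=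
  (LocSq p).mul_mem_cancel_right (sq_mem_locSq u)

variable (p) in
/-- The valuation at `p` as an additive function (with the opposite sign convention). -/
def lv (u : Fˣ) : ℤ := WithZero.log (p.valuation F (u : F))

lemma val_ne_zero (u : Fˣ) : p.valuation F (u : F) ≠ 0 := by simp

lemma lv_mul (u w : Fˣ) : lv p (u * w) = lv p u + lv p w := by
  simp [lv, WithZero.log_mul]

lemma lv_one : lv p (1 : Fˣ) = 0 := by simp [lv]

lemma lv_inv (u : Fˣ) : lv p u⁻¹ = - lv p u := by
  have := lv_mul (p := p) u u⁻¹
  rw [mul_inv_cancel, lv_one] at this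
  linarith

lemma lv_pow (u : Fˣ) (n : ℕ) : lv p (u ^ n) = n * lv p u := by
  simp [lv, WithZero.log_pow]

lemma exp_lv (u : Fˣ) : WithZero.exp (lv p u) = p.valuation F (u : F) := by
  rw [lv, WithZero.exp_log (val_ne_zero u)]

lemma lv_eq_zero_iff {u : Fˣ} : lv p u = 0 ↔ p.valuation F (u : F) = 1 := by
  rw [← exp_lv, ← WithZero.exp_zero, WithZero.exp_inj]

lemma lv_lt_iff {u w : Fˣ} : lv p u < lv p w ↔ p.valuation F (u : F) < p.valuation F (w : F) := by
  rw [← exp_lv, ← exp_lv, WithZero.exp_lt_exp]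

lemma even_lv_of_mem_locSq {u : Fˣ} (h : u ∈ LocSq p) : Even (lv p u) := by
  obtain ⟨x, hx⟩ := h
  have h1 : p.valuation F ((u : F) * x ^ 2) = 1 := by
    have := Valuation.map_sub_swap (p.valuation F) ((u : F) * x ^ 2) 1
    have h2 : p.valuation F (1 + ((u : F) * x ^ 2 - 1)) = p.valuation F 1 :=
      Valuation.map_add_eq_of_lt_left _ (by
        simpa using hx.trans_le (valuation_four_le_one p))
    simpa using h2
  have hx0 : x ≠ 0 := by
    rintro rfl
    simp at h1
  have h3 : lv p (u * (Units.mk0 x hx0) ^ 2) = 0 := by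
    rw [lv_eq_zero_iff]; simpa using h1
  rw [lv_mul, lv_pow] at h3
  exact ⟨- lv p (Units.mk0 x hx0), by push_cast at h3; linarith⟩

lemma exists_uniformizer (p : HeightOneSpectrum (𝓞 F)) : ∃ u : Fˣ, lv p u = -1 := by
  obtain ⟨π, hπ⟩ := p.valuation_exists_uniformizer F
  have h0 : π ≠ 0 := by
    rintro rfl
    rw [map_zero] at hπ
    exact WithZero.exp_ne_zero hπ.symm
  refine ⟨Units.mk0 π h0, ?_⟩
  rw [lv, Units.val_mk0, hπ, WithZero.log_exp]

lemma exists_unit_of_even {u : Fˣ} (h : Even (lv p u)) :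
    ∃ w : Fˣ, lv p (u * w ^ 2) = 0 := by
  obtain ⟨k, hk⟩ := h
  obtain ⟨π, hπ⟩ := exists_uniformizer p
  refine ⟨π ^ k, ?_⟩
  rw [lv_mul, lv_pow]
  have : lv p (π ^ k) = - k := by
    have : ∀ k : ℤ, lv p (π ^ k) = - k := by
      intro k
      simp only [lv] at hπ ⊢
      rw [Units.val_zpow_eq_zpow_val, map_zpow₀, WithZero.log_zpow, hπ]
      simp
    exact this k
  rw [this, hk]; push_cast; ring

variable (p) in
/-- `p` does not divide `2`. -/
def Odd' : Prop := p.valuation F (2 : F) = 1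

lemma valuation_four_of_odd (h : Odd' p) : p.valuation F (4 : F) = 1 := by
  rw [valuation_four_eq, h, one_pow]

/-- An element that is a unit at `p` is approximated by an integer. -/
lemma exists_int_near {x : F} (hx : p.valuation F x ≤ 1) (n : ℕ) :
    ∃ a : 𝓞 F, p.valuation F (algebraMap (𝓞 F) F a - x) < WithZero.exp (-(n : ℤ)) := by
  obtain ⟨a, ha⟩ := p.exists_valuation_sub_lt_of_integer (K := F) (x := x) hx (γ := Units.mk0 (WithZero.exp (-(n : ℤ))) (by simp))
  refine ⟨a, ?_⟩
  simpa [Valuation.map_sub_swap] using ha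

end

section

variable {F : Type} [Field F] [NumberField F] {p : HeightOneSpectrum (𝓞 F)}

lemma lt_one_iff_le_exp {x : WithZero (Multiplicative ℤ)} : x < 1 ↔ x ≤ WithZero.exp (-1 : ℤ) := by
  rcases eq_or_ne x 0 with rfl | hx
  · simp
  · rw [← WithZero.exp_log hx, ← WithZero.exp_zero, WithZero.exp_lt_exp, WithZero.exp_le_exp]
    omega

variable (p) in
/-- The residue field. -/
abbrev ResField := 𝓞 F ⧸ p.asIdeal

instance : Field (ResField p) := by
  have := p.isMaximal
  exact Ideal.Quotient.field _

instance : Finite (ResField p) := by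
  exact Ring.HasFiniteQuotients.finiteQuotient p.ne_bot

lemma mk_eq_zero_iff {a : 𝓞 F} : (Ideal.Quotient.mk p.asIdeal a = 0) ↔
    p.valuation F (algebraMap (𝓞 F) F a) < 1 := by
  rw [Ideal.Quotient.eq_zero_iff_mem, p.valuation_lt_one_iff_mem]

/-- An element with `v x ≤ 1` has a residue. -/
lemma exists_residue {x : F} (hx : p.valuation F x ≤ 1) :
    ∃ a : 𝓞 F, p.valuation F (x - algebraMap (𝓞 F) F a) < 1 := by
  obtain ⟨a, ha⟩ := exists_int_near hx 0
  exact ⟨a, by rw [Valuation.map_sub_swap]; simpa using ha⟩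

lemma locSq_congr {u w : Fˣ} (h : p.valuation F ((u : F) - w) < p.valuation F (4 * w : F)) :
    u ∈ LocSq p ↔ w ∈ LocSq p := by
  have h1 : u * w⁻¹ ∈ LocSq p := by
    apply mem_locSq_of_sub_one_lt
    have : ((u * w⁻¹ : Fˣ) : F) - 1 = (u - w) * (w : F)⁻¹ := by
      have := w.ne_zero
      push_cast; field_simp
    have hw : 0 < p.valuation F (w : F) := by rw [zero_lt_iff]; simp
    rw [this, map_mul, map_inv₀, mul_inv_lt_iff₀ hw, ← map_mul]
    exact h
  constructor
  · intro hu
    have := (LocSq p).mul_mem ((LocSq p).inv_mem h1) hu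
    simpa using this
  · intro hu
    have := (LocSq p).mul_mem h1 hu
    simpa using this

lemma odd'_iff_char : Odd' p ↔ (2 : ResField p) ≠ 0 := by
  have h := mk_eq_zero_iff (p := p) (a := 2)
  rw [Odd', ne_eq, show (2 : ResField p) = Ideal.Quotient.mk p.asIdeal 2 from rfl, h]
  have := valuation_two_le_one (F := F) p
  simp only [map_ofNat, not_lt]
  exact ⟨fun h => h.ge, fun h => le_antisymm this h⟩

lemma ringChar_ne_two (h : Odd' p) : ringChar (ResField p) ≠ 2 := by
  intro h2
  rw [odd'_iff_char] at h
  apply h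
  have := ringChar.Nat.cast_ringChar (R := ResField p)
  rw [h2] at this
  exact_mod_cast this

/-- For odd primes, being a local square for an integral unit is visible in the residue field. -/
lemma int_mem_locSq_iff (hp : Odd' p) {u : Fˣ} (hu : lv p u = 0) {a : 𝓞 F}
    (ha : p.valuation F ((u : F) - algebraMap (𝓞 F) F a) < 1) :
    u ∈ LocSq p ↔ IsSquare (Ideal.Quotient.mk p.asIdeal a) := by
  have h4 := valuation_four_of_odd hp
  rw [lv_eq_zero_iff] at hu
  constructor
  · rintro ⟨x, hx⟩
    rw [h4] at hx
    have hv : p.valuation F ((u : F) * x ^ 2) = 1 := by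
      have h2 : p.valuation F (1 + ((u : F) * x ^ 2 - 1)) = p.valuation F 1 :=
        Valuation.map_add_eq_of_lt_left _ (by simpa using hx)
      simpa using h2
    rw [map_mul, hu, one_mul, map_pow] at hv
    have hvx : p.valuation F x = 1 := by
      exact (pow_eq_one_iff_of_nonneg zero_le two_ne_zero).1 hv
    obtain ⟨b, hb⟩ := exists_residue (p := p) (x := x⁻¹) (by rw [map_inv₀, hvx]; simp)
    refine ⟨Ideal.Quotient.mk p.asIdeal b, ?_⟩
    rw [← map_mul, ← sub_eq_zero, ← map_sub, mk_eq_zero_iff]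
    have hx0 : x ≠ 0 := by rintro rfl; simp at hvx
    have hb1 : p.valuation F (algebraMap (𝓞 F) F b) ≤ 1 := p.valuation_le_one b
    have : algebraMap (𝓞 F) F (a - b * b) = -(u - algebraMap (𝓞 F) F a) +
        (u * x ^ 2 - 1) * (x⁻¹ * x⁻¹) + (x⁻¹ - algebraMap (𝓞 F) F b) *
          (x⁻¹ + algebraMap (𝓞 F) F b) := by
      simp only [map_sub, map_mul]
      field_simp
      ring
    rw [this]
    refine (Valuation.map_add_lt _ (Valuation.map_add_lt _ ?_ ?_) ?_)
    · rwa [Valuation.map_neg]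
    · simp only [map_mul, map_inv₀, hvx]; simpa using hx
    · rw [map_mul]
      refine mul_lt_one_of_nonneg_of_lt_one_left zero_le hb ?_
      refine (Valuation.map_add_le _ (g := 1) ?_ hb1)
      rw [map_inv₀, hvx]; simp
  · rintro ⟨b, hb⟩
    obtain ⟨b, rfl⟩ := Ideal.Quotient.mk_surjective b
    rw [← map_mul, ← sub_eq_zero, ← map_sub, mk_eq_zero_iff] at hb
    have h1 : p.valuation F ((u : F) - algebraMap (𝓞 F) F b ^ 2) < 1 := by
      have : (u : F) - algebraMap (𝓞 F) F b ^ 2 = (u - algebraMap (𝓞 F) F a) +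
        algebraMap (𝓞 F) F (a - b * b) := by simp only [map_sub, map_mul]; ring
      rw [this]
      exact Valuation.map_add_lt _ ha hb
    have hvb : p.valuation F (algebraMap (𝓞 F) F b ^ 2) = 1 := by
      have := Valuation.map_sub_eq_of_lt_left (p.valuation F) (x := (u : F)) (y := u - algebraMap (𝓞 F) F b ^ 2)
        (by rw [hu]; exact h1)
      rw [hu] at this
      simpa using this
    have hb0 : algebraMap (𝓞 F) F b ≠ 0 := by
      intro h0; rw [h0] at hvb; simp at hvb
    rw [locSq_congr (w := (Units.mk0 _ hb0) ^ 2)]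
    · exact sq_mem_locSq _
    · push_cast
      rw [map_mul, h4, Units.val_mk0, hvb, one_mul]
      exact h1

lemma mul_mem_locSq_of_units (hp : Odd' p) {u w : Fˣ} (hu : lv p u = 0) (hw : lv p w = 0)
    (hu' : u ∉ LocSq p) (hw' : w ∉ LocSq p) : u * w ∈ LocSq p := by
  obtain ⟨a, ha⟩ := exists_residue (p := p) (x := (u : F)) (lv_eq_zero_iff.1 hu).le
  obtain ⟨b, hb⟩ := exists_residue (p := p) (x := (w : F)) (lv_eq_zero_iff.1 hw).le
  have hab : p.valuation F (((u * w : Fˣ) : F) - algebraMap (𝓞 F) F (a * b)) < 1 := by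
    have : ((u * w : Fˣ) : F) - algebraMap (𝓞 F) F (a * b) = u * (w - algebraMap (𝓞 F) F b) +
      algebraMap (𝓞 F) F b * (u - algebraMap (𝓞 F) F a) := by
      push_cast [map_mul]; ring
    rw [this]
    refine Valuation.map_add_lt _ ?_ ?_
    · rw [map_mul, lv_eq_zero_iff.1 hu, one_mul]; exact hb
    · rw [map_mul]
      exact mul_lt_one_of_nonneg_of_lt_one_right (p.valuation_le_one b) zero_le ha
  rw [int_mem_locSq_iff hp hu ha] at hu'
  rw [int_mem_locSq_iff hp hw hb] at hw'
  rw [int_mem_locSq_iff hp (by rw [lv_mul, hu, hw]; rfl) hab, map_mul]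
  classical
  have := Fintype.ofFinite (ResField p)
  have hc := ringChar_ne_two hp
  rw [← quadraticChar_neg_one_iff_not_isSquare] at hu' hw'
  have h3 : quadraticChar (ResField p) (Ideal.Quotient.mk p.asIdeal a * Ideal.Quotient.mk p.asIdeal b) = 1 := by
    rw [map_mul, hu', hw']; rfl
  by_contra h
  rw [← quadraticChar_neg_one_iff_not_isSquare, h3] at h
  norm_num at h

lemma unit_of_int {a : 𝓞 F} (ha : Ideal.Quotient.mk p.asIdeal a ≠ 0) :
    ∃ u : Fˣ, (u : F) = algebraMap (𝓞 F) F a ∧ lv p u = 0 := by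
  have h0 : algebraMap (𝓞 F) F a ≠ 0 := by
    intro h
    apply ha
    have : a = 0 := by simpa using h
    rw [this, map_zero]
  refine ⟨Units.mk0 _ h0, rfl, ?_⟩
  rw [lv_eq_zero_iff, Units.val_mk0]
  rw [ne_eq, mk_eq_zero_iff] at ha
  exact le_antisymm (p.valuation_le_one a) (not_lt.1 ha)

lemma exists_unit_notMem_locSq (hp : Odd' p) : ∃ u : Fˣ, lv p u = 0 ∧ u ∉ LocSq p := by
  obtain ⟨a, ha⟩ := FiniteField.exists_nonsquare (F := ResField p) (ringChar_ne_two hp)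
  obtain ⟨a, rfl⟩ := Ideal.Quotient.mk_surjective a
  obtain ⟨u, hu, h0⟩ := unit_of_int (a := a) (fun h => ha (h ▸ IsSquare.zero))
  refine ⟨u, h0, ?_⟩
  rwa [int_mem_locSq_iff hp h0 (a := a) (by simp [hu])]

/-- Units of the form `1 + z ^ 2` representing the nonsquare class. -/
lemma exists_one_add_sq (hp : Odd' p) : ∃ z : 𝓞 F, ∃ u : Fˣ,
    (u : F) = 1 + (algebraMap (𝓞 F) F z) ^ 2 ∧ lv p u = 0 ∧ u ∉ LocSq p := by
  have : ∃ z : ResField p, ¬ IsSquare (1 + z ^ 2) := by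
    by_contra! h
    -- otherwise the squares are closed under adding `1`
    have := Fintype.ofFinite (ResField p)
    obtain ⟨a, ha⟩ := FiniteField.exists_nonsquare (F := ResField p) (ringChar_ne_two hp)
    have h3 : ∀ x y : ResField p, ∃ z, x ^ 2 + y ^ 2 = z ^ 2 := by
      intro x y
      rcases eq_or_ne x 0 with rfl | hx
      · exact ⟨y, by ring⟩
      · obtain ⟨z, hz⟩ := h (y / x)
        refine ⟨z * x, ?_⟩
        field_simp at hz
        rw [mul_pow, hz]; ring
    obtain ⟨c, d, hcd⟩ : ∃ c d : ResField p, a = c ^ 2 + d ^ 2 := by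
      obtain ⟨c, d, h⟩ := FiniteField.exists_root_sum_quadratic (R := ResField p)
        (f := Polynomial.X ^ 2) (g := Polynomial.X ^ 2 - Polynomial.C a)
        (by simp) (Polynomial.degree_X_pow_sub_C (by norm_num) a)
        (FiniteField.odd_card_of_char_ne_two (ringChar_ne_two hp))
      simp only [Polynomial.eval_pow, Polynomial.eval_X, Polynomial.eval_sub, Polynomial.eval_C] at h
      exact ⟨c, d, by linear_combination -h⟩
    obtain ⟨z, hz⟩ := h3 c d
    exact ha ⟨z, by rw [hcd, hz]; ring⟩
  obtain ⟨z, hz⟩ := this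
  obtain ⟨z, rfl⟩ := Ideal.Quotient.mk_surjective z
  obtain ⟨u, hu, h0⟩ := unit_of_int (p := p) (a := 1 + z ^ 2)
    (fun h => hz (by rw [map_add, map_one, map_pow] at h; rw [h]; exact IsSquare.zero))
  refine ⟨z, u, by simpa using hu, h0, ?_⟩
  rw [int_mem_locSq_iff hp h0 (a := 1 + z ^ 2) (by simp [hu])]
  simpa using hz

/-- The group of nonzero values of `x ^ 2 - b y ^ 2`. -/
def normGrp (b : F) : Subgroup Fˣ where
  carrier := {u | ∃ x y : F, (u : F) = x ^ 2 - b * y ^ 2}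
  one_mem' := ⟨1, 0, by simp⟩
  mul_mem' := by
    rintro u w ⟨x, y, h⟩ ⟨z, t, h'⟩
    exact ⟨x * z + b * y * t, x * t + y * z, by push_cast; rw [h, h']; ring⟩
  inv_mem' := by
    rintro u ⟨x, y, h⟩
    refine ⟨x / u, y / u, ?_⟩
    have := u.ne_zero
    push_cast
    field_simp
    rw [h]

omit [NumberField F] in
lemma mem_normGrp {b : F} {u : Fˣ} : u ∈ normGrp b ↔ ∃ x y : F, (u : F) = x ^ 2 - b * y ^ 2 :=
  Iff.rfl

variable (p) in
/-- The local norm group. -/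
def locNm (b : F) : Subgroup Fˣ := normGrp b ⊔ LocSq p

lemma locSq_le_locNm {b : F} : LocSq p ≤ locNm p b := le_sup_right

lemma normGrp_le_locNm {b : F} : normGrp b ≤ locNm p b := le_sup_left

/-- Norms have the obvious valuation and local class. -/
lemma even_of_mem_normGrp {b : Fˣ} (hp : Odd' p) (hb : Even (lv p b)) (hb' : b ∉ LocSq p)
    {u : Fˣ} (hu : u ∈ normGrp (b : F)) : Even (lv p u) := by
  obtain ⟨w, hw⟩ := exists_unit_of_even hb
  obtain ⟨x, y, h⟩ := hu
  rcases eq_or_ne y 0 with rfl | hy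
  · have hx : x ≠ 0 := by rintro rfl; simp at h
    have : u = (Units.mk0 x hx) ^ 2 := by ext; simp [h]
    rw [this, lv_pow]; exact even_two_mul _
  -- write `u = y² w⁻² ((x w / y)² - b w²)`
  set z : F := x * w / y with hz
  have hnot : ¬ p.valuation F (z ^ 2 - (b * w ^ 2 : Fˣ)) < 1 := by
    intro hlt
    have hbw := lv_eq_zero_iff.1 hw
    have hz1 : p.valuation F (z ^ 2) = 1 := by
      have := Valuation.map_add_eq_of_lt_right (p.valuation F) (x := z ^ 2 - (b * w ^ 2 : Fˣ))
        (y := ((b * w ^ 2 : Fˣ) : F)) (by rw [hbw]; exact hlt)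
      rw [hbw] at this
      simpa using this
    have hz0 : z ≠ 0 := by intro h0; rw [h0] at hz1; simp at hz1
    apply hb'
    rw [← mul_sq_mem_locSq_iff (u := w), locSq_congr (w := (Units.mk0 z hz0) ^ 2)]
    · exact sq_mem_locSq _
    · rw [map_mul, valuation_four_of_odd hp, one_mul, Valuation.map_sub_swap]
      push_cast at hz1 hlt ⊢
      rw [Units.val_mk0, hz1]; exact hlt
  rw [not_lt] at hnot
  have hu2 : (u : F) = (y / w) ^ 2 * (z ^ 2 - (b * w ^ 2 : Fˣ)) := by
    rw [h, hz]
    have := w.ne_zero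
    push_cast
    field_simp
  have hz0 : z ^ 2 - ((b * w ^ 2 : Fˣ) : F) ≠ 0 := by
    intro h0; rw [h0, mul_zero] at hu2; exact u.ne_zero hu2
  have hu3 : u = (Units.mk0 y hy / w) ^ 2 * Units.mk0 _ hz0 := by
    ext; push_cast; exact hu2
  have heven : Even (lv p (Units.mk0 _ hz0)) := by
    rcases le_or_gt (p.valuation F z) 1 with h1 | h1
    · have : lv p (Units.mk0 _ hz0) = 0 := by
        rw [lv_eq_zero_iff]
        refine le_antisymm ?_ hnot
        refine Valuation.map_sub_le _ ?_ ?_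
        · rw [map_pow]; exact pow_le_one' h1 2
        · exact (lv_eq_zero_iff.1 hw).le
      rw [this]; exact Even.zero
    · have hz00 : z ≠ 0 := by rintro h0; rw [h0] at h1; simp at h1
      have : lv p (Units.mk0 _ hz0) = lv p (Units.mk0 z hz00 ^ 2) := by
        rw [lv, lv, Units.val_mk0]
        congr 1
        push_cast
        rw [Units.val_mk0]
        have := lv_eq_zero_iff.1 hw
        push_cast at this
        apply Valuation.map_sub_eq_of_lt_left
        rw [this, map_pow]
        exact one_lt_pow' h1 (by norm_num)
      rw [this, lv_pow]; exact even_two_mul _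
  rw [hu3, lv_mul, lv_pow]
  exact Even.add (even_two_mul _) heven

lemma even_of_mem_locNm {b : Fˣ} (hp : Odd' p) (hb : Even (lv p b)) (hb' : b ∉ LocSq p)
    {u : Fˣ} (hu : u ∈ locNm p (b : F)) : Even (lv p u) := by
  obtain ⟨n, hn, l, hl, rfl⟩ := Subgroup.mem_sup.1 hu
  rw [lv_mul]
  exact (even_of_mem_normGrp hp hb hb' hn).add (even_lv_of_mem_locSq hl)

lemma odd_unit_mem_locNm {b : Fˣ} (hp : Odd' p) (hb : ¬ Even (lv p b))
    {u : Fˣ} (hu : u ∈ locNm p (b : F)) (hu0 : Even (lv p u)) : u ∈ LocSq p := by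
  obtain ⟨n, hn, l, hl, rfl⟩ := Subgroup.mem_sup.1 hu
  refine (LocSq p).mul_mem ?_ hl
  rw [lv_mul] at hu0
  have hn0 : Even (lv p n) := by
    have := hu0.sub (even_lv_of_mem_locSq hl); simpa using this
  obtain ⟨x, y, h⟩ := hn
  rcases eq_or_ne y 0 with rfl | hy
  · have hx : x ≠ 0 := by rintro rfl; simp at h
    have : n = (Units.mk0 x hx) ^ 2 := by ext; simp [h]
    rw [this]; exact sq_mem_locSq _
  have hby : ¬ Even (lv p (b * Units.mk0 y hy ^ 2)) := by
    rw [lv_mul, lv_pow, Int.even_add]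
    simp [hb]
  rcases eq_or_ne x 0 with rfl | hx
  · exfalso
    apply hby
    have : (b * Units.mk0 y hy ^ 2) = -n := by ext; push_cast; rw [h]; simp
    rw [this]
    simpa [lv] using hn0
  have key : lv p (Units.mk0 x hx ^ 2) ≠ lv p (b * Units.mk0 y hy ^ 2) := by
    intro h; rw [← h, lv_pow] at hby; exact hby (even_two_mul _)
  rcases lt_or_gt_of_ne key with hlt | hlt
  · exfalso
    apply hby
    rw [lv_lt_iff] at hlt
    have : lv p n = lv p (b * Units.mk0 y hy ^ 2) := by
      rw [lv, lv, h]
      push_cast at hlt ⊢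
      congr 1
      exact Valuation.map_sub_eq_of_lt_right _ hlt
    rwa [this] at hn0
  · rw [lv_lt_iff] at hlt
    rw [locSq_congr (w := Units.mk0 x hx ^ 2)]
    · exact sq_mem_locSq _
    · rw [map_mul, valuation_four_of_odd hp, one_mul]
      push_cast at hlt ⊢
      rw [h, Units.val_mk0]
      have : x ^ 2 - b * y ^ 2 - x ^ 2 = - (b * y ^ 2) := by ring
      rw [this, Valuation.map_neg]
      exact hlt

end

section

lemma index_range_pow {G : Type*} [CommGroup G] [Finite G] (n : ℕ) :
    (powMonoidHom n : G →* G).range.index = Nat.card (powMonoidHom n : G →* G).ker := by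
  have h1 := (powMonoidHom n : G →* G).range.card_mul_index
  have h2 := (powMonoidHom n : G →* G).ker.card_mul_index
  rw [Subgroup.index_ker] at h2
  have h3 : 0 < Nat.card (powMonoidHom n : G →* G).range := Nat.card_pos
  exact Nat.eq_of_mul_eq_mul_left h3 (by rw [h1, ← h2, mul_comm])

variable {F : Type} [Field F] [NumberField F] {p : HeightOneSpectrum (𝓞 F)}

instance (n : ℕ) : Finite (𝓞 F ⧸ p.asIdeal ^ n) :=
  Ring.HasFiniteQuotients.finiteQuotient (pow_ne_zero n p.ne_bot)

lemma card_quot_pow (n : ℕ) :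
    Nat.card (𝓞 F ⧸ p.asIdeal ^ n) = (Ideal.absNorm p.asIdeal) ^ n := by
  rw [← map_pow, Ideal.absNorm_apply, Submodule.cardQuot_apply]

variable (p) in
/-- The ramification exponent of `2`. -/
def twoExp : ℕ := (- lv p (Units.mk0 (2 : F) two_ne_zero)).toNat

lemma valuation_two_eq : p.valuation F (2 : F) = WithZero.exp (-(twoExp p : ℤ)) := by
  have h : lv p (Units.mk0 (2 : F) two_ne_zero) ≤ 0 := by
    have := valuation_two_le_one (F := F) p
    rw [← not_lt, ← lv_one (p := p), lv_lt_iff]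
    simpa using this
  rw [twoExp, Int.toNat_of_nonneg (by omega), neg_neg, exp_lv, Units.val_mk0]

lemma valuation_four_eq_exp : p.valuation F (4 : F) = WithZero.exp (-(2 * twoExp p : ℤ)) := by
  rw [valuation_four_eq, valuation_two_eq, ← WithZero.exp_nsmul]
  congr 1
  simp

lemma mem_pow_iff {a : 𝓞 F} {n : ℕ} : a ∈ p.asIdeal ^ n ↔
    p.valuation F (algebraMap (𝓞 F) F a) ≤ WithZero.exp (-(n : ℤ)) := by
  rw [p.valuation_of_algebraMap, p.intValuation_le_pow_iff_mem]

lemma card_ker_le (e : ℕ) (he : e = twoExp p) :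
    Nat.card (powMonoidHom 2 : (𝓞 F ⧸ p.asIdeal ^ (2 * e + 1))ˣ →* _).ker
      ≤ 2 * Nat.card (𝓞 F ⧸ p.asIdeal ^ e) := by
  classical
  set R := 𝓞 F ⧸ p.asIdeal ^ (2 * e + 1)
  have hle : p.asIdeal ^ (2 * e + 1) ≤ p.asIdeal ^ (e + 1) := Ideal.pow_le_pow_right (by omega)
  let f : R →+* 𝓞 F ⧸ p.asIdeal ^ (e + 1) := Ideal.Quotient.factor hle
  have hf : Function.Surjective f := Ideal.Quotient.factor_surjective hle
  have hcard : Nat.card f.toAddMonoidHom.ker = Nat.card (𝓞 F ⧸ p.asIdeal ^ e) := by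
    have h1 := AddSubgroup.card_mul_index f.toAddMonoidHom.ker
    rw [AddSubgroup.index_ker] at h1
    have h2 : Nat.card f.toAddMonoidHom.range = Nat.card (𝓞 F ⧸ p.asIdeal ^ (e + 1)) := by
      have h3 : f.toAddMonoidHom.range = ⊤ := AddMonoidHom.range_eq_top.2 hf
      rw [h3]
      exact Nat.card_congr AddSubgroup.topEquiv.toEquiv
    have hpos : 0 < Nat.card (𝓞 F ⧸ p.asIdeal ^ (e + 1)) := Nat.card_pos
    rw [h2] at h1
    refine Nat.eq_of_mul_eq_mul_right hpos ?_
    rw [h1, card_quot_pow, card_quot_pow, card_quot_pow, ← pow_add]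
    congr 1; omega
  have key : ∀ x : Rˣ, x ^ 2 = 1 → f ((x : R) - 1) = 0 ∨ f ((x : R) + 1) = 0 := by
    intro x hx
    obtain ⟨a, ha⟩ := Ideal.Quotient.mk_surjective (x : R)
    have h1 : (a - 1) * (a + 1) ∈ p.asIdeal ^ (2 * e + 1) := by
      rw [← Ideal.Quotient.eq_zero_iff_mem]
      have : (x : R) ^ 2 = 1 := by
        rw [← Units.val_pow_eq_pow_val, hx, Units.val_one]
      simp only [map_mul, map_sub, map_add, map_one, ha]
      linear_combination this
    have h2 : a - 1 ∈ p.asIdeal ^ (e + 1) ∨ a + 1 ∈ p.asIdeal ^ (e + 1) := by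
      by_contra! h
      simp only [mem_pow_iff, not_le] at h
      rw [mem_pow_iff, map_mul, map_mul] at h1
      obtain ⟨h3, h4⟩ := h
      rcases eq_or_ne (p.valuation F (algebraMap (𝓞 F) F (a - 1))) 0 with h0 | h0
      · rw [h0] at h3; exact absurd h3 (by simp)
      rcases eq_or_ne (p.valuation F (algebraMap (𝓞 F) F (a + 1))) 0 with h0' | h0'
      · rw [h0'] at h4; exact absurd h4 (by simp)
      rw [← WithZero.exp_log h0, WithZero.exp_lt_exp] at h3
      rw [← WithZero.exp_log h0', WithZero.exp_lt_exp] at h4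
      rw [← WithZero.exp_log h0, ← WithZero.exp_log h0', ← WithZero.exp_add,
        WithZero.exp_le_exp] at h1
      push_cast at h1 h3 h4
      omega
    have h3 : (x : R) - 1 = Ideal.Quotient.mk _ (a - 1) := by simp [ha]
    have h4 : (x : R) + 1 = Ideal.Quotient.mk _ (a + 1) := by simp [ha]
    rw [h3, h4]
    change Ideal.Quotient.mk _ (a - 1) = 0 ∨ Ideal.Quotient.mk _ (a + 1) = 0
    rwa [Ideal.Quotient.eq_zero_iff_mem, Ideal.Quotient.eq_zero_iff_mem]
  let g : (powMonoidHom 2 : Rˣ →* Rˣ).ker → Bool × f.toAddMonoidHom.ker := fun x =>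
    if h : f (((x : Rˣ) : R) - 1) = 0 then (true, ⟨_, h⟩)
    else (false, ⟨((x : Rˣ) : R) + 1, (key x (MonoidHom.mem_ker.1 x.2)).resolve_left h⟩)
  have hg : Function.Injective g := by
    intro x y hxy
    simp only [g] at hxy
    split_ifs at hxy with h1 h2 h2
    · exact Subtype.ext (Units.ext (sub_left_injective (congrArg Subtype.val (congrArg Prod.snd hxy))))
    · simp at hxy
    · simp at hxy
    · exact Subtype.ext (Units.ext (add_left_injective _ (congrArg Subtype.val (congrArg Prod.snd hxy))))
  have : Finite f.toAddMonoidHom.ker := inferInstance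
  refine (Nat.card_le_card_of_injective g hg).trans ?_
  rw [Nat.card_prod, hcard]
  simp

lemma index_locSq_le :
    (LocSq p).index ≠ 0 ∧ (LocSq p).index ≤ 4 * Nat.card (𝓞 F ⧸ p.asIdeal ^ (twoExp p)) := by
  classical
  set e := twoExp p with he
  set R := 𝓞 F ⧸ p.asIdeal ^ (2 * e + 1) with hR
  have hlift : ∀ r : Rˣ, ∃ u : Fˣ, lv p u = 0 ∧ ∃ a : 𝓞 F, Ideal.Quotient.mk _ a = (r : R) ∧
      (u : F) = algebraMap (𝓞 F) F a := by
    intro r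
    obtain ⟨a, ha⟩ := Ideal.Quotient.mk_surjective (r : R)
    have : Ideal.Quotient.mk p.asIdeal a ≠ 0 := by
      intro h0
      have hle : p.asIdeal ^ (2 * e + 1) ≤ p.asIdeal := Ideal.pow_le_self (by omega)
      have h1 : Ideal.Quotient.factor hle (r : R) = 0 := by
        rw [← ha, Ideal.Quotient.factor_mk]; exact h0
      have h2 := (r.isUnit).map (Ideal.Quotient.factor hle)
      rw [h1] at h2
      exact not_isUnit_zero h2
    obtain ⟨u, hu, h0⟩ := unit_of_int this
    exact ⟨u, h0, a, ha, hu⟩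
  choose U hU0 A hA hUA using hlift
  have h4 := valuation_four_eq_exp (F := F) (p := p)
  rw [← he] at h4
  have hclose : ∀ (a : 𝓞 F) (u : Fˣ) (r : Rˣ), Ideal.Quotient.mk _ a = (r : R) →
      p.valuation F ((u : F) - algebraMap (𝓞 F) F a) < p.valuation F 4 → lv p u = 0 →
        (U r * u⁻¹ ∈ LocSq p) := by
    intro a u r har hau hu0
    rw [lv_eq_zero_iff] at hu0
    apply mem_locSq_of_sub_one_lt
    have h1 : ((U r * u⁻¹ : Fˣ) : F) - 1 = (algebraMap (𝓞 F) F (A r - a) -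
        (u - algebraMap (𝓞 F) F a)) * (u : F)⁻¹ := by
      have := u.ne_zero
      push_cast [map_sub]
      rw [hUA]
      field_simp
      ring
    rw [h1, map_mul, map_inv₀, hu0, inv_one, mul_one]
    refine Valuation.map_sub_lt _ ?_ hau
    have h2 : A r - a ∈ p.asIdeal ^ (2 * e + 1) := by
      rw [← Ideal.Quotient.eq, hA, har]
    rw [mem_pow_iff] at h2
    rw [h4]
    refine h2.trans_lt ?_
    rw [WithZero.exp_lt_exp]
    push_cast; omega
  obtain ⟨π, hπ⟩ := exists_uniformizer p
  let g0 : Rˣ ⧸ (powMonoidHom 2 : Rˣ →* Rˣ).range → Fˣ ⧸ LocSq p :=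
    Quotient.lift (fun r => (QuotientGroup.mk (U r) : Fˣ ⧸ LocSq p)) (by
      intro r r' h
      rw [← Quotient.eq_iff_equiv, Quotient.eq, QuotientGroup.leftRel_apply] at h
      obtain ⟨s, hs⟩ := h
      simp only [powMonoidHom_apply] at hs
      have hr' : r' = r * s ^ 2 := by rw [hs]; simp
      rw [QuotientGroup.eq, mul_comm]
      have h1 := hclose (A r * A s ^ 2) (U r * U s ^ 2) r' (by
        rw [hr']; push_cast [map_mul, map_pow]; rw [hA, hA]) (by
        push_cast [map_mul, map_pow]; rw [hUA, hUA]
        rw [sub_self, map_zero]; exact valuation_four_pos p) (by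
        rw [lv_mul, lv_pow, hU0, hU0]; simp)
      have h2 := (LocSq p).mul_mem h1 (sq_mem_locSq (U s))
      convert h2 using 1
      rw [mul_inv, mul_assoc, mul_assoc, inv_mul_cancel, mul_one])
  let g : (Rˣ ⧸ (powMonoidHom 2 : Rˣ →* Rˣ).range) × Bool → Fˣ ⧸ LocSq p :=
    fun x => g0 x.1 * (if x.2 then QuotientGroup.mk π else 1)
  have hg : Function.Surjective g := by
    have hev : ∀ c : Fˣ, Even (lv p c) → ∃ x, g0 x = QuotientGroup.mk c := by
      intro c hc
      obtain ⟨w, hw⟩ := exists_unit_of_even hc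
      obtain ⟨a, ha⟩ := exists_int_near (lv_eq_zero_iff.1 hw).le (2 * e)
      push_cast at ha
      rw [← h4, Valuation.map_sub_swap] at ha
      have hau : IsUnit (Ideal.Quotient.mk (p.asIdeal ^ (2 * e + 1)) a) := by
        rw [isUnit_iff_exists_inv]
        have ha0 : a ∉ p.asIdeal := by
          intro ham
          rw [← p.valuation_lt_one_iff_mem (K := F)] at ham
          have := Valuation.map_add_lt _ (ha.trans_le (valuation_four_le_one p)) ham
          push_cast at hw
          rw [sub_add_cancel, ← Units.val_pow_eq_pow_val, ← Units.val_mul,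
            lv_eq_zero_iff.1 hw] at this
          exact lt_irrefl _ this
        have hcop : IsCoprime (Ideal.span {a}) (p.asIdeal ^ (2 * e + 1)) := by
          apply IsCoprime.pow_right
          rw [Ideal.isCoprime_iff_sup_eq, sup_comm]
          exact (p.isMaximal.out).2 _ (lt_of_le_of_ne le_sup_left (fun h => ha0 (by
            rw [h]; exact Ideal.mem_sup_right (Ideal.mem_span_singleton_self a))))
        rw [Ideal.isCoprime_iff_exists] at hcop
        obtain ⟨x, hx, y, hy, hxy⟩ := hcop
        obtain ⟨b, rfl⟩ := Ideal.mem_span_singleton'.1 hx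
        refine ⟨Ideal.Quotient.mk _ b, ?_⟩
        rw [← map_mul, ← map_one (Ideal.Quotient.mk _), Ideal.Quotient.eq, ← hxy]
        have : a * b - (b * a + y) = -y := by ring
        rw [this]; exact neg_mem hy
      obtain ⟨r, hr⟩ := hau
      refine ⟨QuotientGroup.mk r, ?_⟩
      change (QuotientGroup.mk (U r) : Fˣ ⧸ LocSq p) = _
      have h1 := hclose a _ r hr.symm (by exact_mod_cast ha) hw
      rw [QuotientGroup.eq, ← (LocSq p).inv_mem_iff]
      have h2 := (LocSq p).mul_mem h1 (sq_mem_locSq w)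
      convert h2 using 1
      rw [mul_inv, mul_inv, inv_inv, mul_assoc, mul_assoc, inv_mul_cancel, mul_one]
    intro c
    obtain ⟨c, rfl⟩ := QuotientGroup.mk_surjective c
    by_cases hc : Even (lv p c)
    · obtain ⟨x, hx⟩ := hev c hc
      exact ⟨(x, false), (mul_one _).trans hx⟩
    · obtain ⟨x, hx⟩ := hev (c * π⁻¹) (by
        rw [lv_mul, lv_inv, hπ, neg_neg, Int.even_add]
        simp [hc])
      refine ⟨(x, true), ?_⟩
      simp only [g, hx, if_true]
      rw [← QuotientGroup.mk_mul, inv_mul_cancel_right]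
  have : Finite (Fˣ ⧸ LocSq p) := Finite.of_surjective g hg
  refine ⟨?_, ?_⟩
  · rw [Subgroup.index]; exact Nat.card_pos.ne'
  · rw [Subgroup.index]
    refine (Nat.card_le_card_of_surjective g hg).trans ?_
    rw [Nat.card_prod]
    have h1 := card_ker_le (p := p) e he
    have h2 : Nat.card (Rˣ ⧸ (powMonoidHom 2 : Rˣ →* Rˣ).range) =
      Nat.card (powMonoidHom 2 : Rˣ →* Rˣ).ker := index_range_pow 2
    rw [h2]
    simp only [Nat.card_eq_fintype_card (α := Bool), Fintype.card_bool]
    linarith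

lemma two_mem_pow_twoExp : (2 : 𝓞 F) ∈ p.asIdeal ^ twoExp p := by
  rw [mem_pow_iff]
  rw [map_ofNat, valuation_two_eq]

lemma prod_card_le (S : Finset (HeightOneSpectrum (𝓞 F))) :
    ∏ p ∈ S, Nat.card (𝓞 F ⧸ p.asIdeal ^ (twoExp p)) ≤ 2 ^ Module.finrank ℚ F := by
  have h1 : ∏ p ∈ S, p.asIdeal ^ (twoExp p) ∣ Ideal.span {(2 : 𝓞 F)} := by
    apply Finset.prod_dvd_of_coprime
    · intro p _ q _ hpq
      apply IsCoprime.pow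
      rw [Ideal.isCoprime_iff_sup_eq]
      exact p.isMaximal.coprime_of_ne q.isMaximal (fun h => hpq (HeightOneSpectrum.ext h))
    · intro p _
      rw [Ideal.dvd_span_singleton]
      exact two_mem_pow_twoExp
  have h2 := map_dvd Ideal.absNorm h1
  have h3 : Ideal.absNorm (Ideal.span {(2 : 𝓞 F)}) = 2 ^ Module.finrank ℚ F := by
    rw [Ideal.absNorm_span_singleton]
    have : (2 : 𝓞 F) = algebraMap ℤ (𝓞 F) 2 := by simp
    rw [this, Algebra.norm_algebraMap, Int.natAbs_pow, RingOfIntegers.rank]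
    rfl
  rw [h3, map_prod] at h2
  have h4 := Nat.le_of_dvd (by positivity) h2
  refine le_trans (le_of_eq ?_) h4
  refine Finset.prod_congr rfl fun p _ => ?_
  rw [card_quot_pow, map_pow]

end

section

/-- The index of the squares in a commutative group. -/
def sqIndex (G : Type*) [CommGroup G] : ℕ := (powMonoidHom 2 : G →* G).range.index

lemma sqIndex_congr {G H : Type*} [CommGroup G] [CommGroup H] (e : G ≃* H) :
    sqIndex G = sqIndex H := by
  have : (powMonoidHom 2 : G →* G).range = (powMonoidHom 2 : H →* H).range.comap e.toMonoidHom := by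
    ext x
    simp only [MonoidHom.mem_range, powMonoidHom_apply, Subgroup.mem_comap]
    constructor
    · rintro ⟨y, rfl⟩
      exact ⟨e y, by simp⟩
    · rintro ⟨y, hy⟩
      refine ⟨e.symm y, ?_⟩
      apply e.injective
      simpa using hy
  rw [sqIndex, sqIndex, this, Subgroup.index_comap_of_surjective _ e.surjective]

lemma sqIndex_prod (G H : Type*) [CommGroup G] [CommGroup H] :
    sqIndex (G × H) = sqIndex G * sqIndex H := by
  have : (powMonoidHom 2 : G × H →* G × H).range =
      (powMonoidHom 2 : G →* G).range.prod (powMonoidHom 2 : H →* H).range := by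
    ext ⟨x, y⟩
    simp only [MonoidHom.mem_range, powMonoidHom_apply, Subgroup.mem_prod, Prod.exists,
      Prod.pow_mk, Prod.mk.injEq]
    constructor
    · rintro ⟨a, b, h1, h2⟩
      exact ⟨⟨a, h1⟩, ⟨b, h2⟩⟩
    · rintro ⟨⟨a, h1⟩, ⟨b, h2⟩⟩
      exact ⟨a, b, h1, h2⟩
  rw [sqIndex, this, Subgroup.index_prod]; rfl

lemma sqIndex_int : sqIndex (Multiplicative ℤ) = 2 := by
  have : (powMonoidHom 2 : Multiplicative ℤ →* Multiplicative ℤ).range =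
      AddSubgroup.toSubgroup (AddSubgroup.zmultiples (2 : ℤ)) := by
    ext x
    simp only [MonoidHom.mem_range, powMonoidHom_apply]
    constructor
    · rintro ⟨y, rfl⟩
      refine ⟨y.toAdd, ?_⟩
      rw [toAdd_pow]
      change y.toAdd • (2 : ℤ) = _
      simp [mul_comm]
    · rintro ⟨k, hk⟩
      refine ⟨Multiplicative.ofAdd k, ?_⟩
      apply Multiplicative.toAdd.injective
      rw [← hk]
      rw [toAdd_pow]
      change 2 • k = k • (2 : ℤ)
      simp [mul_comm]
  rw [sqIndex, this]
  have h := Int.index_zmultiples 2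
  simpa using h

lemma sqIndex_pi (n : ℕ) : sqIndex (Fin n → Multiplicative ℤ) = 2 ^ n := by
  induction n with
  | zero =>
    rw [sqIndex, Subgroup.index_eq_one.2]
    · simp
    · exact Subsingleton.elim _ _
  | succ n ih =>
    rw [pow_succ', ← ih]
    conv_rhs => rw [← sqIndex_int]
    rw [← sqIndex_prod]
    refine (sqIndex_congr (MulEquiv.mk' (Fin.consEquiv (fun _ => Multiplicative ℤ)) ?_)).symm
    intro x y
    ext i
    refine Fin.cases ?_ (fun j => ?_) i <;> simp [Fin.consEquiv]

variable {F : Type} [Field F] [NumberField F] {p : HeightOneSpectrum (𝓞 F)}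

/-- The group of `S`-units. -/
def sUnit (S : Set (HeightOneSpectrum (𝓞 F))) : Subgroup Fˣ where
  carrier := {u | ∀ p ∉ S, lv p u = 0}
  one_mem' := fun p _ => lv_one
  mul_mem' := fun ha hb p hp => by rw [lv_mul, ha p hp, hb p hp, add_zero]
  inv_mem' := fun ha p hp => by rw [lv_inv, ha p hp, neg_zero]

lemma sUnit_mono {S T : Set (HeightOneSpectrum (𝓞 F))} (h : S ⊆ T) :
    sUnit S ≤ sUnit T := fun _ hu p hp => hu p (fun h' => hp (h h'))

lemma mem_integers {x : F} (h : ∀ p : HeightOneSpectrum (𝓞 F), p.valuation F x ≤ 1) :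
    ∃ a : 𝓞 F, algebraMap (𝓞 F) F a = x :=
  HeightOneSpectrum.mem_integers_of_valuation_le_one F x h

lemma exists_unit_of_mem_sUnit_empty {u : Fˣ} (hu : u ∈ sUnit (F := F) ∅) :
    ∃ w : (𝓞 F)ˣ, ((w : 𝓞 F) : F) = u := by
  have h1 : ∀ u ∈ sUnit (F := F) ∅, ∃ a : 𝓞 F, algebraMap (𝓞 F) F a = (u : F) := by
    intro u hu
    exact mem_integers (fun p => (lv_eq_zero_iff.1 (hu p (by simp))).le)
  obtain ⟨a, ha⟩ := h1 u hu
  obtain ⟨b, hb⟩ := h1 u⁻¹ (inv_mem hu)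
  have hab : a * b = 1 := by
    apply FaithfulSMul.algebraMap_injective (𝓞 F) F
    rw [map_mul, ha, hb, map_one]; simp
  exact ⟨⟨a, b, hab, by rw [mul_comm]; exact hab⟩, ha⟩

lemma sqIndex_torsion : sqIndex (NumberField.Units.torsion F) = 2 := by
  rw [sqIndex, index_range_pow]
  have h1 : (-1 : (𝓞 F)ˣ) ∈ NumberField.Units.torsion F := by
    rw [NumberField.Units.torsion, CommGroup.mem_torsion, isOfFinOrder_iff_pow_eq_one]
    exact ⟨2, by norm_num, by simp⟩
  have hne : (-1 : (𝓞 F)ˣ) ≠ 1 := by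
    intro h
    have := congrArg (Units.val) h
    norm_num at this
  have : ((powMonoidHom 2 : NumberField.Units.torsion F →* NumberField.Units.torsion F).ker :
      Set (NumberField.Units.torsion F)) = {1, ⟨-1, h1⟩} := by
    ext x
    simp only [SetLike.mem_coe, MonoidHom.mem_ker, powMonoidHom_apply, Set.mem_insert_iff,
      Set.mem_singleton_iff]
    constructor
    · intro h
      have h2 : ((x : (𝓞 F)ˣ) : 𝓞 F) ^ 2 = 1 := by
        have := congrArg (fun y : NumberField.Units.torsion F => ((y : (𝓞 F)ˣ) : 𝓞 F)) h
        simpa using this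
      rcases sq_eq_sq_iff_eq_or_eq_neg.1 (h2.trans (one_pow 2).symm) with h3 | h3
      · left; exact Subtype.ext (Units.ext h3)
      · right; exact Subtype.ext (Units.ext (by simpa using h3))
    · rintro (rfl | rfl)
      · simp
      · apply Subtype.ext; simp
  have h3 : Nat.card (powMonoidHom 2 : NumberField.Units.torsion F →* NumberField.Units.torsion F).ker =
      Nat.card ({1, ⟨-1, h1⟩} : Set (NumberField.Units.torsion F)) := by
    rw [← this]; rfl
  rw [h3, Nat.card_coe_set_eq, Set.ncard_pair]
  intro h
  exact hne (congrArg Subtype.val h).symm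

lemma sqIndex_sUnit_empty :
    sqIndex (sUnit (F := F) ∅) = 2 ^ (Fintype.card (InfinitePlace F)) := by
  classical
  let r := NumberField.Units.rank F
  let ψ : NumberField.Units.torsion F × (Fin r → Multiplicative ℤ) →* (𝓞 F)ˣ :=
    { toFun := fun x => x.1 * ∏ i, (NumberField.Units.fundSystem F i) ^ (x.2 i).toAdd
      map_one' := by simp
      map_mul' := by
        intro x y
        simp only [Prod.fst_mul, Prod.snd_mul, Pi.mul_apply, toAdd_mul, zpow_add,
          Finset.prod_mul_distrib, Subgroup.coe_mul]
        exact mul_mul_mul_comm _ _ _ _ }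
  let ι : (𝓞 F)ˣ →* Fˣ := Units.map (algebraMap (𝓞 F) F).toMonoidHom
  let φ := ι.comp ψ
  have hψ : Function.Injective ψ := by
    rintro ⟨a, b⟩ ⟨c, d⟩ h
    obtain ⟨e, he, hu⟩ := NumberField.Units.exist_unique_eq_mul_prod F (ψ (c, d))
    have h1 := hu (a, fun i => (b i).toAdd) h.symm
    have h2 := hu (c, fun i => (d i).toAdd) rfl
    rw [← h2, Prod.mk.injEq] at h1
    refine Prod.ext h1.1 ?_
    funext i
    exact Multiplicative.toAdd.injective (congrFun h1.2 i)
  have hι : Function.Injective ι :=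
    Units.map_injective (FaithfulSMul.algebraMap_injective (𝓞 F) F)
  have hφ : Function.Injective φ := hι.comp hψ
  have hr : φ.range = sUnit ∅ := by
    ext u
    constructor
    · rintro ⟨x, rfl⟩ p _
      rw [lv_eq_zero_iff]
      change p.valuation F ((ψ x : 𝓞 F) : F) = 1
      generalize ψ x = w
      have h1 : ∀ w : (𝓞 F)ˣ, p.valuation F ((w : 𝓞 F) : F) ≤ 1 := fun w => p.valuation_le_one _
      refine le_antisymm (h1 w) ?_
      have h2 := h1 w⁻¹
      have h3 : ((w : 𝓞 F) : F) * ((w⁻¹ : (𝓞 F)ˣ) : 𝓞 F) = 1 := by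
        rw [← map_mul]; simp
      have h4 := congrArg (p.valuation F) h3
      rw [map_mul, map_one] at h4
      have h5 := mul_le_mul_right h2 (p.valuation F ((w : 𝓞 F) : F))
      rw [h4, mul_one] at h5
      exact h5
    · intro hu
      obtain ⟨w, hw⟩ := exists_unit_of_mem_sUnit_empty hu
      obtain ⟨⟨ζ, e⟩, he, -⟩ := NumberField.Units.exist_unique_eq_mul_prod F w
      refine ⟨(ζ, fun i => Multiplicative.ofAdd (e i)), ?_⟩
      ext
      rw [← hw, he]
      rfl
  rw [← hr, ← sqIndex_congr (MonoidHom.ofInjective hφ), sqIndex_prod, sqIndex_torsion, sqIndex_pi,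
    ← pow_succ']
  congr 1
  have : 0 < Fintype.card (InfinitePlace F) := Fintype.card_pos
  simp only [r, NumberField.Units.rank]
  omega

lemma exists_sUnit_singleton (p : HeightOneSpectrum (𝓞 F)) :
    ∃ u ∈ sUnit {p}, lv p u ≠ 0 := by
  obtain ⟨n, hn, h⟩ := (isOfFinOrder_of_finite (ClassGroup.mk0 ⟨p.asIdeal,
    mem_nonZeroDivisors_of_ne_zero p.ne_bot⟩)).exists_pow_eq_one
  rw [← map_pow, ClassGroup.mk0_eq_one_iff] at h
  obtain ⟨⟨a, ha⟩⟩ := h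
  simp only [SubmonoidClass.mk_pow, Ideal.submodule_span_eq] at ha
  have ha0 : a ≠ 0 := by
    rintro rfl
    simp only [Ideal.span_singleton_zero] at ha
    exact pow_ne_zero n p.ne_bot (by simpa using ha)
  have h0 : algebraMap (𝓞 F) F a ≠ 0 := by simpa using ha0
  refine ⟨Units.mk0 _ h0, ?_, ?_⟩
  · intro q hq
    rw [lv_eq_zero_iff, Units.val_mk0]
    refine le_antisymm (q.valuation_le_one a) (not_lt.1 fun hlt => ?_)
    rw [q.valuation_lt_one_iff_mem] at hlt
    apply hq
    have h1 : p.asIdeal ^ n ≤ q.asIdeal := by rw [ha]; exact (Ideal.span_singleton_le_iff_mem _).2 hlt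
    have h2 : p.asIdeal ≤ q.asIdeal := q.isPrime.le_of_pow_le h1
    exact HeightOneSpectrum.ext (p.isMaximal.eq_of_le q.isPrime.ne_top h2).symm
  · intro h
    rw [lv_eq_zero_iff, Units.val_mk0] at h
    have : a ∈ p.asIdeal := by
      have : a ∈ p.asIdeal ^ n := by rw [ha]; exact Ideal.mem_span_singleton_self a
      exact Ideal.pow_le_self hn.ne' this
    rw [← p.valuation_lt_one_iff_mem (K := F)] at this
    exact this.ne h

lemma lv_zpow (u : Fˣ) (k : ℤ) : lv p (u ^ k) = k * lv p u := by
  simp only [lv]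
  rw [Units.val_zpow_eq_zpow_val, map_zpow₀, WithZero.log_zpow]
  simp

lemma sqIndex_insert {S : Set (HeightOneSpectrum (𝓞 F))} (hp : p ∉ S) :
    sqIndex (sUnit (insert p S)) = 2 * sqIndex (sUnit S) := by
  classical
  -- the value group of `p` on the larger group
  let H : AddSubgroup ℤ :=
    { carrier := {n | ∃ u ∈ sUnit (insert p S), lv p u = n}
      zero_mem' := ⟨1, one_mem _, lv_one⟩
      add_mem' := by
        rintro a b ⟨u, hu, rfl⟩ ⟨w, hw, rfl⟩
        exact ⟨u * w, mul_mem hu hw, lv_mul _ _⟩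
      neg_mem' := by
        rintro a ⟨u, hu, rfl⟩
        exact ⟨u⁻¹, inv_mem hu, lv_inv _⟩ }
  obtain ⟨n, hn⟩ := Int.subgroup_cyclic H
  obtain ⟨g, hg, hgn⟩ : n ∈ H := by rw [hn]; exact AddSubgroup.subset_closure rfl
  have hn0 : n ≠ 0 := by
    rintro rfl
    obtain ⟨u, hu, hu0⟩ := exists_sUnit_singleton p
    have : lv p u ∈ H := ⟨u, sUnit_mono (by simp) hu, rfl⟩
    rw [hn] at this
    rw [AddSubgroup.closure_singleton_zero] at this
    exact hu0 this
  let φ : sUnit S × Multiplicative ℤ →* Fˣ :=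
    { toFun := fun x => x.1 * g ^ x.2.toAdd
      map_one' := by simp
      map_mul' := by
        intro x y
        simp only [Prod.fst_mul, Prod.snd_mul, toAdd_mul, zpow_add, Subgroup.coe_mul]
        exact mul_mul_mul_comm _ _ _ _ }
  have hlv : ∀ x, lv p (φ x) = x.2.toAdd * n := by
    intro x
    simp only [φ, MonoidHom.coe_mk, OneHom.coe_mk, lv_mul, lv_zpow, hgn]
    rw [x.1.2 p hp, zero_add]
  have hφ : Function.Injective φ := by
    intro x y h
    have h2 := hlv y
    rw [← h, hlv] at h2
    have h3 := mul_right_cancel₀ hn0 h2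
    have h4 : x.2 = y.2 := Multiplicative.toAdd.injective h3
    refine Prod.ext ?_ h4
    simp only [φ, MonoidHom.coe_mk, OneHom.coe_mk, h4] at h
    exact Subtype.ext (mul_right_cancel h)
  have hr : φ.range = sUnit (insert p S) := by
    ext u
    constructor
    · rintro ⟨x, rfl⟩
      exact mul_mem (sUnit_mono (by simp) x.1.2) (zpow_mem hg _)
    · intro hu
      have : lv p u ∈ H := ⟨u, hu, rfl⟩
      rw [hn] at this
      obtain ⟨k, hk⟩ := AddSubgroup.mem_closure_singleton.1 this
      refine ⟨(⟨u * g ^ (-k), ?_⟩, Multiplicative.ofAdd k), ?_⟩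
      · intro q hq
        by_cases hqp : q = p
        · subst hqp
          rw [lv_mul, lv_zpow, hgn, ← hk]
          simp
        · exact (mul_mem hu (zpow_mem hg _)) q (by simp [hqp, hq])
      · simp [φ]
  rw [← hr, ← sqIndex_congr (MonoidHom.ofInjective hφ), sqIndex_prod, sqIndex_int, mul_comm]

/-- The index of the squares in the group of `S`-units. -/
theorem sqIndex_sUnit (S : Finset (HeightOneSpectrum (𝓞 F))) :
    sqIndex (sUnit (S : Set (HeightOneSpectrum (𝓞 F)))) =
      2 ^ (S.card + Fintype.card (InfinitePlace F)) := by
  classical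
  induction S using Finset.induction_on with
  | empty => rw [Finset.coe_empty, sqIndex_sUnit_empty]; simp
  | insert p S hp ih =>
    rw [Finset.coe_insert, sqIndex_insert (by simpa using hp), ih, Finset.card_insert_of_notMem hp]
    ring

end

section

/-- A quadratic extension `E = F(r)`, `r ^ 2 = c`, with its nontrivial automorphism. -/
structure QuadExt {F : Type} [Field F] (c : F) (E : Type) [Field E] [Algebra F E] where
  /-- the square root of `c` -/
  r : E
  r_sq : r ^ 2 = algebraMap F E c
  /-- the conjugation -/
  σ : E ≃ₐ[F] E
  σ_r : σ r = -r
  rep : ∀ x : E, ∃ u w : F, x = algebraMap F E u + algebraMap F E w * r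
  nonsq : ¬ IsSquare c

open Polynomial in
theorem exists_quadExt {F : Type} [Field F] [NumberField F] {c : F} (hc : ¬ IsSquare c) :
    ∃ (E : Type) (_ : Field E) (_ : NumberField E) (_ : Algebra F E),
      Algebra.IsQuadraticExtension F E ∧ Nonempty (QuadExt c E) := by
  let f : F[X] := X ^ 2 - C c
  have hirr : Irreducible f := by
    apply X_pow_sub_C_irreducible_of_prime Nat.prime_two
    rintro b rfl
    exact hc ⟨b, pow_two b⟩
  have : Fact (Irreducible f) := ⟨hirr⟩
  have : CharZero (AdjoinRoot f) := charZero_of_injective_algebraMap (algebraMap F _).injective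
  have hquad : Algebra.IsQuadraticExtension F (AdjoinRoot f) := by
    constructor
    rw [(AdjoinRoot.powerBasis hirr.ne_zero).finrank, AdjoinRoot.powerBasis_dim]
    exact natDegree_X_pow_sub_C
  have : FiniteDimensional ℚ (AdjoinRoot f) := Module.Finite.trans F _
  have hroot : (AdjoinRoot.root f) ^ 2 = algebraMap F (AdjoinRoot f) c := by
    have := AdjoinRoot.eval₂_root f
    simp only [f, eval₂_sub, eval₂_X_pow, eval₂_C] at this
    exact sub_eq_zero.1 this
  let s : AdjoinRoot f →ₐ[F] AdjoinRoot f := AdjoinRoot.liftAlgHom f (Algebra.ofId F _)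
    (-AdjoinRoot.root f) (by
      have : (-AdjoinRoot.root f) ^ 2 - algebraMap F (AdjoinRoot f) c = 0 := by
        rw [neg_sq, hroot, sub_self]
      simpa [f] using this)
  have hs : s (AdjoinRoot.root f) = - AdjoinRoot.root f := by simp [s]
  have hss : s.comp s = AlgHom.id F _ := by
    apply AdjoinRoot.algHom_ext
    simp [hs]
  refine ⟨AdjoinRoot f, inferInstance, ⟨⟩, inferInstance, hquad, ⟨⟨AdjoinRoot.root f, hroot,
    AlgEquiv.ofAlgHom s s hss hss, hs, ?_, hc⟩⟩⟩
  intro x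
  have hx : x ∈ Algebra.adjoin F {AdjoinRoot.root f} := by
    rw [AdjoinRoot.adjoinRoot_eq_top]; trivial
  induction hx using Algebra.adjoin_induction with
  | mem x hx =>
    obtain rfl := hx
    exact ⟨0, 1, by simp⟩
  | algebraMap a => exact ⟨a, 0, by simp⟩
  | add x y _ _ h1 h2 =>
    obtain ⟨a, b, rfl⟩ := h1
    obtain ⟨a', b', rfl⟩ := h2
    exact ⟨a + a', b + b', by simp only [map_add]; ring⟩
  | mul x y _ _ h1 h2 =>
    obtain ⟨a, b, rfl⟩ := h1
    obtain ⟨a', b', rfl⟩ := h2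
    refine ⟨a * a' + b * b' * c, a * b' + a' * b, ?_⟩
    simp only [map_add, map_mul, ← hroot]; ring

namespace QuadExt

variable {F : Type} [Field F] {c : F} {E : Type} [Field E] [Algebra F E] (Q : QuadExt c E)

include Q

local notation "ι" => algebraMap F E

lemma σ_apply (u w : F) : Q.σ (ι u + ι w * Q.r) = ι u - ι w * Q.r := by
  rw [map_add, map_mul, Q.σ_r, AlgEquiv.commutes, AlgEquiv.commutes]; ring

lemma r_not_mem (u : F) : Q.r ≠ ι u := by
  intro h
  have := Q.r_sq
  rw [h, ← map_pow] at this
  exact Q.nonsq ⟨u, by rw [← pow_two]; exact ((ι).injective this).symm⟩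

lemma eq_zero {u w : F} (h : ι u + ι w * Q.r = 0) : u = 0 ∧ w = 0 := by
  have hw : w = 0 := by
    by_contra hw
    apply Q.r_not_mem (-u / w)
    have : ι w ≠ 0 := by simpa using hw
    rw [map_div₀, map_neg]
    field_simp
    linear_combination h
  subst hw
  refine ⟨by simpa using h, rfl⟩

lemma mul_σ (u w : F) : (ι u + ι w * Q.r) * Q.σ (ι u + ι w * Q.r) = ι (u ^ 2 - c * w ^ 2) := by
  rw [σ_apply]
  simp only [map_sub, map_mul, map_pow]
  linear_combination (- (ι w) ^ 2) * Q.r_sq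

lemma exists_norm (x : Eˣ) : ∃ n : Fˣ, ι n = x * Q.σ x := by
  obtain ⟨u, w, h⟩ := Q.rep x
  have h1 := Q.mul_σ u w
  rw [← h] at h1
  have h0 : u ^ 2 - c * w ^ 2 ≠ 0 := by
    intro h0
    rw [h0, map_zero] at h1
    have : (x : E) * Q.σ x ≠ 0 := by simp
    exact this h1
  exact ⟨Units.mk0 _ h0, h1.symm⟩

/-- The relative norm. -/
def nm : Eˣ →* Fˣ where
  toFun x := (Q.exists_norm x).choose
  map_one' := by
    ext
    apply (ι).injective
    rw [(Q.exists_norm 1).choose_spec]; simp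
  map_mul' x y := by
    ext
    apply (ι).injective
    rw [(Q.exists_norm (x * y)).choose_spec, Units.val_mul, Units.val_mul, map_mul, map_mul,
      (Q.exists_norm x).choose_spec, (Q.exists_norm y).choose_spec]
    ring

lemma nm_spec (x : Eˣ) : ι (Q.nm x) = x * Q.σ x := (Q.exists_norm x).choose_spec

lemma nm_mem_normGrp (x : Eˣ) : Q.nm x ∈ normGrp c := by
  obtain ⟨u, w, h⟩ := Q.rep x
  refine ⟨u, w, ?_⟩
  apply (ι).injective
  rw [nm_spec, h, mul_σ]

lemma nm_algebraMap (u : Fˣ) : Q.nm (Units.map (ι).toMonoidHom u) = u ^ 2 := by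
  ext
  apply (ι).injective
  rw [nm_spec]
  simp [pow_two]

end QuadExt

namespace QuadExt

variable {F : Type} [Field F] {c : F} {E : Type} [Field E] [Algebra F E]

local notation "ι" => algebraMap F E

variable [NumberField F] [NumberField E]

instance : IsScalarTower (𝓞 F) (𝓞 E) E := inferInstance

/-- The prime below. -/
abbrev below (P : HeightOneSpectrum (𝓞 E)) : HeightOneSpectrum (𝓞 F) := P.under (𝓞 F)

variable (F) in
/-- Valuations on the base field are restrictions of valuations from above, up to a power. -/
lemma valuation_below (P : HeightOneSpectrum (𝓞 E)) : ∃ e : ℕ, e ≠ 0 ∧ ∀ x : F,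
    P.valuation E (ι x) = (below (F := F) P).valuation F x ^ e := by
  have : P.asIdeal.LiesOver (below (F := F) P).asIdeal := ⟨rfl⟩
  refine ⟨_, Ideal.IsDedekindDomain.ramificationIdx'_ne_zero_of_liesOver P.asIdeal (below (F := F) P).ne_bot, fun x => ?_⟩
  exact ((below (F := F) P).valuation_liesOver E P x).symm

lemma valuation_le_one_iff {P : HeightOneSpectrum (𝓞 E)} {x : F} :
    P.valuation E (ι x) ≤ 1 ↔ (below (F := F) P).valuation F x ≤ 1 := by
  obtain ⟨e, he, h⟩ := valuation_below F P
  rw [h, pow_le_one_iff_of_nonneg zero_le he]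

lemma valuation_lt_one_iff {P : HeightOneSpectrum (𝓞 E)} {x : F} :
    P.valuation E (ι x) < 1 ↔ (below (F := F) P).valuation F x < 1 := by
  obtain ⟨e, he, h⟩ := valuation_below F P
  rw [h, pow_lt_one_iff_of_nonneg zero_le he]

lemma valuation_lt_iff {P : HeightOneSpectrum (𝓞 E)} {x y : F} :
    P.valuation E (ι x) < P.valuation E (ι y) ↔
      (below (F := F) P).valuation F x < (below (F := F) P).valuation F y := by
  obtain ⟨e, he, h⟩ := valuation_below F P
  rw [h, h, pow_lt_pow_iff_left₀ zero_le zero_le he]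

lemma valuation_eq_one_iff {P : HeightOneSpectrum (𝓞 E)} {x : F} :
    P.valuation E (ι x) = 1 ↔ (below (F := F) P).valuation F x = 1 := by
  obtain ⟨e, he, h⟩ := valuation_below F P
  rw [h, pow_eq_one_iff_of_nonneg zero_le he]

omit [NumberField E] in
lemma exists_above (p : HeightOneSpectrum (𝓞 F)) :
    ∃ P : HeightOneSpectrum (𝓞 E), below P = p := by
  obtain ⟨Q, hQ, h⟩ := Ideal.exists_maximal_ideal_liesOver_of_isIntegral p.asIdeal (S := 𝓞 E)
  have hne : Q ≠ ⊥ := by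
    rintro rfl
    have := h.over
    have hb : Ideal.under (𝓞 F) (⊥ : Ideal (𝓞 E)) = ⊥ := Ideal.under_bot _ _
    rw [hb] at this
    exact p.ne_bot this
  exact ⟨⟨Q, hQ.isPrime, hne⟩, HeightOneSpectrum.ext h.over.symm⟩

lemma finite_above (S : Finset (HeightOneSpectrum (𝓞 F))) :
    {P : HeightOneSpectrum (𝓞 E) | below P ∈ S}.Finite := by
  have : {P : HeightOneSpectrum (𝓞 E) | below P ∈ S} =
      ⋃ p ∈ S, {P : HeightOneSpectrum (𝓞 E) | below P = p} := by ext; simp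
  rw [this]
  refine Set.Finite.biUnion S.finite_toSet fun p _ => ?_
  have h1 := IsDedekindDomain.primesOver_finite (B := 𝓞 E) p.asIdeal
  refine Set.Finite.of_finite_image (f := HeightOneSpectrum.asIdeal) (h1.subset ?_) ?_
  · rintro _ ⟨P, hP, rfl⟩
    refine ⟨P.isPrime, ⟨?_⟩⟩
    rw [← hP]; rfl
  · intro a _ b _ h
    exact HeightOneSpectrum.ext h

variable (E) in
/-- The finite set of primes above a finite set of primes. -/
def above (S : Finset (HeightOneSpectrum (𝓞 F))) : Finset (HeightOneSpectrum (𝓞 E)) :=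
  (finite_above (E := E) S).toFinset

lemma mem_above {S : Finset (HeightOneSpectrum (𝓞 F))} {P : HeightOneSpectrum (𝓞 E)} :
    P ∈ above E S ↔ below P ∈ S := by simp [above]

variable (Q : QuadExt c E)

/-- The conjugation on the ring of integers. -/
def τ : 𝓞 E ≃+* 𝓞 E := RingOfIntegers.mapRingEquiv Q.σ.toRingEquiv

/-- The conjugate prime. -/
def conj (P : HeightOneSpectrum (𝓞 E)) : HeightOneSpectrum (𝓞 E) :=
  P.comap Q.τ Q.τ.surjective

omit [NumberField F] [NumberField E] in
lemma below_conj (P : HeightOneSpectrum (𝓞 E)) :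
    below (F := F) (Q.conj P) = below P := by
  ext a
  change Q.τ (algebraMap (𝓞 F) (𝓞 E) a) ∈ P.asIdeal ↔ algebraMap (𝓞 F) (𝓞 E) a ∈ P.asIdeal
  have : Q.τ (algebraMap (𝓞 F) (𝓞 E) a) = algebraMap (𝓞 F) (𝓞 E) a := by
    apply RingOfIntegers.ext
    exact Q.σ.commutes (a : F)
  rw [this]

omit [NumberField F] [NumberField E] in
lemma mem_conj_pow {P : HeightOneSpectrum (𝓞 E)} {a : 𝓞 E} (n : ℕ) :
    a ∈ (Q.conj P).asIdeal ^ n ↔ Q.τ a ∈ P.asIdeal ^ n := by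
  have : (Q.conj P).asIdeal = P.asIdeal.map Q.τ.symm := by
    change P.asIdeal.comap Q.τ = _
    exact (Ideal.map_symm Q.τ).symm
  rw [this, ← Ideal.map_pow]
  have h2 : (P.asIdeal ^ n).map Q.τ.symm = (P.asIdeal ^ n).comap Q.τ := Ideal.map_symm Q.τ
  rw [h2]
  rfl

lemma valuation_conj (P : HeightOneSpectrum (𝓞 E)) (x : E) :
    (Q.conj P).valuation E x = P.valuation E (Q.σ x) := by
  have h1 : ∀ a : 𝓞 E, (Q.conj P).valuation E (a : E) = P.valuation E ((Q.τ a : 𝓞 E) : E) := by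
    intro a
    rcases eq_or_ne a 0 with rfl | ha
    · simp
    have hk : ∀ n : ℕ, (Q.conj P).valuation E (a : E) ≤ WithZero.exp (-(n : ℤ)) ↔
        P.valuation E ((Q.τ a : 𝓞 E) : E) ≤ WithZero.exp (-(n : ℤ)) := by
      intro n
      rw [← mem_pow_iff, ← mem_pow_iff, mem_conj_pow]
    have hz1 : (Q.conj P).valuation E (a : E) ≠ 0 := by simpa using ha
    have hz2 : P.valuation E ((Q.τ a : 𝓞 E) : E) ≠ 0 := by simpa using ha
    have hl1 := (Q.conj P).valuation_le_one (K := E) a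
    have hl2 := P.valuation_le_one (K := E) (Q.τ a)
    change (Q.conj P).valuation E (a : E) ≤ 1 at hl1
    change P.valuation E ((Q.τ a : 𝓞 E) : E) ≤ 1 at hl2
    generalize (Q.conj P).valuation E (a : E) = x at *
    generalize P.valuation E ((Q.τ a : 𝓞 E) : E) = y at *
    obtain ⟨m, rfl⟩ : ∃ m, x = WithZero.exp m := ⟨_, (WithZero.exp_log hz1).symm⟩
    obtain ⟨n, rfl⟩ : ∃ n, y = WithZero.exp n := ⟨_, (WithZero.exp_log hz2).symm⟩
    simp only [WithZero.exp_le_exp, ← WithZero.exp_zero, WithZero.exp_inj] at hk hl1 hl2 ⊢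
    have h3 := hk (-m).toNat
    have h4 := hk (-n).toNat
    omega
  obtain ⟨a, b, hb, rfl⟩ := IsFractionRing.div_surjective (A := 𝓞 E) x
  rw [map_div₀, map_div₀, map_div₀]
  congr 1
  · exact h1 a
  · exact h1 b

/-- If `c` is a square at `p` there are two primes above `p`. -/
lemma conj_ne {P : HeightOneSpectrum (𝓞 E)} {c : Fˣ} (Q : QuadExt (c : F) E)
    (hc : c ∈ LocSq (below (F := F) P)) : Q.conj P ≠ P := by
  intro hP
  obtain ⟨x, hx⟩ := hc
  set θ : E := (1 + ι x * Q.r) / 2 with hθ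
  have hσθ : Q.σ θ = 1 - θ := by
    rw [hθ, map_div₀, map_add, map_mul, Q.σ_r, map_one, AlgEquiv.commutes]
    have : Q.σ 2 = 2 := map_ofNat _ 2
    rw [this]
    field_simp
    ring
  have hmul : θ * (1 - θ) = ι ((1 - c * x ^ 2) / 4) := by
    rw [hθ, map_div₀, map_sub, map_mul, map_pow, ← Q.r_sq, map_one, map_ofNat]
    field_simp
    ring
  have h1 : P.valuation E (θ * (1 - θ)) < 1 := by
    rw [hmul, valuation_lt_one_iff, map_div₀, ← Valuation.map_sub_swap]
    rw [div_lt_one₀ (valuation_four_pos _)]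
    exact hx
  have h2 : P.valuation E θ = P.valuation E (1 - θ) := by
    rw [← hσθ, ← valuation_conj, hP]
  rw [map_mul, ← h2, ← pow_two, pow_lt_one_iff_of_nonneg zero_le two_ne_zero] at h1
  have h3 := Valuation.map_add_lt _ h1 (h2 ▸ h1)
  rw [add_sub_cancel, map_one] at h3
  exact lt_irrefl _ h3

lemma card_above (S : Finset (HeightOneSpectrum (𝓞 F))) {c : Fˣ} (Q : QuadExt (c : F) E)
    (T : Finset (HeightOneSpectrum (𝓞 F))) (hT : ∀ p ∈ S, p ∉ T → c ∈ LocSq p) :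
    2 * S.card ≤ (above E S).card + T.card := by
  classical
  have h1 : (above E S).card = ∑ p ∈ S, ((above E S).filter (fun P => below P = p)).card :=
    Finset.card_eq_sum_card_fiberwise (fun P hP => mem_above.1 hP)
  have h2 : ∀ p ∈ S, 2 ≤ ((above E S).filter (fun P => below P = p)).card +
      (if p ∈ T then 1 else 0) := by
    intro p hp
    obtain ⟨P, hP⟩ := exists_above (E := E) p
    have hPm : P ∈ (above E S).filter (fun P => below P = p) := by
      simp [mem_above, hP, hp]
    split_ifs with hpT
    · have : 1 ≤ ((above E S).filter (fun P => below P = p)).card :=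
        Finset.card_pos.2 ⟨P, hPm⟩
      omega
    · have hne := conj_ne (P := P) Q (by rw [hP]; exact hT p hp hpT)
      have hcm : Q.conj P ∈ (above E S).filter (fun P => below P = p) := by
        simp [mem_above, below_conj, hP, hp]
      have : 1 < ((above E S).filter (fun P => below P = p)).card :=
        Finset.one_lt_card.2 ⟨_, hcm, _, hPm, hne⟩
      omega
  have h3 := Finset.sum_le_sum h2
  rw [Finset.sum_add_distrib, ← h1, Finset.sum_const, smul_eq_mul] at h3
  have h4 : ∑ p ∈ S, (if p ∈ T then 1 else 0) ≤ T.card := by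
    rw [← Finset.sum_filter, Finset.sum_const, smul_eq_mul, mul_one]
    apply Finset.card_le_card
    intro p hp
    exact (Finset.mem_filter.1 hp).2
  omega

end QuadExt

/-- Positivity under every real embedding. -/
def RealPos {F : Type} [Field F] (c : F) : Prop := ∀ φ : F →+* ℝ, 0 < φ c

open ComplexEmbedding in
lemma QuadExt.card_infinitePlace {F E : Type} [Field F] [NumberField F] [Field E] [NumberField E]
    [Algebra F E] [Algebra.IsQuadraticExtension F E] {c : F} (Q : QuadExt c E) (hc : RealPos c) :
    Fintype.card (InfinitePlace E) = 2 * Fintype.card (InfinitePlace F) := by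
  classical
  have hun : ∀ w : InfinitePlace E, w.IsUnramified F := by
    intro w
    rw [← InfinitePlace.mk_embedding w, InfinitePlace.isUnramified_mk_iff_isUnmixed]
    intro hreal
    set φ := w.embedding
    let f : F →+* ℝ := hreal.embedding
    have hf : ∀ x : F, ((f x : ℝ) : ℂ) = φ (algebraMap F E x) := fun x =>
      hreal.coe_embedding_apply x
    have hr : φ Q.r ^ 2 = ((f c : ℝ) : ℂ) := by rw [hf, ← map_pow, Q.r_sq]
    have hr2 : ((Real.sqrt (f c) : ℝ) : ℂ) ^ 2 = ((f c : ℝ) : ℂ) := by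
      rw [← Complex.ofReal_pow, Real.sq_sqrt (hc f).le]
    obtain ⟨s, hs⟩ : ∃ s : ℝ, φ Q.r = (s : ℂ) := by
      rw [← hr2] at hr
      rcases sq_eq_sq_iff_eq_or_eq_neg.1 hr with h | h
      · exact ⟨_, h⟩
      · exact ⟨- Real.sqrt (f c), by rw [h]; simp⟩
    rw [isReal_iff]
    ext x
    obtain ⟨u, v, rfl⟩ := Q.rep x
    simp only [conjugate_coe_eq, map_add, map_mul, ← hf, hs, Complex.conj_ofReal]
  have h := InfinitePlace.card_eq_card_isUnramifiedIn (k := F) (K := E)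
  have hall : (Finset.univ.filter (fun w : InfinitePlace F => w.IsUnramifiedIn E)) = Finset.univ := by
    ext w
    simp only [Finset.mem_filter, Finset.mem_univ, true_and, iff_true]
    obtain ⟨w, rfl⟩ := InfinitePlace.comap_surjective (k := F) (K := E) w
    rw [InfinitePlace.isUnramifiedIn_comap]
    exact hun w
  rw [hall, Algebra.IsQuadraticExtension.finrank_eq_two F E] at h
  simp only [Finset.compl_univ, Finset.card_empty, zero_mul, add_zero, Finset.card_univ] at h
  rw [h, mul_comm]

end

section

section
variable {F : Type} [Field F] [NumberField F]

lemma finite_lv_ne_zero (u : Fˣ) : {p : HeightOneSpectrum (𝓞 F) | lv p u ≠ 0}.Finite := by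
  have h1 := HeightOneSpectrum.Support.finite (𝓞 F) (u : F)
  have h2 := HeightOneSpectrum.Support.finite (𝓞 F) ((u⁻¹ : Fˣ) : F)
  refine (h1.union h2).subset fun p hp => ?_
  by_contra hn
  apply hp
  simp only [Set.mem_union, not_or] at hn
  obtain ⟨h3, h4⟩ := hn
  change ¬ 1 < p.valuation F (u : F) at h3
  change ¬ 1 < p.valuation F ((u⁻¹ : Fˣ) : F) at h4
  rw [lv_eq_zero_iff]
  rw [Units.val_inv_eq_inv_val, map_inv₀] at h4
  have hpos : 0 < p.valuation F (u : F) := zero_lt_iff.2 (val_ne_zero _)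
  apply le_antisymm (not_lt.1 h3)
  rw [not_lt, inv_le_one₀ hpos] at h4
  exact h4

/-- Every prime outside `S` is generated by an element up to primes in `S`. -/
def ClassTriv (S : Set (HeightOneSpectrum (𝓞 F))) : Prop :=
  ∀ p ∉ S, ∃ π : Fˣ, lv p π = -1 ∧ ∀ q ∉ S, q ≠ p → lv q π = 0

lemma ClassTriv.mono {S T : Set (HeightOneSpectrum (𝓞 F))} (hS : ClassTriv S) (h : S ⊆ T) :
    ClassTriv T := by
  intro p hp
  obtain ⟨π, h1, h2⟩ := hS p (fun h' => hp (h h'))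
  exact ⟨π, h1, fun q hq => h2 q (fun h' => hq (h h'))⟩

lemma lv_prod {I : Type*} (p : HeightOneSpectrum (𝓞 F)) (s : Finset I) (f : I → Fˣ) :
    lv p (∏ i ∈ s, f i) = ∑ i ∈ s, lv p (f i) := by
  classical
  induction s using Finset.induction_on with
  | empty => simp [lv_one]
  | insert a s ha ih => rw [Finset.prod_insert ha, Finset.sum_insert ha, lv_mul, ih]

lemma ClassTriv.exists_lv {S : Set (HeightOneSpectrum (𝓞 F))} (hS : ClassTriv S)
    (e : HeightOneSpectrum (𝓞 F) → ℤ) (he : {p | e p ≠ 0}.Finite) :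
    ∃ f : Fˣ, ∀ p ∉ S, lv p f = e p := by
  classical
  choose! π h1 h2 using hS
  refine ⟨∏ p ∈ he.toFinset.filter (· ∉ S), π p ^ (- e p), fun q hq => ?_⟩
  rw [lv_prod]
  by_cases hz : e q = 0
  · rw [hz]
    refine Finset.sum_eq_zero fun p hp => ?_
    have hp' := Finset.mem_filter.1 hp
    rw [lv_zpow, h2 p hp'.2 q hq, mul_zero]
    rintro rfl
    simp [hz] at hp'
  · rw [Finset.sum_eq_single q]
    · rw [lv_zpow, h1 q hq]; ring
    · intro p hp hne
      have hp' := Finset.mem_filter.1 hp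
      rw [lv_zpow, h2 p hp'.2 q hq hne.symm, mul_zero]
    · intro hn
      exact absurd (by simp [hz, hq]) hn

lemma ClassTriv.exists_primitive {S : Set (HeightOneSpectrum (𝓞 F))} (hS : ClassTriv S)
    {u w : F} (h : u ≠ 0 ∨ w ≠ 0) :
    ∃ f : Fˣ, ∀ p ∉ S, max (p.valuation F (f * u)) (p.valuation F (f * w)) = 1 := by
  have hne : ∀ p : HeightOneSpectrum (𝓞 F), max (p.valuation F u) (p.valuation F w) ≠ 0 := by
    intro p hp
    rcases h with h | h
    · have h1 := le_max_left (p.valuation F u) (p.valuation F w)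
      rw [hp] at h1
      exact h (by simpa using le_antisymm h1 zero_le)
    · have h1 := le_max_right (p.valuation F u) (p.valuation F w)
      rw [hp] at h1
      exact h (by simpa using le_antisymm h1 zero_le)
  have key : ∀ u : F, {p : HeightOneSpectrum (𝓞 F) | p.valuation F u ≠ 1 ∧ u ≠ 0}.Finite := by
    intro u
    by_cases hu : u = 0
    · simp [hu]
    · refine (finite_lv_ne_zero (Units.mk0 u hu)).subset fun p hp => ?_
      simp only [Set.mem_ofPred_eq, ne_eq, lv_eq_zero_iff, Units.val_mk0]
      exact hp.1
  obtain ⟨f, hf⟩ := hS.exists_lv (fun p => - (max (p.valuation F u) (p.valuation F w)).log) (by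
    refine ((key u).union (key w)).subset fun p hp => ?_
    by_contra hn
    apply hp
    simp only [Set.mem_union, Set.mem_ofPred_eq, not_or, not_and, not_not] at hn
    by_cases hu : u = 0
    · by_cases hw : w = 0
      · exact absurd h (by simp [hu, hw])
      · have : p.valuation F w = 1 := by
          by_contra h'
          exact hw (hn.2 h')
        simp [hu, this]
    · have hu1 : p.valuation F u = 1 := by
        by_contra h'
        exact hu (hn.1 h')
      by_cases hw : w = 0
      · simp [hw, hu1]
      · have : p.valuation F w = 1 := by
          by_contra h'
          exact hw (hn.2 h')
        simp [hu1, this])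
  refine ⟨f, fun p hp => ?_⟩
  rw [map_mul, map_mul, max_mul_mul_left, ← exp_lv, hf p hp,
    ← WithZero.exp_log (hne p), ← WithZero.exp_add]
  simp

lemma sqIndex_eq_relIndex {G : Type*} [CommGroup G] (U : Subgroup G) :
    sqIndex U = (U.map (powMonoidHom 2)).relIndex U := by
  rw [sqIndex, Subgroup.relIndex]
  congr 1
  ext x
  simp only [MonoidHom.mem_range, Subgroup.mem_subgroupOf, Subgroup.mem_map, powMonoidHom_apply]
  constructor
  · rintro ⟨y, rfl⟩
    exact ⟨y, y.2, rfl⟩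
  · rintro ⟨y, hy, h⟩
    exact ⟨⟨y, hy⟩, Subtype.ext h⟩

end

namespace QuadExt

variable {F : Type} [Field F] {c : F} {E : Type} [Field E] [Algebra F E]

local notation "ι" => algebraMap F E

variable [NumberField F] [NumberField E]

lemma nm_mem_sUnit (Q : QuadExt c E) {S : Finset (HeightOneSpectrum (𝓞 F))} {x : Eˣ}
    (hx : x ∈ sUnit (above E S : Set (HeightOneSpectrum (𝓞 E)))) : Q.nm x ∈ sUnit (S : Set _) := by
  intro p hp
  obtain ⟨P, rfl⟩ := exists_above (E := E) p
  rw [lv_eq_zero_iff, ← valuation_eq_one_iff (E := E), nm_spec, map_mul, ← valuation_conj]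
  have h1 := hx P (by simpa [mem_above] using hp)
  have h2 := hx (Q.conj P) (by simpa [mem_above, below_conj] using hp)
  rw [lv_eq_zero_iff] at h1 h2
  rw [h1, h2, one_mul]

/-- The inclusion on units. -/
abbrev ui (F E : Type) [Field F] [Field E] [Algebra F E] : Fˣ →* Eˣ :=
  Units.map (algebraMap F E).toMonoidHom

lemma ui_mem_sUnit {S : Finset (HeightOneSpectrum (𝓞 F))} {u : Fˣ} :
    ui F E u ∈ sUnit (above E S : Set (HeightOneSpectrum (𝓞 E))) ↔ u ∈ sUnit (S : Set _) := by
  constructor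
  · intro h p hp
    obtain ⟨P, rfl⟩ := exists_above (E := E) p
    have h1 := h P (by simpa [mem_above] using hp)
    rw [lv_eq_zero_iff] at h1 ⊢
    exact valuation_eq_one_iff.1 h1
  · intro h P hP
    have h1 := h (below P) (by simpa [mem_above] using hP)
    rw [lv_eq_zero_iff] at h1 ⊢
    exact valuation_eq_one_iff.2 h1

/-- Hilbert 90 refined to `S`-units. -/
lemma ker_nm (Q : QuadExt c E) {S : Finset (HeightOneSpectrum (𝓞 F))}
    (hd : ∀ p, ¬ Odd' p → p ∈ S) (hS : ClassTriv (S : Set (HeightOneSpectrum (𝓞 F))))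
    (hc : ∀ p ∉ S, p.valuation F c = 1) {x : Eˣ}
    (hx : x ∈ sUnit (above E S : Set (HeightOneSpectrum (𝓞 E)))) (hn : Q.nm x = 1) :
    ∃ u ∈ sUnit (S : Set (HeightOneSpectrum (𝓞 F))),
      ∃ y ∈ sUnit (above E S : Set (HeightOneSpectrum (𝓞 E))), x = ui F E u * y ^ 2 := by
  have hn1 : (x : E) * Q.σ x = 1 := by rw [← nm_spec, hn]; simp
  obtain ⟨y, hy0, hy⟩ : ∃ y : E, y ≠ 0 ∧ x * Q.σ y = y := by
    by_cases h : (1 + x : E) = 0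
    · refine ⟨Q.r, ?_, ?_⟩
      · have := Q.r_not_mem 0
        rwa [map_zero] at this
      · have : (x : E) = -1 := by linear_combination h
        rw [this, Q.σ_r]; ring
    · exact ⟨1 + x, h, by rw [map_add, map_one]; linear_combination hn1⟩
  obtain ⟨u, w, huw⟩ := Q.rep y
  obtain ⟨f, hf⟩ := hS.exists_primitive (u := u) (w := w) (by
    by_contra h
    push Not at h
    rw [h.1, h.2] at huw
    simp [huw] at hy0)
  set u0 := f * u with hu0
  set w0 := f * w with hw0
  have hyne : ι f * y ≠ 0 := mul_ne_zero (by simp) hy0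
  set y0 : Eˣ := Units.mk0 (ι f * y) hyne with hy0'
  have hyv : (y0 : E) = ι u0 + ι w0 * Q.r := by
    rw [hy0', Units.val_mk0, huw, hu0, hw0, map_mul, map_mul]; ring
  have hxy : (x : E) * Q.σ y0 = y0 := by
    rw [hy0', Units.val_mk0, map_mul, AlgEquiv.commutes]
    linear_combination ι f * hy
  set n := Q.nm y0 with hn'
  have hxn : (x : E) * ι n = (y0 : E) ^ 2 := by
    rw [nm_spec]; linear_combination (y0 : E) * hxy
  have hnv : (n : F) = u0 ^ 2 - c * w0 ^ 2 := by
    apply (ι).injective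
    rw [nm_spec, hyv, mul_σ]
  have hιn : ι (n : F) ≠ 0 := by simp
  have hσy : Q.σ y0 = ι u0 - ι w0 * Q.r := by rw [hyv, σ_apply]
  have hσx : Q.σ x * ι n = (Q.σ y0) ^ 2 := by
    rw [nm_spec]
    linear_combination (- Q.σ x * Q.σ y0) * hxy + Q.σ y0 ^ 2 * hn1
  have htr : (x : E) + Q.σ x = ι (2 * (u0 ^ 2 + c * w0 ^ 2) / n) := by
    rw [map_div₀, eq_div_iff hιn, add_mul, hxn, hσx, hyv, σ_apply]
    simp only [map_mul, map_add, map_pow, map_ofNat]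
    linear_combination (2 * ι w0 ^ 2) * Q.r_sq
  have hnU : n ∈ sUnit (S : Set (HeightOneSpectrum (𝓞 F))) := by
    intro p hp
    have hodd : Odd' p := by
      by_contra h
      exact hp (hd p h)
    obtain ⟨P, rfl⟩ := exists_above (E := E) p
    have hp' : below P ∉ S := by simpa using hp
    have h1 := hx P (by simpa [mem_above] using hp)
    have h2 := hx (Q.conj P) (by simpa [mem_above, below_conj] using hp)
    rw [lv_eq_zero_iff] at h1 h2
    rw [valuation_conj] at h2
    have ht : (below (F := F) P).valuation F (2 * (u0 ^ 2 + c * w0 ^ 2) / n) ≤ 1 := by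
      rw [← valuation_le_one_iff (E := E), ← htr]
      exact Valuation.map_add_le _ h1.le h2.le
    set v := (below (F := F) P).valuation F with hv
    have h4 : v 4 = 1 := valuation_four_of_odd hodd
    have h2' : v 2 ≤ 1 := le_of_eq hodd
    have hmax := hf _ hp
    have hu1 : v u0 ≤ 1 := hmax ▸ le_max_left _ _
    have hw1 : v w0 ≤ 1 := hmax ▸ le_max_right _ _
    have hc1 : v c = 1 := hc _ hp'
    have hn0 : (n : F) ≠ 0 := n.ne_zero
    have hcw : v (c * w0 ^ 2) ≤ 1 := by
      rw [map_mul, map_pow]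
      exact mul_le_one' hc1.le (pow_le_one' hw1 2)
    have hn1 : v n ≤ 1 := by
      rw [hnv]
      refine Valuation.map_sub_le _ ?_ hcw
      rw [map_pow]; exact pow_le_one' hu1 2
    have hnpos : 0 < v n := zero_lt_iff.2 (by simp)
    have hun : v (u0 ^ 2) ≤ v n := by
      have : (4 : F) * u0 ^ 2 / n = 2 * (u0 ^ 2 + c * w0 ^ 2) / n + 2 := by
        rw [eq_comm, ← eq_sub_iff_add_eq, ← sub_eq_zero]
        field_simp
        rw [hnv]; ring
      have h5 : v (4 * u0 ^ 2 / n) ≤ 1 := by rw [this]; exact Valuation.map_add_le _ ht h2'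
      rw [map_div₀, map_mul, h4, one_mul, div_le_one₀ hnpos] at h5
      exact h5
    have hwn : v (c * w0 ^ 2) ≤ v n := by
      have : (4 : F) * (c * w0 ^ 2) / n = 2 * (u0 ^ 2 + c * w0 ^ 2) / n - 2 := by
        rw [← sub_eq_zero]
        field_simp
        rw [hnv]; ring
      have h5 : v (4 * (c * w0 ^ 2) / n) ≤ 1 := by rw [this]; exact Valuation.map_sub_le _ ht h2'
      rw [map_div₀, map_mul, h4, one_mul, div_le_one₀ hnpos] at h5
      exact h5
    rw [map_mul, hc1, one_mul] at hwn
    rw [lv_eq_zero_iff]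
    apply le_antisymm hn1
    rcases max_choice (v u0) (v w0) with h | h
    · rw [map_pow, ← h, hmax, one_pow] at hun
      exact hun
    · rw [map_pow, ← h, hmax, one_pow] at hwn
      exact hwn
  refine ⟨n⁻¹, inv_mem hnU, y0, ?_, ?_⟩
  · intro P hP
    have h1 := hx P hP
    have h2 := (ui_mem_sUnit (E := E)).2 hnU P hP
    have h3 : x * ui F E n = y0 ^ 2 := by
      ext; simpa using hxn
    have h4 : lv P (x * ui F E n) = lv P (y0 ^ 2) := by rw [h3]
    rw [lv_mul, lv_pow, h1, h2] at h4
    simp at h4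
    exact h4
  · ext
    simp only [Units.val_mul, Units.val_pow_eq_pow_val, map_inv, Units.val_inv_eq_inv_val]
    rw [← hxn]
    simp only [Units.coe_map, RingHom.toMonoidHom_eq_coe, MonoidHom.coe_coe]
    field_simp

end QuadExt

end

section

namespace QuadExt

variable {F E : Type} [Field F] [NumberField F] [Field E] [NumberField E]
    [Algebra F E] [Algebra.IsQuadraticExtension F E]

/-- Index bound for norms of `S`-units from a quadratic extension unramified at infinity. -/
theorem relIndex_norm_le {c : Fˣ} (Q : QuadExt (c : F) E) (hpos : RealPos (c : F))
    {S : Finset (HeightOneSpectrum (𝓞 F))} (hd : ∀ p, ¬ Odd' p → p ∈ S)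
    (hS : ClassTriv (S : Set (HeightOneSpectrum (𝓞 F))))
    (hc : c ∈ sUnit (S : Set (HeightOneSpectrum (𝓞 F))))
    (T : Finset (HeightOneSpectrum (𝓞 F))) (hT : ∀ p ∈ S, p ∉ T → c ∈ LocSq p) :
    ((sUnit (above E S : Set (HeightOneSpectrum (𝓞 E)))).map Q.nm).relIndex
      (sUnit (S : Set (HeightOneSpectrum (𝓞 F)))) ≠ 0 ∧
    2 * ((sUnit (above E S : Set (HeightOneSpectrum (𝓞 E)))).map Q.nm).relIndex
      (sUnit (S : Set (HeightOneSpectrum (𝓞 F)))) ≤ 2 ^ T.card := by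
  set U := sUnit (S : Set (HeightOneSpectrum (𝓞 F))) with hU
  set A := sUnit (above E S : Set (HeightOneSpectrum (𝓞 E))) with hA
  set sq : Fˣ →* Fˣ := powMonoidHom 2 with hsq
  set sqE : Eˣ →* Eˣ := powMonoidHom 2 with hsqE
  set I := ui F E with hI
  have hIA : U.map I ≤ A := by
    rintro _ ⟨u, hu, rfl⟩
    exact ui_mem_sUnit.2 hu
  have hA2 : A.map sqE ≤ A := by
    rintro _ ⟨u, hu, rfl⟩
    exact pow_mem hu 2
  have hU2 : U.map sq ≤ U := by
    rintro _ ⟨u, hu, rfl⟩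
    exact pow_mem hu 2
  have hNA : A.map Q.nm ≤ U := by
    rintro _ ⟨u, hu, rfl⟩
    exact Q.nm_mem_sUnit hu
  set J := U.map I ⊔ A.map sqE with hJ
  have hJA : J ≤ A := sup_le hIA hA2
  -- images under the norm
  have hNJ : J.map Q.nm = U.map sq := by
    rw [hJ, Subgroup.map_sup]
    apply le_antisymm
    · refine sup_le ?_ ?_
      · rintro _ ⟨_, ⟨u, hu, rfl⟩, rfl⟩
        exact ⟨u, hu, (Q.nm_algebraMap u).symm⟩
      · rintro _ ⟨_, ⟨u, hu, rfl⟩, rfl⟩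
        exact ⟨Q.nm u, Q.nm_mem_sUnit hu, (map_pow Q.nm u 2).symm⟩
    · refine le_trans ?_ le_sup_left
      rintro _ ⟨u, hu, rfl⟩
      exact ⟨I u, ⟨u, hu, rfl⟩, Q.nm_algebraMap u⟩
  have hU2A : U.map sq ≤ A.map Q.nm := hNJ ▸ Subgroup.map_mono hJA
  have h1 : J.relIndex A = (U.map sq).relIndex (A.map Q.nm) := by
    rw [← hNJ, ← Subgroup.relIndex_comap,
      ← Subgroup.inf_relIndex_right ((J.map Q.nm).comap Q.nm) A]
    congr 1
    apply le_antisymm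
    · exact le_inf (Subgroup.le_comap_map Q.nm J) hJA
    · intro x hx0
      obtain ⟨hx1, hx⟩ := Subgroup.mem_inf.1 hx0
      obtain ⟨y, hy, hxy⟩ := Subgroup.mem_map.1 (Subgroup.mem_comap.1 hx1)
      obtain ⟨u, hu, z, hz, h⟩ := Q.ker_nm hd hS
        (fun p hp => lv_eq_zero_iff.1 (hc p (by simpa using hp))) (x := x * y⁻¹)
        (mul_mem hx (inv_mem (hJA hy))) (by
          rw [map_mul, map_inv, hxy, mul_inv_cancel])
      have : x * y⁻¹ ∈ J := by
        rw [h]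
        exact mul_mem (Subgroup.mem_sup_left ⟨u, hu, rfl⟩) (Subgroup.mem_sup_right ⟨z, hz, rfl⟩)
      simpa using mul_mem this hy
  have h2 : (U.map sq).relIndex (A.map Q.nm) * (A.map Q.nm).relIndex U = (U.map sq).relIndex U :=
    Subgroup.relIndex_mul_relIndex _ _ _ hU2A hNA
  have h3 : (A.map sqE).relIndex J * J.relIndex A = (A.map sqE).relIndex A :=
    Subgroup.relIndex_mul_relIndex _ _ _ le_sup_right hJA
  have h4 : (A.map sqE).relIndex J = ((A.map sqE).comap I).relIndex U := by
    rw [hJ, Subgroup.relIndex_sup_right, ← Subgroup.relIndex_comap]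
  set W := (A.map sqE).comap I ⊓ U with hW
  have hW' : ((A.map sqE).comap I).relIndex U = W.relIndex U :=
    (Subgroup.inf_relIndex_right _ _).symm
  have hU2W : U.map sq ≤ W := by
    refine le_inf ?_ hU2
    rintro _ ⟨u, hu, rfl⟩
    exact ⟨I u, hIA ⟨u, hu, rfl⟩, (map_pow I u 2).symm⟩
  have h5 : (U.map sq).relIndex W * W.relIndex U = (U.map sq).relIndex U :=
    Subgroup.relIndex_mul_relIndex _ _ _ hU2W inf_le_right
  have hs : (U.map sq).relIndex U = 2 ^ (S.card + Fintype.card (InfinitePlace F)) := by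
    rw [← sqIndex_eq_relIndex, sqIndex_sUnit]
  have hsE : (A.map sqE).relIndex A =
      2 ^ ((above E S).card + Fintype.card (InfinitePlace E)) := by
    rw [← sqIndex_eq_relIndex, sqIndex_sUnit]
  have h6 : (U.map sq).relIndex W ≠ 1 := by
    intro h
    rw [Subgroup.relIndex_eq_one] at h
    have hr : Q.r ≠ 0 := by
      have := Q.r_not_mem 0
      rwa [map_zero] at this
    have hrc : (Units.mk0 Q.r hr) ^ 2 = I c := by
      ext; simp [hI, Q.r_sq]
    have hrA : Units.mk0 Q.r hr ∈ A := by
      intro P hP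
      have := (ui_mem_sUnit (E := E)).2 hc P hP
      have h' : lv P (Units.mk0 Q.r hr ^ 2) = 0 := by rw [hrc]; exact this
      rw [lv_pow] at h'
      simpa using h'
    obtain ⟨u, hu, huc⟩ := h (show c ∈ W from ⟨⟨_, hrA, hrc⟩, hc⟩)
    apply Q.nonsq
    refine ⟨u, ?_⟩
    rw [← huc, ← pow_two]; rfl
  have h7 := Q.card_above S T hT
  have h8 := Q.card_infinitePlace hpos
  rw [hs] at h2 h5
  rw [hsE, h4, hW', h1] at h3
  set x := W.relIndex U
  set y := (U.map sq).relIndex (A.map Q.nm)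
  set z := (A.map Q.nm).relIndex U
  set k := (U.map sq).relIndex W
  set s := S.card + Fintype.card (InfinitePlace F)
  set t := (above E S).card + Fintype.card (InfinitePlace E)
  have hz : z ≠ 0 := by
    intro h; rw [h, mul_zero] at h2; exact absurd h2.symm (by positivity)
  have hk : 2 ≤ k := by
    have : k ≠ 0 := by
      intro h; rw [h, zero_mul] at h5; exact absurd h5.symm (by positivity)
    omega
  refine ⟨hz, ?_⟩
  have hx : 2 * x ≤ 2 ^ s := h5 ▸ Nat.mul_le_mul_right x hk
  have hst : 2 * s ≤ t + T.card := by omega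
  have h9 : (2 * z) * 2 ^ t ≤ 2 ^ T.card * 2 ^ t := by
    calc (2 * z) * 2 ^ t = (2 * x) * (y * z) := by rw [← h3]; ring
      _ = (2 * x) * 2 ^ s := by rw [h2]
      _ ≤ 2 ^ s * 2 ^ s := Nat.mul_le_mul_right _ hx
      _ = 2 ^ (2 * s) := by rw [← pow_add, two_mul]
      _ ≤ 2 ^ (t + T.card) := Nat.pow_le_pow_right (by norm_num) hst
      _ = _ := by rw [add_comm, ← pow_add]
  exact Nat.le_of_mul_le_mul_right h9 (by positivity)

end QuadExt

end

section

variable (F : Type) [Field F] [NumberField F]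

/-- The signs at the real embeddings. -/
def signs : Fˣ →* ((F →+* ℝ) → SignTypeˣ) :=
  MonoidHom.pi fun φ => Units.map ((signHom : ℝ →*₀ SignType).toMonoidHom.comp φ.toMonoidHom)

/-- The elements positive under every real embedding. -/
def Pos : Subgroup Fˣ := (signs F).ker

variable {F}

omit [NumberField F] in
lemma mem_Pos {u : Fˣ} : u ∈ Pos F ↔ RealPos (u : F) := by
  rw [Pos, MonoidHom.mem_ker, funext_iff]
  refine forall_congr' fun φ => ?_
  rw [← sign_eq_one_iff, ← Units.val_inj]
  rfl

omit [NumberField F] in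
lemma RealPos.mul {a b : F} (ha : RealPos a) (hb : RealPos b) : RealPos (a * b) := fun φ => by
  rw [map_mul]; exact mul_pos (ha φ) (hb φ)

instance : Finite (F →+* ℝ) := by
  refine Finite.of_injective (fun φ : F →+* ℝ => Complex.ofRealHom.comp φ) fun φ ψ h => ?_
  ext x
  have := RingHom.congr_fun h x
  exact Complex.ofReal_injective this

lemma card_real_embeddings_le : Nat.card (F →+* ℝ) ≤ InfinitePlace.nrRealPlaces F := by
  classical
  rw [InfinitePlace.nrRealPlaces, ← Nat.card_eq_fintype_card]
  have hr : ∀ φ : F →+* ℝ, ComplexEmbedding.conjugate (Complex.ofRealHom.comp φ) =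
      Complex.ofRealHom.comp φ := by
    intro φ
    ext x
    simp [ComplexEmbedding.conjugate_coe_eq]
  refine Nat.card_le_card_of_injective
    (fun φ : F →+* ℝ => (⟨InfinitePlace.mk (Complex.ofRealHom.comp φ), ?_⟩ :
      {w : InfinitePlace F // w.IsReal})) ?_
  · exact ⟨_, hr φ, rfl⟩
  · intro φ ψ h
    have h1 := InfinitePlace.mk_eq_iff.1 (Subtype.ext_iff.1 h)
    rw [hr, or_self] at h1
    ext x
    exact Complex.ofReal_injective (RingHom.congr_fun h1 x)

lemma index_Pos_le : (Pos F).index ≠ 0 ∧ (Pos F).index ≤ 2 ^ InfinitePlace.nrRealPlaces F := by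
  classical
  rw [Pos, Subgroup.index_ker]
  constructor
  · exact Nat.card_pos.ne'
  · calc Nat.card (signs F).range ≤ Nat.card ((F →+* ℝ) → SignTypeˣ) :=
        Nat.card_le_card_of_injective _ Subtype.val_injective
      _ = 2 ^ Nat.card (F →+* ℝ) := by
        rw [Nat.card_fun, Nat.card_eq_fintype_card (α := SignTypeˣ)]; rfl
      _ ≤ _ := Nat.pow_le_pow_right (by norm_num) card_real_embeddings_le

/-- Elements that are squares at all primes of `S` and positive. -/
def Lam (S : Finset (HeightOneSpectrum (𝓞 F))) : Subgroup Fˣ :=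
  (⨅ p : S, LocSq (p : HeightOneSpectrum (𝓞 F))) ⊓ Pos F

lemma mem_Lam {S : Finset (HeightOneSpectrum (𝓞 F))} {u : Fˣ} :
    u ∈ Lam S ↔ (∀ p ∈ S, u ∈ LocSq p) ∧ RealPos (u : F) := by
  rw [Lam, Subgroup.mem_inf, mem_Pos, Subgroup.mem_iInf]
  simp

lemma index_Lam_le (S : Finset (HeightOneSpectrum (𝓞 F))) :
    (Lam S).index ≠ 0 ∧
    (Lam S).index ≤ 2 ^ (2 * (S.card + Fintype.card (InfinitePlace F))) := by
  have h1 : (⨅ p : S, LocSq (p : HeightOneSpectrum (𝓞 F))).index ≠ 0 :=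
    Subgroup.index_iInf_ne_zero fun p => index_locSq_le.1
  refine ⟨Subgroup.index_inf_ne_zero h1 index_Pos_le.1, ?_⟩
  have h2 : (⨅ p : S, LocSq (p : HeightOneSpectrum (𝓞 F))).index ≤
      4 ^ S.card * 2 ^ Module.finrank ℚ F := by
    calc _ ≤ ∏ p : S, (LocSq (p : HeightOneSpectrum (𝓞 F))).index := Subgroup.index_iInf_le _
      _ ≤ ∏ p : S, (4 * Nat.card (𝓞 F ⧸ (p : HeightOneSpectrum (𝓞 F)).asIdeal ^ twoExp p.1)) :=
        Finset.prod_le_prod' fun p _ => index_locSq_le.2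
      _ = ∏ p ∈ S, (4 * Nat.card (𝓞 F ⧸ (p : HeightOneSpectrum (𝓞 F)).asIdeal ^ twoExp p)) :=
        Finset.prod_coe_sort S
          (fun p => 4 * Nat.card (𝓞 F ⧸ (p : HeightOneSpectrum (𝓞 F)).asIdeal ^ twoExp p))
      _ ≤ _ := by
        rw [Finset.prod_mul_distrib, Finset.prod_const]
        exact Nat.mul_le_mul_left _ (prod_card_le S)
  have h3 := InfinitePlace.card_add_two_mul_card_eq_rank F
  have h4 := InfinitePlace.card_eq_nrRealPlaces_add_nrComplexPlaces F
  calc (Lam S).index ≤ _ * _ := Subgroup.index_inf_le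
    _ ≤ (4 ^ S.card * 2 ^ Module.finrank ℚ F) * 2 ^ InfinitePlace.nrRealPlaces F :=
      Nat.mul_le_mul h2 index_Pos_le.2
    _ = _ := by
      rw [show 4 = 2 ^ 2 by norm_num, ← pow_mul, ← pow_add, ← pow_add]
      congr 1
      omega

end

section

open Filter Topology in
/-- A counting function of exact linear growth cannot have pairs growing linearly. -/
lemma no_pairs_injection {X Y : Type*} (N : X → ℕ) (M : Y → ℕ)
    (hN : ∀ x : ℝ, {a | (N a : ℝ) ≤ x}.Finite) (hM : ∀ x : ℝ, {a | (M a : ℝ) ≤ x}.Finite)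
    {κ κ' : ℝ} (hκ : 0 < κ)
    (h1 : Tendsto (fun x : ℝ => ({a | (N a : ℝ) ≤ x}.ncard : ℝ) / x) atTop (𝓝 κ))
    (h2 : Tendsto (fun x : ℝ => ({a | (M a : ℝ) ≤ x}.ncard : ℝ) / x) atTop (𝓝 κ'))
    (f : X × X → Y) (hf : Function.Injective f) (hfN : ∀ a b, M (f (a, b)) ≤ N a * N b) :
    False := by
  classical
  have hpow : Tendsto (fun k : ℕ => (2 : ℝ) ^ k) atTop atTop :=
    tendsto_pow_atTop_atTop_of_one_lt (by norm_num)
  set A : ℕ → Finset X := fun k => (hN (2 ^ k)).toFinset with hA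
  have hAmem : ∀ k a, a ∈ A k ↔ (N a : ℝ) ≤ 2 ^ k := by intro k a; simp [hA]
  have hAmono : ∀ k, A k ⊆ A (k + 1) := by
    intro k a ha
    rw [hAmem] at ha ⊢
    exact ha.trans (pow_le_pow_right₀ (by norm_num) (Nat.le_succ k))
  set D : ℕ → Finset Y := fun k => (hM (2 ^ k)).toFinset with hD
  have hDmem : ∀ k a, a ∈ D k ↔ (M a : ℝ) ≤ 2 ^ k := by intro k a; simp [hD]
  have hA1 : Tendsto (fun k : ℕ => ((A k).card : ℝ) / 2 ^ k) atTop (𝓝 κ) := by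
    refine (h1.comp hpow).congr fun k => ?_
    simp only [Function.comp_apply, hA]
    rw [Set.ncard_eq_toFinset_card _ (hN _)]
  have hD1 : Tendsto (fun k : ℕ => ((D k).card : ℝ) / 2 ^ k) atTop (𝓝 κ') := by
    refine (h2.comp hpow).congr fun k => ?_
    simp only [Function.comp_apply, hD]
    rw [Set.ncard_eq_toFinset_card _ (hM _)]
  set B : ℕ → Finset X := fun k => A (k + 1) \ A k with hB
  have hB1 : Tendsto (fun k : ℕ => ((B k).card : ℝ) / 2 ^ k) atTop (𝓝 κ) := by
    have h3 := ((hA1.comp (tendsto_add_atTop_nat 1)).const_mul 2).sub hA1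
    rw [two_mul, add_sub_cancel_right] at h3
    refine h3.congr fun k => ?_
    simp only [Function.comp_apply, hB]
    rw [Finset.card_sdiff_of_subset (hAmono k), Nat.cast_sub (Finset.card_le_card (hAmono k)),
      pow_succ]
    field_simp
  have e1 := hA1.eventually (lt_mem_nhds (half_lt_self hκ))
  have e2 := hB1.eventually (lt_mem_nhds (half_lt_self hκ))
  have e3 := hD1.eventually (gt_mem_nhds (lt_add_one κ'))
  obtain ⟨n, hn⟩ := eventually_atTop.1 (e1.and (e2.and e3))
  -- count pairs of product at most `2 ^ (2 n + m + 1)`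
  have key : ∀ m : ℕ, (m : ℝ) * ((κ / 2) * (κ / 2)) ≤ 2 * (κ' + 1) := by
    intro m
    set t := 2 * n + m + 1 with ht
    have hcard : (∑ i ∈ Finset.range m, ((A (n + (m - i))) ×ˢ (B (n + i))).card) ≤ (D t).card := by
      rw [← Finset.card_sigma]
      refine Finset.card_le_card_of_injOn (fun s => f s.2) ?_ ?_
      · rintro ⟨i, a, b⟩ h
        simp only [Finset.coe_sigma, Set.mem_sigma_iff, Finset.mem_coe, Finset.mem_range,
          Finset.mem_product] at h
        obtain ⟨hi, ha, hb⟩ := h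
        rw [Finset.mem_coe, hDmem]
        have hb' := (hAmem _ _).1 (Finset.mem_sdiff.1 hb).1
        have ha' := (hAmem _ _).1 ha
        calc (M (f (a, b)) : ℝ) ≤ ((N a * N b : ℕ) : ℝ) := by exact_mod_cast hfN a b
          _ = N a * N b := by push_cast; ring
          _ ≤ 2 ^ (n + (m - i)) * 2 ^ (n + i + 1) := by gcongr
          _ = 2 ^ t := by
            rw [← pow_add]; congr 1; omega
      · rintro ⟨i, a, b⟩ h ⟨i', a', b'⟩ h' heq
        have := hf heq
        simp only [Prod.mk.injEq] at this
        obtain ⟨rfl, rfl⟩ := this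
        simp only [Finset.coe_sigma, Set.mem_sigma_iff, Finset.mem_coe, Finset.mem_range,
          Finset.mem_product] at h h'
        have h3 := Finset.mem_sdiff.1 h.2.2
        have h4 := Finset.mem_sdiff.1 h'.2.2
        rw [hAmem, hAmem] at h3 h4
        have h5 : n + i < n + i' + 1 := by
          by_contra hc
          exact h3.2 (h4.1.trans (pow_le_pow_right₀ (by norm_num) (not_lt.1 hc)))
        have h6 : n + i' < n + i + 1 := by
          by_contra hc
          exact h4.2 (h3.1.trans (pow_le_pow_right₀ (by norm_num) (not_lt.1 hc)))
        obtain rfl : i = i' := by omega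
        rfl
    have hD2 : ((D t).card : ℝ) ≤ (κ' + 1) * 2 ^ t := by
      have := (hn t (by omega)).2.2
      rw [div_lt_iff₀ (by positivity)] at this
      exact this.le
    have hterm : ∀ i ∈ Finset.range m, (κ / 2) * (κ / 2) * 2 ^ (2 * n + m) ≤
        (((A (n + (m - i))) ×ˢ (B (n + i))).card : ℝ) := by
      intro i hi
      have him := Finset.mem_range.1 hi
      have h3 := (hn (n + (m - i)) (by omega)).1
      have h4 := (hn (n + i) (by omega)).2.1
      rw [lt_div_iff₀ (by positivity)] at h3 h4
      rw [Finset.card_product, Nat.cast_mul]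
      calc (κ / 2) * (κ / 2) * 2 ^ (2 * n + m)
          = (κ / 2 * 2 ^ (n + (m - i))) * (κ / 2 * 2 ^ (n + i)) := by
            rw [show 2 * n + m = (n + (m - i)) + (n + i) by omega, pow_add]; ring
        _ ≤ _ := by gcongr
    have h5 := Finset.sum_le_sum hterm
    rw [Finset.sum_const, Finset.card_range, nsmul_eq_mul, ← Nat.cast_sum] at h5
    have h6 : (m : ℝ) * ((κ / 2) * (κ / 2) * 2 ^ (2 * n + m)) ≤ (κ' + 1) * 2 ^ t :=
      h5.trans ((Nat.cast_le.2 hcard).trans hD2)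
    rw [ht, pow_succ] at h6
    have h7 : (0 : ℝ) < 2 ^ (2 * n + m) := by positivity
    refine le_of_mul_le_mul_right ?_ h7
    linarith
  obtain ⟨m, hm⟩ := exists_nat_gt (2 * (κ' + 1) / ((κ / 2) * (κ / 2)))
  rw [div_lt_iff₀ (by positivity)] at hm
  exact absurd (key m) (not_le.2 hm)

section counting

variable {F : Type} [Field F] [NumberField F]

/-- The norm of a prime. -/
def nrm (p : HeightOneSpectrum (𝓞 F)) : ℕ := Ideal.absNorm p.asIdeal

lemma two_le_nrm (p : HeightOneSpectrum (𝓞 F)) : 2 ≤ nrm p := by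
  have h1 : nrm p ≠ 0 := by
    rw [nrm, Ne, Ideal.absNorm_eq_zero_iff]; exact p.ne_bot
  have h2 : nrm p ≠ 1 := by
    rw [nrm, Ne, Ideal.absNorm_eq_one_iff]; exact p.isPrime.ne_top
  omega

/-- The norm of a formal product of primes. -/
def mnrm (m : Multiset (HeightOneSpectrum (𝓞 F))) : ℕ := (m.map nrm).prod

lemma mnrm_cons (p) (m : Multiset (HeightOneSpectrum (𝓞 F))) : mnrm (p ::ₘ m) = nrm p * mnrm m := by
  simp [mnrm]

lemma mnrm_eq (m : Multiset (HeightOneSpectrum (𝓞 F))) :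
    mnrm m = Ideal.absNorm (m.map HeightOneSpectrum.asIdeal).prod := by
  rw [map_multiset_prod, Multiset.map_map]; rfl

/-- Formal products of primes are nonzero ideals. -/
lemma bijective_prod : Function.Bijective (fun m : Multiset (HeightOneSpectrum (𝓞 F)) =>
    (⟨(m.map HeightOneSpectrum.asIdeal).prod, mem_nonZeroDivisors_of_ne_zero (by
      refine Multiset.prod_ne_zero fun h => ?_
      obtain ⟨p, -, hp⟩ := Multiset.mem_map.1 h
      exact p.ne_bot hp)⟩ : nonZeroDivisors (Ideal (𝓞 F)))) := by
  constructor
  · intro m m' h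
    have h1 := Subtype.ext_iff.1 h
    have h2 : ∀ m : Multiset (HeightOneSpectrum (𝓞 F)),
        UniqueFactorizationMonoid.normalizedFactors (m.map HeightOneSpectrum.asIdeal).prod =
          m.map HeightOneSpectrum.asIdeal := by
      intro m
      refine UniqueFactorizationMonoid.normalizedFactors_prod_of_prime fun x hx => ?_
      obtain ⟨p, -, rfl⟩ := Multiset.mem_map.1 hx
      exact p.prime
    have h3 := h2 m
    simp only at h1
    rw [h1, h2 m'] at h3
    exact (Multiset.map_injective (fun _ _ h => HeightOneSpectrum.ext h) h3).symm
  · rintro ⟨I, hI⟩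
    obtain ⟨s, hs, hprod⟩ := UniqueFactorizationMonoid.exists_prime_factors I
      (nonZeroDivisors.ne_zero hI)
    obtain rfl := associated_iff_eq.1 hprod
    have : ∀ s : Multiset (Ideal (𝓞 F)), (∀ b ∈ s, Prime b) →
        ∃ m : Multiset (HeightOneSpectrum (𝓞 F)), m.map HeightOneSpectrum.asIdeal = s := by
      intro s
      induction s using Multiset.induction_on with
      | empty => exact fun _ => ⟨0, rfl⟩
      | cons a s ih =>
        intro h
        obtain ⟨m, hm⟩ := ih fun b hb => h b (Multiset.mem_cons_of_mem hb)
        have ha := h a (Multiset.mem_cons_self a s)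
        exact ⟨⟨a, Ideal.isPrime_of_prime ha, ha.ne_zero⟩ ::ₘ m, by simp [hm]⟩
    obtain ⟨m, rfl⟩ := this s hs
    exact ⟨m, rfl⟩

lemma finite_mnrm_le (x : ℝ) :
    {m : Multiset (HeightOneSpectrum (𝓞 F)) | (mnrm m : ℝ) ≤ x}.Finite := by
  have h1 := Ideal.finite_setOfPred_absNorm_le (S := 𝓞 F) ⌊x⌋₊
  refine Set.Finite.of_finite_image (f := fun m => (m.map HeightOneSpectrum.asIdeal).prod)
    (h1.subset ?_) ?_
  · rintro _ ⟨m, hm, rfl⟩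
    change Ideal.absNorm _ ≤ _
    rw [← mnrm_eq]
    exact Nat.le_floor hm
  · intro a _ b _ h
    exact bijective_prod.1 (Subtype.ext h)

open Filter Topology in
lemma tendsto_card_coprime (S : Finset (HeightOneSpectrum (𝓞 F))) : ∃ κ : ℝ, 0 < κ ∧
    Tendsto (fun x : ℝ => ({m : Multiset (HeightOneSpectrum (𝓞 F)) | (∀ p ∈ m, p ∉ S) ∧
      (mnrm m : ℝ) ≤ x}.ncard : ℝ) / x) atTop (𝓝 κ) := by
  classical
  induction S using Finset.induction_on with
  | empty =>
    refine ⟨dedekindZeta_residue F, dedekindZeta_residue_pos F, ?_⟩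
    refine (Ideal.tendsto_norm_le_div_atTop₀ F).congr fun x => ?_
    congr 2
    symm
    rw [← Nat.card_coe_set_eq]
    refine Nat.card_congr ((Equiv.ofBijective _ bijective_prod).subtypeEquiv fun m => ?_)
    simp only [Finset.notMem_empty, not_false_eq_true, implies_true, true_and,
      Equiv.ofBijective_apply, ← mnrm_eq]
    rfl
  | insert P S hP ih =>
    obtain ⟨κ, hκ, h⟩ := ih
    set c : ℝ → ℝ := fun x => ({m : Multiset (HeightOneSpectrum (𝓞 F)) | (∀ p ∈ m, p ∉ S) ∧
      (mnrm m : ℝ) ≤ x}.ncard : ℝ) with hc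
    have hq : (2 : ℝ) ≤ nrm P := by exact_mod_cast two_le_nrm P
    refine ⟨κ - κ / nrm P, ?_, ?_⟩
    · have : κ / nrm P ≤ κ / 2 := by gcongr
      linarith
    · have h2 : Tendsto (fun x : ℝ => x / nrm P) atTop atTop :=
        tendsto_id.atTop_div_const (by linarith)
      have h3 := h.sub ((h.comp h2).div_const (nrm P : ℝ))
      refine h3.congr fun x => ?_
      have h4 : c x = ({m : Multiset (HeightOneSpectrum (𝓞 F)) | (∀ p ∈ m, p ∉ insert P S) ∧
          (mnrm m : ℝ) ≤ x}.ncard : ℝ) + c (x / nrm P) := by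
        simp only [hc]
        have hinj : Function.Injective (fun m => P ::ₘ m) := fun a b h => by simpa using h
        have hq0 : (0 : ℝ) < nrm P := by linarith
        have hU : {m : Multiset (HeightOneSpectrum (𝓞 F)) | (∀ p ∈ m, p ∉ S) ∧
            (mnrm m : ℝ) ≤ x} = {m | (∀ p ∈ m, p ∉ insert P S) ∧ (mnrm m : ℝ) ≤ x} ∪
              (fun m => P ::ₘ m) '' {m | (∀ p ∈ m, p ∉ S) ∧ (mnrm m : ℝ) ≤ x / nrm P} := by
          ext m
          simp only [Set.mem_union, Set.mem_image, Set.mem_ofPred_eq]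
          constructor
          · rintro ⟨h5, h6⟩
            by_cases hPm : P ∈ m
            · right
              obtain ⟨m, rfl⟩ := Multiset.exists_cons_of_mem hPm
              refine ⟨m, ⟨fun p hp => h5 p (Multiset.mem_cons_of_mem hp), ?_⟩, rfl⟩
              rw [mnrm_cons, Nat.cast_mul] at h6
              rw [le_div_iff₀ hq0]; linarith
            · left
              refine ⟨fun p hp => ?_, h6⟩
              rw [Finset.mem_insert, not_or]
              refine ⟨?_, h5 p hp⟩
              rintro rfl
              exact hPm hp
          · rintro (⟨h5, h6⟩ | ⟨m, ⟨h5, h6⟩, rfl⟩)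
            · exact ⟨fun p hp h => h5 p hp (Finset.mem_insert_of_mem h), h6⟩
            · refine ⟨fun p hp => ?_, ?_⟩
              · rcases Multiset.mem_cons.1 hp with rfl | hp
                · exact hP
                · exact h5 p hp
              · rw [mnrm_cons, Nat.cast_mul]
                rw [le_div_iff₀ hq0] at h6; linarith
        rw [hU, Set.ncard_union_eq _ ((finite_mnrm_le x).subset fun m hm => hm.2)
          (((finite_mnrm_le (x / nrm P)).subset fun m hm => hm.2).image _),
          Set.ncard_image_of_injective _ hinj, Nat.cast_add]
        rw [Set.disjoint_left]
        rintro _ ⟨h5, -⟩ ⟨m, -, rfl⟩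
        exact h5 P (Multiset.mem_cons_self P m) (Finset.mem_insert_self P S)
      change c x / x - c (x / nrm P) / (x / nrm P) / nrm P = _
      rw [h4]
      field_simp
      ring
end counting

end

section

namespace QuadExt

variable {F : Type} [Field F] [NumberField F] {E : Type} [Field E] [NumberField E] [Algebra F E]

omit [NumberField F] in
lemma nrm_conj {c : F} (Q : QuadExt c E) (P : HeightOneSpectrum (𝓞 E)) :
    nrm (Q.conj P) = nrm P := by
  have e : 𝓞 E ⧸ (Q.conj P).asIdeal ≃+* 𝓞 E ⧸ P.asIdeal :=
    Ideal.quotientEquiv _ _ Q.τ (by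
      change P.asIdeal = Ideal.map Q.τ (Ideal.comap Q.τ P.asIdeal)
      exact (Ideal.map_comap_of_surjective _ Q.τ.surjective _).symm)
  rw [nrm, nrm, Ideal.absNorm_apply, Ideal.absNorm_apply, Submodule.cardQuot_apply,
    Submodule.cardQuot_apply]
  exact Nat.card_congr e.toEquiv

lemma nrm_le [Algebra.IsQuadraticExtension F E] {c : F} (Q : QuadExt c E)
    {P : HeightOneSpectrum (𝓞 E)} (h : Q.conj P ≠ P) : nrm P ≤ nrm (below (F := F) P) := by
  have hle : ∀ P : HeightOneSpectrum (𝓞 E), P.asIdeal ∣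
      (below (F := F) P).asIdeal.map (algebraMap (𝓞 F) (𝓞 E)) := fun P => by
    rw [Ideal.dvd_iff_le, Ideal.map_le_iff_le_comap]; exact le_rfl
  have h1 := hle P
  have h2 := hle (Q.conj P)
  rw [below_conj] at h2
  have hcop : IsCoprime (Q.conj P).asIdeal P.asIdeal := by
    apply Ideal.isCoprime_of_isMaximal
    exact fun h' => h (HeightOneSpectrum.ext h')
  have h3 := hcop.mul_dvd h2 h1
  have h4 := map_dvd Ideal.absNorm h3
  rw [map_mul, Ideal.absNorm_algebraMap] at h4
  have h5 : Module.finrank (𝓞 F) (𝓞 E) = 2 := by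
    rw [← Algebra.IsQuadraticExtension.finrank_eq_two F E]
    exact (Algebra.IsAlgebraic.finrank_of_isFractionRing (𝓞 F) F (𝓞 E) E).symm
  rw [h5] at h4
  have h6 := Nat.le_of_dvd (pow_pos (by have := two_le_nrm (below (F := F) P); exact lt_of_lt_of_le two_pos this) 2) h4
  have h7 := Q.nrm_conj P
  change nrm (Q.conj P) * nrm P ≤ nrm (below P) ^ 2 at h6
  rw [h7] at h6
  nlinarith

end QuadExt

variable {F : Type} [Field F] [NumberField F]

theorem exists_unit_notMem_outside {u : Fˣ} (hu : ¬ IsSquare (u : F))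
    (S : Finset (HeightOneSpectrum (𝓞 F))) :
    ∃ p ∉ S, u ∉ LocSq p := by
  classical
  by_contra hcon
  push Not at hcon
  obtain ⟨E, _, _, _, _, ⟨Q⟩⟩ := exists_quadExt hu
  have hab := fun p : HeightOneSpectrum (𝓞 F) => QuadExt.exists_above (E := E) p
  choose g hg using hab
  set g' := fun p => Q.conj (g p) with hg'
  have hg'b : ∀ p, QuadExt.below (F := F) (g' p) = p := fun p => by
    rw [hg', QuadExt.below_conj, hg]
  have hne : ∀ p ∉ S, g' p ≠ g p := fun p hp =>
    Q.conj_ne (P := g p) (by rw [hg]; exact hcon p hp)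
  have hn : ∀ p ∉ S, nrm (g p) ≤ nrm p := fun p hp => by
    have := Q.nrm_le (hne p hp)
    rwa [hg] at this
  have hn' : ∀ p ∉ S, nrm (g' p) ≤ nrm p := fun p hp => by
    rw [hg', Q.nrm_conj]; exact hn p hp
  have hginj : Function.Injective g := Function.LeftInverse.injective hg
  have hg'inj : Function.Injective g' := Function.LeftInverse.injective hg'b
  obtain ⟨κ, hκ, h1⟩ := tendsto_card_coprime S
  obtain ⟨κ', -, h2⟩ := tendsto_card_coprime (∅ : Finset (HeightOneSpectrum (𝓞 E)))
  let X := {m : Multiset (HeightOneSpectrum (𝓞 F)) // ∀ p ∈ m, p ∉ S}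
  refine no_pairs_injection (X := X) (Y := Multiset (HeightOneSpectrum (𝓞 E)))
    (fun m => mnrm m.1) mnrm ?_ finite_mnrm_le (κ := κ) (κ' := κ') hκ ?_ ?_
    (fun m => m.1.1.map g + m.2.1.map g') ?_ ?_
  · intro x
    exact Set.Finite.preimage Subtype.val_injective.injOn (finite_mnrm_le x)
  · refine h1.congr fun x => ?_
    congr 2
    rw [← Set.ncard_image_of_injective _ Subtype.val_injective]
    congr 1
    ext m
    simp only [Set.mem_image, Set.mem_ofPred_eq, X]
    constructor
    · rintro ⟨h3, h4⟩
      exact ⟨⟨m, h3⟩, h4, rfl⟩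
    · rintro ⟨⟨m, h3⟩, h4, rfl⟩
      exact ⟨h3, h4⟩
  · simpa using h2
  · have hcount : ∀ a b : X, ∀ p ∉ S, (a.1.map g + b.1.map g').count (g p) = a.1.count p := by
      intro a b p hp
      have h0 : (b.1.map g').count (g p) = 0 := Multiset.count_eq_zero.2 fun h => by
        obtain ⟨q, hq, h⟩ := Multiset.mem_map.1 h
        have : q = p := by rw [← hg'b q, h, hg]
        subst this
        exact hne q hp h
      rw [Multiset.count_add, Multiset.count_map_eq_count' _ _ hginj, h0, add_zero]
    have hcount' : ∀ a b : X, ∀ p ∉ S, (a.1.map g + b.1.map g').count (g' p) = b.1.count p := by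
      intro a b p hp
      have h0 : (a.1.map g).count (g' p) = 0 := Multiset.count_eq_zero.2 fun h => by
        obtain ⟨q, hq, h⟩ := Multiset.mem_map.1 h
        have : q = p := by rw [← hg q, h, hg'b]
        subst this
        exact hne q hp h.symm
      rw [Multiset.count_add, Multiset.count_map_eq_count' _ _ hg'inj, h0, zero_add]
    have hout : ∀ a : X, ∀ p ∈ S, a.1.count p = 0 := fun a p hp =>
      Multiset.count_eq_zero.2 fun h => a.2 p h hp
    rintro ⟨a, b⟩ ⟨a', b'⟩ h
    simp only at h
    refine Prod.ext (Subtype.ext (Multiset.ext.2 fun p => ?_))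
      (Subtype.ext (Multiset.ext.2 fun p => ?_))
    · by_cases hp : p ∈ S
      · rw [hout _ p hp, hout _ p hp]
      · rw [← hcount a b p hp, h, hcount _ _ p hp]
    · by_cases hp : p ∈ S
      · rw [hout _ p hp, hout _ p hp]
      · rw [← hcount' a b p hp, h, hcount' _ _ p hp]
  · rintro ⟨a, ha⟩ ⟨b, hb⟩
    have key : ∀ (g : HeightOneSpectrum (𝓞 F) → HeightOneSpectrum (𝓞 E)),
        (∀ p ∉ S, nrm (g p) ≤ nrm p) → ∀ a : Multiset (HeightOneSpectrum (𝓞 F)),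
        (∀ p ∈ a, p ∉ S) → mnrm (a.map g) ≤ mnrm a := by
      intro g hg a ha
      induction a using Multiset.induction_on with
      | empty => simp [mnrm]
      | cons p m ih =>
        rw [Multiset.map_cons, mnrm_cons, mnrm_cons]
        exact Nat.mul_le_mul (hg p (ha p (Multiset.mem_cons_self p m)))
          (ih fun q hq => ha q (Multiset.mem_cons_of_mem hq))
    have hadd : mnrm (a.map g + b.map g') = mnrm (a.map g) * mnrm (b.map g') := by
      simp [mnrm]
    simp only
    rw [hadd]
    exact Nat.mul_le_mul (key g hn a ha) (key g' hn' b hb)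

end

section

section groups

variable {G : Type*} [CommGroup G]

lemma relIndex_le_two {H K : Subgroup G}
    (h : ∀ x ∈ K, ∀ y ∈ K, x ∉ H → y ∉ H → x * y ∈ H) :
    H.relIndex K ≠ 0 ∧ H.relIndex K ≤ 2 := by
  by_cases hle : K ≤ H
  · rw [Subgroup.relIndex_eq_one.2 hle]; simp
  · obtain ⟨a, ha, haH⟩ := Set.not_subset.1 hle
    have : H.relIndex K = 2 := by
      rw [Subgroup.relIndex, Subgroup.index_eq_two_iff]
      refine ⟨⟨a, ha⟩, fun b => ?_⟩
      rw [xor_iff_iff_not]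
      simp only [Subgroup.mem_subgroupOf, Subgroup.coe_mul]
      constructor
      · intro h1 h2
        exact haH ((H.mul_mem_cancel_left h2).1 h1)
      · intro h1
        exact h _ b.2 _ ha h1 haH
    rw [this]; simp

variable {I : Type*} [DecidableEq I] {T : Finset I} {M : I → Subgroup G} {g : I → G}

lemma prod_mem_iff (h1 : ∀ w ∈ T, g w ∉ M w) (h2 : ∀ w ∈ T, ∀ w' ∈ T, w' ≠ w → g w' ∈ M w)
    {A : Finset I} (hA : A ⊆ T) {w : I} (hw : w ∈ T) : ∏ i ∈ A, g i ∈ M w ↔ w ∉ A := by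
  constructor
  · intro h hwA
    rw [← Finset.mul_prod_erase _ _ hwA] at h
    refine h1 w hw ((Subgroup.mul_mem_cancel_right _ (Subgroup.prod_mem _ fun i hi => ?_)).1 h)
    exact h2 w hw i (hA (Finset.mem_of_mem_erase hi)) (Finset.ne_of_mem_erase hi)
  · intro h
    refine Subgroup.prod_mem _ fun i hi => h2 w hw i (hA hi) ?_
    rintro rfl
    exact h hi

lemma two_pow_le_relIndex (h1 : ∀ w ∈ T, g w ∉ M w)
    (h2 : ∀ w ∈ T, ∀ w' ∈ T, w' ≠ w → g w' ∈ M w) {N U : Subgroup G}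
    (hN : ∀ w ∈ T, N ≤ M w) (hg : ∀ w ∈ T, g w ∈ U) (h0 : N.relIndex U ≠ 0) :
    2 ^ T.card ≤ N.relIndex U := by
  rw [← Finset.card_powerset, ← Fintype.card_coe, ← Nat.card_eq_fintype_card]
  have : Finite (U ⧸ N.subgroupOf U) := Nat.finite_of_card_ne_zero h0
  refine Nat.card_le_card_of_injective (fun A : T.powerset =>
    (QuotientGroup.mk (⟨∏ i ∈ A.1, g i, U.prod_mem fun i hi =>
      hg i (Finset.mem_powerset.1 A.2 hi)⟩ : U) : U ⧸ N.subgroupOf U)) ?_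
  rintro ⟨A, hA⟩ ⟨B, hB⟩ h
  rw [QuotientGroup.eq, Subgroup.mem_subgroupOf] at h
  rw [Finset.mem_powerset] at hA hB
  ext w
  simp only
  by_cases hw : w ∈ T
  · have h3 := hN w hw h
    have hA' := prod_mem_iff h1 h2 hA hw
    have hB' := prod_mem_iff h1 h2 hB hw
    simp only [Subgroup.coe_mul, InvMemClass.coe_inv] at h3
    have h4 : ∏ i ∈ A, g i ∈ M w ↔ ∏ i ∈ B, g i ∈ M w := by
      constructor
      · intro h5
        exact (Subgroup.mul_mem_cancel_left _ (inv_mem h5)).1 h3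
      · intro h5
        exact inv_mem_iff.1 ((Subgroup.mul_mem_cancel_right _ h5).1 h3)
    rw [hA', hB'] at h4
    tauto
  · exact ⟨fun h => absurd (hA h) hw, fun h => absurd (hB h) hw⟩

end groups

variable {F : Type} [Field F] [NumberField F]

/-- Weak approximation at finitely many primes. -/
theorem exists_approx (S : Finset (HeightOneSpectrum (𝓞 F)))
    (x : HeightOneSpectrum (𝓞 F) → F) (n : ℕ) :
    ∃ y : F, ∀ p ∈ S, p.valuation F (y - x p) ≤ WithZero.exp (-(n : ℤ)) := by
  classical
  obtain ⟨⟨D, hD⟩, h_int⟩ := IsLocalization.exist_integer_multiples_of_finset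
    (nonZeroDivisors (𝓞 F)) (S.image x)
  have hD0 : algebraMap (𝓞 F) F D ≠ 0 := by
    simpa using nonZeroDivisors.ne_zero hD
  have h_int' : ∀ p ∈ S, ∃ z : 𝓞 F, algebraMap (𝓞 F) F z = algebraMap (𝓞 F) F D * x p := by
    intro p hp
    obtain ⟨z, hz⟩ := h_int (x p) (Finset.mem_image_of_mem _ hp)
    exact ⟨z, by rw [hz, Algebra.smul_def]⟩
  choose! z hz using h_int'
  set m : HeightOneSpectrum (𝓞 F) → ℕ := fun p => (- lv p (Units.mk0 _ hD0)).toNat with hm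
  have hvD : ∀ p : HeightOneSpectrum (𝓞 F),
      WithZero.exp (-(m p : ℤ)) ≤ p.valuation F (algebraMap (𝓞 F) F D) := by
    intro p
    have hmp : (m p : ℤ) = _ := Int.toNat_of_nonneg (a := - lv p (Units.mk0 _ hD0)) (by
      have h3 := p.valuation_le_one (K := F) D
      have := exp_lv (p := p) (Units.mk0 _ hD0)
      rw [Units.val_mk0] at this
      rw [← this, ← WithZero.exp_zero, WithZero.exp_le_exp] at h3
      omega)
    have := exp_lv (p := p) (Units.mk0 _ hD0)
    rw [Units.val_mk0] at this
    rw [← this, WithZero.exp_le_exp]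
    omega
  obtain ⟨y, hy⟩ := IsDedekindDomain.exists_forall_sub_mem_ideal (s := S)
    (fun p : HeightOneSpectrum (𝓞 F) => p.asIdeal) (fun p => n + m p) (fun p _ => p.prime)
    (fun p _ q _ h h' => h (HeightOneSpectrum.ext h')) (fun p => z p.1)
  refine ⟨algebraMap (𝓞 F) F y / algebraMap (𝓞 F) F D, fun p hp => ?_⟩
  have h1 := hy p hp
  rw [← p.intValuation_le_pow_iff_mem, ← p.valuation_of_algebraMap (K := F)] at h1
  change p.valuation F (algebraMap (𝓞 F) F (y - z p)) ≤ _ at h1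
  rw [map_sub, hz p hp] at h1
  have h2 : algebraMap (𝓞 F) F y / algebraMap (𝓞 F) F D - x p =
      (algebraMap (𝓞 F) F y - algebraMap (𝓞 F) F D * x p) / algebraMap (𝓞 F) F D := by
    field_simp
  have hpos : 0 < p.valuation F (algebraMap (𝓞 F) F D) := by
    rw [zero_lt_iff]; simpa using nonZeroDivisors.ne_zero hD
  rw [h2, map_div₀, div_le_iff₀ hpos]
  refine h1.trans ?_
  rw [Nat.cast_add, neg_add, WithZero.exp_add]
  gcongr
  exact hvD p

theorem exists_unit_approx (S : Finset (HeightOneSpectrum (𝓞 F)))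
    (w : HeightOneSpectrum (𝓞 F) → Fˣ) :
    ∃ g : Fˣ, ∀ p ∈ S, p.valuation F ((g : F) - w p) < p.valuation F (4 * (w p : F)) := by
  have h4 : (4 : F) ≠ 0 := by norm_num
  set n := S.sup (fun p => (1 - lv p (Units.mk0 4 h4 * w p)).toNat) with hn
  obtain ⟨y, hy⟩ := exists_approx S (fun p => (w p : F)) n
  have hy' : ∀ p ∈ S, p.valuation F (y - w p) < p.valuation F (4 * (w p : F)) := by
    intro p hp
    refine (hy p hp).trans_lt ?_
    have h1 := exp_lv (p := p) (Units.mk0 4 h4 * w p)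
    rw [Units.val_mul, Units.val_mk0] at h1
    rw [← h1, WithZero.exp_lt_exp]
    have h2 : (1 - lv p (Units.mk0 4 h4 * w p)).toNat ≤ n :=
      Finset.le_sup (f := fun p => (1 - lv p (Units.mk0 4 h4 * w p)).toNat) hp
    omega
  rcases eq_or_ne y 0 with rfl | h0
  · refine ⟨1, fun p hp => absurd (hy' p hp) ?_⟩
    rw [zero_sub, Valuation.map_neg, map_mul, not_lt]
    exact mul_le_of_le_one_left zero_le (valuation_four_le_one p)
  · exact ⟨Units.mk0 y h0, fun p hp => hy' p hp⟩

lemma finite_not_odd : {p : HeightOneSpectrum (𝓞 F) | ¬ Odd' p}.Finite := by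
  have h2 : (2 : F) ≠ 0 := by norm_num
  refine (finite_lv_ne_zero (Units.mk0 2 h2)).subset fun p hp h => hp ?_
  rwa [lv_eq_zero_iff] at h

/-- A nonsquare unit is a nonsquare at some prime at which a given `b` is a square. -/
theorem exists_separating_prime {u b : Fˣ} (hu : ¬ IsSquare (u : F))
    (hub : ¬ IsSquare ((u * b : Fˣ) : F)) (S : Finset (HeightOneSpectrum (𝓞 F))) :
    ∃ p ∉ S, Odd' p ∧ b ∈ LocSq p ∧ lv p u = 0 ∧ u ∉ LocSq p := by
  classical
  set S' := S ∪ (finite_not_odd (F := F)).toFinset ∪ (finite_lv_ne_zero u).toFinset ∪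
    (finite_lv_ne_zero b).toFinset with hS'
  have hS'' : ∀ p ∉ S', p ∉ S ∧ Odd' p ∧ lv p u = 0 ∧ lv p b = 0 := by
    intro p hp
    simp only [hS', Finset.mem_union, Set.Finite.mem_toFinset, Set.mem_ofPred_eq, not_or,
      not_not] at hp
    tauto
  by_cases hb : IsSquare (b : F)
  · obtain ⟨p, hp, hpu⟩ := exists_unit_notMem_outside hu S'
    obtain ⟨h1, h2, h3, h4⟩ := hS'' p hp
    refine ⟨p, h1, h2, ?_, h3, hpu⟩
    obtain ⟨r, hr⟩ := hb
    have hr0 : r ≠ 0 := by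
      rintro rfl
      exact b.ne_zero (by simp at hr)
    exact mem_locSq_of_isSquare ⟨Units.mk0 r hr0, Units.ext hr⟩
  · obtain ⟨E, _, _, _, _, ⟨Q⟩⟩ := exists_quadExt hb
    have hE : ¬ IsSquare ((QuadExt.ui F E u : Eˣ) : E) := by
      rintro ⟨y, hy⟩
      change algebraMap F E u = _ at hy
      obtain ⟨s, t, rfl⟩ := Q.rep y
      have h1 : algebraMap F E (s * s + t * t * b - u) + algebraMap F E (2 * s * t) * Q.r = 0 := by
        have := Q.r_sq
        simp only [map_sub, map_add, map_mul, hy, ← this, map_ofNat]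
        ring
      obtain ⟨h2, h3⟩ := Q.eq_zero h1
      have h4 : s = 0 ∨ t = 0 := by
        rcases mul_eq_zero.1 h3 with h | h
        · left; simpa using h
        · exact Or.inr h
      rcases h4 with rfl | rfl
      · apply hub
        refine ⟨t * b, ?_⟩
        rw [Units.val_mul]
        linear_combination -(b : F) * h2
      · apply hu
        exact ⟨s, by linear_combination -h2⟩
    obtain ⟨P, hP, hPu⟩ := exists_unit_notMem_outside hE (QuadExt.above E S')
    rw [QuadExt.mem_above] at hP
    obtain ⟨h1, h2, h3, h4⟩ := hS'' _ hP
    have hlift : ∀ w : Fˣ, w ∈ LocSq (QuadExt.below (F := F) P) → QuadExt.ui F E w ∈ LocSq P := by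
      rintro w ⟨x, hx⟩
      refine ⟨algebraMap F E x, ?_⟩
      rw [← QuadExt.valuation_lt_iff (E := E)] at hx
      simp only [map_sub, map_mul, map_pow, map_one, map_ofNat] at hx
      exact hx
    have h5 : u ∉ LocSq (QuadExt.below (F := F) P) := fun h => hPu (hlift u h)
    refine ⟨_, h1, h2, ?_, h3, h5⟩
    by_contra hbn
    have h6 := hlift _ (mul_mem_locSq_of_units h2 h3 h4 h5 hbn)
    have hr0 : Q.r ≠ 0 := by
      intro h
      have := Q.r_sq
      rw [h, zero_pow two_ne_zero] at this
      exact b.ne_zero ((map_eq_zero _).1 this.symm)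
    have h7 : QuadExt.ui F E (u * b) = QuadExt.ui F E u * (Units.mk0 Q.r hr0) ^ 2 := by
      ext
      rw [map_mul]
      push_cast
      rw [Units.val_mk0, Q.r_sq]
      rfl
    rw [h7, mul_sq_mem_locSq_iff] at h6
    exact hPu h6

/-- Every finite set of primes is contained in a finite one outside of which all ideals are
principal. -/
theorem exists_classTriv (S : Finset (HeightOneSpectrum (𝓞 F))) :
    ∃ S' : Finset (HeightOneSpectrum (𝓞 F)), S ⊆ S' ∧ ClassTriv (S' : Set (HeightOneSpectrum (𝓞 F))) := by
  classical
  choose J hJ using fun c : ClassGroup (𝓞 F) => ClassGroup.mk0_surjective c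
  have hfin : ∀ c, {q : HeightOneSpectrum (𝓞 F) | q.asIdeal ∣ (J c : Ideal (𝓞 F))}.Finite := fun c =>
    Ideal.finite_factors (nonZeroDivisors.ne_zero (J c).2)
  refine ⟨S ∪ Finset.univ.biUnion fun c => (hfin c).toFinset, Finset.subset_union_left, ?_⟩
  intro p hp
  set P : nonZeroDivisors (Ideal (𝓞 F)) := ⟨p.asIdeal, mem_nonZeroDivisors_of_ne_zero p.ne_bot⟩
  set c := (ClassGroup.mk0 P)⁻¹ with hc
  have hout : ∀ q : HeightOneSpectrum (𝓞 F), q ∉ (↑(S ∪ Finset.univ.biUnion fun c =>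
      (hfin c).toFinset) : Set (HeightOneSpectrum (𝓞 F))) → ¬ q.asIdeal ∣ (J c : Ideal (𝓞 F)) := by
    intro q hq h
    apply hq
    simp only [Finset.coe_union, Set.mem_union, Finset.mem_coe, Finset.mem_biUnion]
    exact Or.inr ⟨c, Finset.mem_univ _, by simpa using h⟩
  have h1 : ClassGroup.mk0 (P * J c) = 1 := by
    rw [map_mul, hJ, hc, mul_inv_cancel]
  rw [ClassGroup.mk0_eq_one_iff] at h1
  obtain ⟨⟨a, ha⟩⟩ := h1
  simp only [Submonoid.coe_mul, Ideal.submodule_span_eq, P] at ha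
  have ha0 : a ≠ 0 := by
    rintro rfl
    simp only [Ideal.span_singleton_zero] at ha
    rcases mul_eq_zero.1 ha with h | h
    · exact p.ne_bot h
    · exact nonZeroDivisors.ne_zero (J c).2 h
  have h0 : algebraMap (𝓞 F) F a ≠ 0 := by simpa using ha0
  have hdvd : ∀ I : Ideal (𝓞 F), a ∈ I ↔ I ∣ p.asIdeal * J c := by
    intro I
    rw [ha, Ideal.dvd_span_singleton]
  refine ⟨Units.mk0 _ h0, ?_, ?_⟩
  · apply le_antisymm
    · have h2 : a ∈ p.asIdeal ^ 1 := by
        rw [pow_one, hdvd]; exact dvd_mul_right _ _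
      rw [← p.intValuation_le_pow_iff_mem, ← p.valuation_of_algebraMap (K := F)] at h2
      have h3 := exp_lv (p := p) (Units.mk0 _ h0)
      rw [Units.val_mk0] at h3
      rw [← h3, WithZero.exp_le_exp] at h2
      simpa using h2
    · by_contra hlt
      have h2 : a ∈ p.asIdeal ^ 2 := by
        rw [← p.intValuation_le_pow_iff_mem, ← p.valuation_of_algebraMap (K := F)]
        have h3 := exp_lv (p := p) (Units.mk0 _ h0)
        rw [Units.val_mk0] at h3
        rw [← h3, WithZero.exp_le_exp]
        push_cast
        omega
      rw [hdvd, pow_two] at h2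
      exact hout p hp ((mul_dvd_mul_iff_left p.ne_bot).1 h2)
  · intro q hq hqp
    rw [lv_eq_zero_iff, Units.val_mk0]
    refine le_antisymm (q.valuation_le_one a) (not_lt.1 fun hlt => ?_)
    rw [q.valuation_lt_one_iff_mem, hdvd] at hlt
    rcases q.prime.dvd_or_dvd hlt with h | h
    · refine hqp (HeightOneSpectrum.ext ?_)
      exact (p.isMaximal.eq_of_le q.isPrime.ne_top (Ideal.dvd_iff_le.1 h)).symm
    · exact hout q hq h

end

section

variable {F : Type} [Field F] [NumberField F]

/-- A set of auxiliary primes at which `b` is a square, and on which `S`-units take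
arbitrary quadratic characters. -/
def Aux (S : Finset (HeightOneSpectrum (𝓞 F))) (b : Fˣ) (T : Finset (HeightOneSpectrum (𝓞 F))) :
    Prop :=
  ∀ w ∈ T, w ∉ S ∧ b ∈ LocSq w ∧ ∃ u ∈ sUnit (S : Set (HeightOneSpectrum (𝓞 F))),
    u ∉ LocSq w ∧ ∀ w' ∈ T, w' ≠ w → u ∈ LocSq w'

lemma mem_map_sq {S : Set (HeightOneSpectrum (𝓞 F))} {u : Fˣ} (hu : u ∈ sUnit S)
    (h : IsSquare (u : F)) : u ∈ (sUnit S).map (powMonoidHom 2) := by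
  obtain ⟨r, hr⟩ := h
  have hr0 : r ≠ 0 := by
    rintro rfl
    exact u.ne_zero (by simp at hr)
  have hur : (Units.mk0 r hr0) ^ 2 = u := by
    ext; push_cast; rw [Units.val_mk0, hr, pow_two]
  refine ⟨Units.mk0 r hr0, ?_, hur⟩
  intro p hp
  have h1 := hu p hp
  rw [← hur, lv_pow] at h1
  simpa using h1

lemma mem_locSq_of_isSquare_val {p : HeightOneSpectrum (𝓞 F)} {u : Fˣ} (h : IsSquare (u : F)) :
    u ∈ LocSq p := by
  obtain ⟨v, -, rfl⟩ := mem_map_sq (S := Set.univ) (u := u) (fun p hp => absurd trivial hp) h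
  exact sq_mem_locSq v

theorem Aux.exists_card {S : Finset (HeightOneSpectrum (𝓞 F))} {b : Fˣ}
    (hd : ∀ p, ¬ Odd' p → p ∈ S) (k : ℕ)
    (hk : k + 1 ≤ S.card + Fintype.card (InfinitePlace F)) :
    ∃ T : Finset (HeightOneSpectrum (𝓞 F)), T.card = k ∧ Aux S b T := by
  classical
  induction k with
  | zero => exact ⟨∅, rfl, fun w hw => absurd hw (Finset.notMem_empty w)⟩
  | succ k ih =>
    obtain ⟨T, hT, hA⟩ := ih (by omega)
    set U := sUnit (S : Set (HeightOneSpectrum (𝓞 F))) with hU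
    set V : Subgroup Fˣ := ⨅ p : T, LocSq (p : HeightOneSpectrum (𝓞 F)) with hV
    have hVm : ∀ u, u ∈ V ↔ ∀ p ∈ T, u ∈ LocSq p := by
      intro u; rw [hV, Subgroup.mem_iInf]; simp
    have hex : ∃ u ∈ U, u ∈ V ∧ ¬ IsSquare (u : F) ∧ ¬ IsSquare ((u * b : Fˣ) : F) := by
      by_contra hcon
      push Not at hcon
      have hU2 : (U.map (powMonoidHom 2)).relIndex U = 2 ^ (S.card + Fintype.card (InfinitePlace F)) := by
        rw [← sqIndex_eq_relIndex, sqIndex_sUnit]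
      have hle : U.map (powMonoidHom 2) ≤ V ⊓ U := by
        rintro _ ⟨u, hu, rfl⟩
        refine Subgroup.mem_inf.2 ⟨(hVm _).2 fun p _ => sq_mem_locSq u, U.pow_mem hu 2⟩
      have h1 := Subgroup.relIndex_mul_relIndex _ _ _ hle (inf_le_right : V ⊓ U ≤ U)
      rw [hU2, Subgroup.inf_relIndex_right V U] at h1
      have h2 : V.relIndex U ≤ 2 ^ k := by
        calc V.relIndex U ≤ ∏ p : T, (LocSq (p : HeightOneSpectrum (𝓞 F))).relIndex U :=
              Subgroup.relIndex_iInf_le _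
          _ ≤ ∏ p : T, 2 := by
            refine Finset.prod_le_prod' fun p _ => (relIndex_le_two ?_).2
            intro x hx y hy hxn hyn
            have hpS := (hA p p.2).1
            exact mul_mem_locSq_of_units (by by_contra h; exact hpS (hd _ h))
              (hx p hpS) (hy p hpS) hxn hyn
          _ = 2 ^ k := by simp [hT]
      have h3 : (U.map (powMonoidHom 2)).relIndex (V ⊓ U) ≤ 2 := by
        refine (relIndex_le_two ?_).2
        intro x hx y hy hxn hyn
        obtain ⟨hxV, hxU⟩ := Subgroup.mem_inf.1 hx
        obtain ⟨hyV, hyU⟩ := Subgroup.mem_inf.1 hy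
        have hx2 := hcon x hxU hxV fun h => hxn (mem_map_sq hxU h)
        have hy2 := hcon y hyU hyV fun h => hyn (mem_map_sq hyU h)
        refine mem_map_sq (U.mul_mem hxU hyU) ?_
        obtain ⟨r, hr⟩ := hx2
        obtain ⟨s, hs⟩ := hy2
        refine ⟨r * s / b, ?_⟩
        have hb := b.ne_zero
        rw [Units.val_mul] at hr hs ⊢
        field_simp
        linear_combination (y : F) * b * hr + r * r * hs
      have h4 : 2 ^ (S.card + Fintype.card (InfinitePlace F)) ≤ 2 * 2 ^ k := by
        rw [← h1]; exact Nat.mul_le_mul h3 h2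
      rw [← pow_succ', Nat.pow_le_pow_iff_right (by norm_num)] at h4
      omega
    obtain ⟨u, huU, huV, hu, hub⟩ := hex
    rw [hVm] at huV
    obtain ⟨p, hp, hpo, hbp, hup, hun⟩ := exists_separating_prime hu hub (S ∪ T)
    rw [Finset.mem_union, not_or] at hp
    refine ⟨insert p T, by rw [Finset.card_insert_of_notMem hp.2, hT], ?_⟩
    intro w hw
    rcases Finset.mem_insert.1 hw with rfl | hwT
    · refine ⟨hp.1, hbp, u, huU, hun, fun w' hw' hne => ?_⟩
      exact huV w' ((Finset.mem_insert.1 hw').resolve_left hne)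
    · obtain ⟨h1, h2, v, hvU, hv, hv'⟩ := hA w hwT
      have hpw : p ≠ w := by rintro rfl; exact hp.2 hwT
      refine ⟨h1, h2, ?_⟩
      by_cases hvp : v ∈ LocSq p
      · refine ⟨v, hvU, hv, fun w' hw' hne => ?_⟩
        rcases Finset.mem_insert.1 hw' with rfl | h
        · exact hvp
        · exact hv' w' h hne
      · refine ⟨v * u, U.mul_mem hvU huU, ?_, fun w' hw' hne => ?_⟩
        · rwa [(LocSq w).mul_mem_cancel_right (huV w hwT)]
        · rcases Finset.mem_insert.1 hw' with rfl | h
          · exact mul_mem_locSq_of_units hpo (hvU w' hp.1) hup hvp hun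
          · exact (LocSq w').mul_mem (hv' w' h hne) (huV w' h)

lemma isSquare_of_aux [DecidableEq (HeightOneSpectrum (𝓞 F))] {S : Finset (HeightOneSpectrum (𝓞 F))} {b : Fˣ}
    {T : Finset (HeightOneSpectrum (𝓞 F))} (hd : ∀ p, ¬ Odd' p → p ∈ S)
    (hS : ClassTriv (S : Set (HeightOneSpectrum (𝓞 F)))) (hT : Aux S b T) {c : Fˣ}
    (hc : c ∈ sUnit ((S ∪ T : Finset _) : Set (HeightOneSpectrum (𝓞 F)))) (hpos : RealPos (c : F))
    (hcS : ∀ p ∈ S, c ∈ LocSq p) : IsSquare (c : F) := by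
  classical
  by_contra hsq
  obtain ⟨E, _, _, _, _, ⟨Q⟩⟩ := exists_quadExt hsq
  set T' := T.filter (fun w => c ∉ LocSq w) with hT'
  have hTd : ∀ p ∈ S ∪ T, p ∉ T' → c ∈ LocSq p := by
    intro p hp hpT
    rcases Finset.mem_union.1 hp with h | h
    · exact hcS p h
    · by_contra hn
      exact hpT (Finset.mem_filter.2 ⟨h, hn⟩)
  obtain ⟨h0, hle⟩ := Q.relIndex_norm_le hpos (S := S ∪ T)
    (fun p hp => Finset.mem_union_left _ (hd p hp))
    (hS.mono (by simp)) hc T' hTd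
  choose! hTS hTb u huU huw huw' using hT
  have hodd : ∀ w ∈ T, Odd' w := fun w hw => by
    by_contra h; exact hTS w hw (hd _ h)
  have hUU : sUnit (S : Set (HeightOneSpectrum (𝓞 F))) ≤
      sUnit ((S ∪ T : Finset _) : Set (HeightOneSpectrum (𝓞 F))) := sUnit_mono (by simp)
  have hg : ∀ w ∈ T', ∃ g ∈ sUnit ((S ∪ T : Finset _) : Set (HeightOneSpectrum (𝓞 F))),
      g ∉ locNm w (c : F) ∧ ∀ w' ∈ T', w' ≠ w → g ∈ LocSq w' := by
    intro w hw
    obtain ⟨hwT, hcw⟩ := Finset.mem_filter.1 hw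
    by_cases hev : Even (lv w c)
    · obtain ⟨π, h1, h2⟩ := hS w (by simpa using hTS w hwT)
      set A := (T.erase w).filter (fun w' => π ∉ LocSq w') with hA
      have hAT : A ⊆ T := (Finset.filter_subset _ _).trans (Finset.erase_subset _ _)
      have hprod : ∏ i ∈ A, u i ∈ sUnit (S : Set (HeightOneSpectrum (𝓞 F))) :=
        Subgroup.prod_mem _ fun i hi => huU i (hAT hi)
      refine ⟨π * ∏ i ∈ A, u i, ?_, ?_, ?_⟩
      · refine Subgroup.mul_mem _ ?_ (hUU hprod)
        intro q hq
        simp only [Finset.coe_union, Set.mem_union, Finset.mem_coe, not_or] at hq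
        exact h2 q (by simpa using hq.1) (by rintro rfl; exact hq.2 hwT)
      · intro h
        have h3 := even_of_mem_locNm (hodd w hwT) hev hcw h
        rw [lv_mul, h1, hprod w (by simpa using hTS w hwT)] at h3
        exact absurd h3 (by decide)
      · intro w' hw' hne
        have hw'T := (Finset.mem_filter.1 hw').1
        have h4 := prod_mem_iff (M := fun w => LocSq w) (g := u) huw
          (fun w hw w' hw' hne => huw' w' hw' w hw hne.symm) hAT hw'T
        by_cases hπ : π ∈ LocSq w'
        · refine Subgroup.mul_mem _ hπ (h4.2 ?_)
          simp [hA, hπ]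
        · refine mul_mem_locSq_of_units (hodd w' hw'T) (h2 w' (by simpa using hTS w' hw'T) hne)
            (hprod w' (by simpa using hTS w' hw'T)) hπ ?_
          rw [h4, not_not]
          simp [hA, hπ, hne, hw'T]
    · refine ⟨u w, hUU (huU w hwT), fun h => huw w hwT ?_, fun w' hw' hne =>
        huw' w hwT w' (Finset.mem_filter.1 hw').1 hne⟩
      refine odd_unit_mem_locNm (hodd w hwT) hev h ?_
      rw [huU w hwT w (by simpa using hTS w hwT)]
      exact Even.zero
  choose! g hgU hgw hgw' using hg
  have := two_pow_le_relIndex (T := T') (M := fun w => locNm w (c : F)) (g := g) hgw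
    (fun w hw w' hw' hne => locSq_le_locNm (hgw' w' hw' w hw hne.symm))
    (fun w _ => by
      rintro _ ⟨y, -, rfl⟩
      exact normGrp_le_locNm (Q.nm_mem_normGrp y)) hgU h0
  have h2 : 0 < 2 ^ T'.card := by positivity
  omega

/-- Lower bound for the number of local norm conditions. -/
lemma two_pow_le_index_iInf_locNm {b : Fˣ} (B : Finset (HeightOneSpectrum (𝓞 F)))
    (hB : ∀ p ∈ B, Odd' p ∧ b ∉ LocSq p)
    (h0 : (⨅ p : B, locNm (p : HeightOneSpectrum (𝓞 F)) (b : F)).index ≠ 0) :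
    2 ^ B.card ≤ (⨅ p : B, locNm (p : HeightOneSpectrum (𝓞 F)) (b : F)).index := by
  classical
  have hx : ∀ p ∈ B, ∃ x : Fˣ, x ∉ locNm p (b : F) := by
    intro p hp
    obtain ⟨ho, hn⟩ := hB p hp
    by_cases hev : Even (lv p b)
    · obtain ⟨π, hπ⟩ := exists_uniformizer p
      refine ⟨π, fun h => ?_⟩
      have := even_of_mem_locNm ho hev hn h
      rw [hπ] at this
      exact absurd this (by decide)
    · obtain ⟨u, hu, hun⟩ := exists_unit_notMem_locSq ho
      exact ⟨u, fun h => hun (odd_unit_mem_locNm ho hev h (by rw [hu]; exact Even.zero))⟩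
  choose! x hx using hx
  have hg : ∀ p ∈ B, ∃ g : Fˣ, g ∉ locNm p (b : F) ∧ ∀ q ∈ B, q ≠ p → g ∈ locNm q (b : F) := by
    intro p hp
    obtain ⟨g, hg⟩ := exists_unit_approx B (fun q => if q = p then x p else 1)
    have hdiv : ∀ q ∈ B, g * (if q = p then x p else 1)⁻¹ ∈ LocSq q := by
      intro q hq
      have h := hg q hq
      set w := (if q = p then x p else 1) with hw
      apply mem_locSq_of_sub_one_lt
      have hw0 : (w : F) ≠ 0 := w.ne_zero
      have : ((g * w⁻¹ : Fˣ) : F) - 1 = (g - w) / w := by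
        push_cast; field_simp
      rw [this, map_div₀, div_lt_iff₀ (by rw [zero_lt_iff]; exact val_ne_zero w), ← map_mul]
      exact h
    refine ⟨g, fun h => hx p hp ?_, fun q hq hne => ?_⟩
    · have h1 := locSq_le_locNm (b := (b : F)) (hdiv p hp)
      rw [if_pos rfl, Subgroup.mul_mem_cancel_left _ h] at h1
      exact inv_mem_iff.1 h1
    · have h1 := locSq_le_locNm (b := (b : F)) (hdiv q hq)
      rwa [if_neg hne, inv_one, mul_one] at h1
  choose! g hg hg' using hg
  rw [← Subgroup.relIndex_top_right] at h0 ⊢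
  exact two_pow_le_relIndex (M := fun p => locNm p (b : F)) (g := g) hg
    (fun w hw w' hw' hne => hg' w' hw' w hw hne.symm)
    (fun w hw => iInf_le (fun p : B => locNm (p : HeightOneSpectrum (𝓞 F)) (b : F)) ⟨w, hw⟩)
    (fun _ _ => trivial) h0

/-- A Hasse norm theorem for quadratic extensions: the conditions at the primes above two
and at infinity are simplified. -/
theorem mem_normGrp_of_local {a b : Fˣ} (hpos : RealPos (b : F))
    (h : ∀ p : HeightOneSpectrum (𝓞 F), b ∈ LocSq p ∨ (Odd' p ∧ a ∈ locNm p (b : F))) :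
    a ∈ normGrp (b : F) := by
  classical
  by_cases hb : IsSquare (b : F)
  · obtain ⟨r, hr⟩ := hb
    have hr0 : r ≠ 0 := by
      rintro rfl
      exact b.ne_zero (by simp at hr)
    refine ⟨(a + 1) / 2, (a - 1) / (2 * r), ?_⟩
    rw [hr]
    field_simp
    ring
  obtain ⟨S, hSsub, hS⟩ := exists_classTriv ((finite_not_odd (F := F)).toFinset ∪
    (finite_lv_ne_zero a).toFinset ∪ (finite_lv_ne_zero b).toFinset)
  have hd : ∀ p, ¬ Odd' p → p ∈ S := fun p hp => hSsub (by simp [hp])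
  have haS : a ∈ sUnit (S : Set (HeightOneSpectrum (𝓞 F))) := by
    intro p hp
    by_contra hn
    exact hp (hSsub (by simp [hn]))
  have hbS : b ∈ sUnit (S : Set (HeightOneSpectrum (𝓞 F))) := by
    intro p hp
    by_contra hn
    exact hp (hSsub (by simp [hn]))
  set s := S.card + Fintype.card (InfinitePlace F) with hs
  have hs1 : 1 ≤ s := by
    have : 0 < Fintype.card (InfinitePlace F) := Fintype.card_pos
    omega
  obtain ⟨T, hTc, hT⟩ := Aux.exists_card (b := b) hd (s - 1) (by omega)
  have hTS : Disjoint S T := by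
    rw [Finset.disjoint_right]
    exact fun w hw => (hT w hw).1
  set U := sUnit ((S ∪ T : Finset _) : Set (HeightOneSpectrum (𝓞 F))) with hU
  have hUU : sUnit (S : Set (HeightOneSpectrum (𝓞 F))) ≤ U := sUnit_mono (by simp)
  set B := S.filter (fun p => b ∉ LocSq p) with hB
  set M : Subgroup Fˣ := ⨅ p : B, locNm (p : HeightOneSpectrum (𝓞 F)) (b : F) with hM
  have hMm : ∀ x, x ∈ M ↔ ∀ p ∈ B, x ∈ locNm p (b : F) := by
    intro x; rw [hM, Subgroup.mem_iInf]; simp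
  have hΛM : Lam S ≤ M := by
    intro x hx
    rw [mem_Lam] at hx
    rw [hMm]
    exact fun p hp => locSq_le_locNm (hx.1 p (Finset.mem_filter.1 hp).1)
  obtain ⟨hΛ0, hΛ⟩ := index_Lam_le S
  -- the index of `U Λ`
  have hUΛ : (U ⊔ Lam S).index ≤ 2 := by
    have h1 : (U.map (powMonoidHom 2)).relIndex U = 2 ^ (2 * s - 1) := by
      rw [← sqIndex_eq_relIndex, hU, sqIndex_sUnit, Finset.card_union_of_disjoint hTS, hTc]
      congr 1; omega
    have h2 : Lam S ⊓ U ≤ U.map (powMonoidHom 2) := by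
      intro x hx
      obtain ⟨hx1, hx2⟩ := Subgroup.mem_inf.1 hx
      rw [mem_Lam] at hx1
      exact mem_map_sq hx2 (isSquare_of_aux hd hS hT hx2 hx1.2 hx1.1)
    have h3 := Subgroup.relIndex_dvd_of_le_left U h2
    rw [h1, Subgroup.inf_relIndex_right, ← Subgroup.relIndex_sup_right] at h3
    have h4 := Subgroup.relIndex_mul_index (le_sup_right : Lam S ≤ U ⊔ Lam S)
    have h5 : (Lam S).relIndex (U ⊔ Lam S) ≠ 0 := by
      intro h; rw [h, zero_mul] at h4; exact hΛ0 h4.symm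
    have h6 := Nat.le_of_dvd (Nat.pos_of_ne_zero h5) h3
    by_contra hlt
    have h7 : 2 ^ (2 * s - 1) * 3 ≤ 2 ^ (2 * s) := by
      calc _ ≤ (Lam S).relIndex (U ⊔ Lam S) * (U ⊔ Lam S).index := Nat.mul_le_mul h6 (by omega)
        _ = _ := h4
        _ ≤ _ := hΛ
    rw [show 2 * s = (2 * s - 1) + 1 by omega, pow_succ] at h7
    have : 0 < 2 ^ (2 * s - 1) := by positivity
    simp only [Nat.add_sub_cancel] at h7
    omega
  have hM0 : M.index ≠ 0 := by
    have := Subgroup.index_dvd_of_le hΛM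
    intro h
    rw [h, zero_dvd_iff] at this
    exact hΛ0 this
  have hMB : 2 ^ B.card ≤ M.index := two_pow_le_index_iInf_locNm B (fun p hp => by
    obtain ⟨hpS, hpb⟩ := Finset.mem_filter.1 hp
    exact ⟨((h p).resolve_left hpb).1, hpb⟩) hM0
  have hMU : 2 ^ B.card ≤ M.relIndex U * 2 := by
    have h1 := Subgroup.relIndex_mul_index (le_sup_right : M ≤ U ⊔ M)
    rw [Subgroup.relIndex_sup_right] at h1
    rw [← h1] at hMB
    refine hMB.trans (Nat.mul_le_mul_left _ (le_trans ?_ hUΛ))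
    refine Nat.le_of_dvd (Nat.pos_of_ne_zero ?_) (Subgroup.index_dvd_of_le (sup_le_sup_left hΛM U))
    intro h
    have h4 := Subgroup.relIndex_mul_index (le_sup_right : Lam S ≤ U ⊔ Lam S)
    rw [h, mul_zero] at h4
    exact hΛ0 h4.symm
  obtain ⟨E, _, _, _, _, ⟨Q⟩⟩ := exists_quadExt hb
  obtain ⟨hN0, hN⟩ := Q.relIndex_norm_le hpos (S := S ∪ T)
    (fun p hp => Finset.mem_union_left _ (hd p hp))
    (hS.mono (by simp)) (hUU hbS) B (by
      intro p hp hpB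
      rcases Finset.mem_union.1 hp with h1 | h1
      · by_contra hn
        exact hpB (Finset.mem_filter.2 ⟨h1, hn⟩)
      · exact (hT p h1).2.1)
  set N := (sUnit (QuadExt.above E (S ∪ T) : Set (HeightOneSpectrum (𝓞 E)))).map Q.nm with hNdef
  have hNM : N ≤ M ⊓ U := by
    rintro _ ⟨y, hy, rfl⟩
    refine Subgroup.mem_inf.2 ⟨(hMm _).2 fun p _ => normGrp_le_locNm (Q.nm_mem_normGrp y),
      Q.nm_mem_sUnit hy⟩
  have h1 := Subgroup.relIndex_mul_relIndex _ _ _ hNM (inf_le_right : M ⊓ U ≤ U)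
  rw [Subgroup.inf_relIndex_right] at h1
  have h2 : N.relIndex (M ⊓ U) = 1 := by
    have h3 : N.relIndex (M ⊓ U) ≠ 0 := by
      intro h; rw [h, zero_mul] at h1; exact hN0 h1.symm
    by_contra hne
    have h4 : 2 ≤ N.relIndex (M ⊓ U) := by omega
    have h5 : 2 * M.relIndex U ≤ N.relIndex U := by
      rw [← h1]; exact Nat.mul_le_mul_right _ h4
    have h6 : 0 < 2 ^ B.card := by positivity
    have h7 : 2 * N.relIndex U ≤ 2 ^ B.card := hN
    omega
  rw [Subgroup.relIndex_eq_one] at h2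
  have ha : a ∈ M ⊓ U := by
    refine Subgroup.mem_inf.2 ⟨(hMm _).2 fun p hp => ?_, hUU haS⟩
    exact ((h p).resolve_left (Finset.mem_filter.1 hp).2).2
  obtain ⟨y, -, rfl⟩ := h2 ha
  exact Q.nm_mem_normGrp y

end

section

variable {F : Type} [Field F] [NumberField F] {p : HeightOneSpectrum (𝓞 F)}

open Classical in
variable (p) in
/-- The residue of a `p`-integral element. -/
def rs (x : F) : ResField p :=
  if h : p.valuation F x ≤ 1 then Ideal.Quotient.mk p.asIdeal (exists_residue h).choose else 0

lemma rs_eq {x : F} {a : 𝓞 F} (h : p.valuation F (x - algebraMap (𝓞 F) F a) < 1) :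
    rs p x = Ideal.Quotient.mk p.asIdeal a := by
  have hx : p.valuation F x ≤ 1 := by
    have := (p.valuation F).map_add_le h.le (p.valuation_le_one (K := F) a)
    rwa [sub_add_cancel] at this
  rw [rs, dif_pos hx, Ideal.Quotient.eq, ← p.valuation_lt_one_iff_mem (K := F)]
  have h1 := (exists_residue hx).choose_spec
  have h2 := Valuation.map_sub_lt _ h h1
  change p.valuation F (algebraMap (𝓞 F) F (_ - a)) < 1
  rw [map_sub (algebraMap (𝓞 F) F)]
  refine lt_of_eq_of_lt ?_ h2
  congr 1; ring

lemma rs_spec {x : F} (hx : p.valuation F x ≤ 1) :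
    ∃ a : 𝓞 F, p.valuation F (x - algebraMap (𝓞 F) F a) < 1 ∧
      rs p x = Ideal.Quotient.mk p.asIdeal a := by
  obtain ⟨a, ha⟩ := exists_residue hx
  exact ⟨a, ha, rs_eq ha⟩

lemma rs_algebraMap (a : 𝓞 F) : rs p (algebraMap (𝓞 F) F a) = Ideal.Quotient.mk p.asIdeal a :=
  rs_eq (by simp)

lemma rs_add {x y : F} (hx : p.valuation F x ≤ 1) (hy : p.valuation F y ≤ 1) :
    rs p (x + y) = rs p x + rs p y := by
  obtain ⟨a, ha, ha'⟩ := rs_spec hx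
  obtain ⟨b, hb, hb'⟩ := rs_spec hy
  rw [ha', hb', ← map_add]
  apply rs_eq
  rw [map_add, add_sub_add_comm]
  exact Valuation.map_add_lt _ ha hb

lemma rs_mul {x y : F} (hx : p.valuation F x ≤ 1) (hy : p.valuation F y ≤ 1) :
    rs p (x * y) = rs p x * rs p y := by
  obtain ⟨a, ha, ha'⟩ := rs_spec hx
  obtain ⟨b, hb, hb'⟩ := rs_spec hy
  rw [ha', hb', ← map_mul]
  apply rs_eq
  have : x * y - algebraMap (𝓞 F) F (a * b) =
      x * (y - algebraMap (𝓞 F) F b) + (x - algebraMap (𝓞 F) F a) * algebraMap (𝓞 F) F b := by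
    rw [map_mul]; ring
  rw [this]
  refine Valuation.map_add_lt _ ?_ ?_
  · rw [map_mul]; exact (mul_le_of_le_one_left zero_le hx).trans_lt hb
  · rw [map_mul]; exact (mul_le_of_le_one_right zero_le (p.valuation_le_one b)).trans_lt ha

lemma rs_eq_zero_iff {x : F} (hx : p.valuation F x ≤ 1) : rs p x = 0 ↔ p.valuation F x < 1 := by
  obtain ⟨a, ha, ha'⟩ := rs_spec hx
  rw [ha', mk_eq_zero_iff]
  constructor
  · intro h
    have := Valuation.map_add_lt _ ha h
    rwa [sub_add_cancel] at this
  · intro h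
    have := Valuation.map_sub_lt _ h ha
    rwa [sub_sub_cancel] at this

lemma rs_neg {x : F} (hx : p.valuation F x ≤ 1) : rs p (-x) = - rs p x := by
  rw [← sub_eq_zero, sub_neg_eq_add, ← rs_add (by rwa [Valuation.map_neg]) hx, neg_add_cancel,
    rs_eq_zero_iff (by simp)]
  simp

lemma rs_sub {x y : F} (hx : p.valuation F x ≤ 1) (hy : p.valuation F y ≤ 1) :
    rs p (x - y) = rs p x - rs p y := by
  rw [sub_eq_add_neg, rs_add hx (by rwa [Valuation.map_neg]), rs_neg hy, sub_eq_add_neg]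

lemma rs_surjective (k : ResField p) : ∃ a : 𝓞 F, rs p (algebraMap (𝓞 F) F a) = k := by
  obtain ⟨a, rfl⟩ := Ideal.Quotient.mk_surjective k
  exact ⟨a, rs_algebraMap a⟩

section indices

variable {V : Type*} [AddCommGroup V] {H K : AddSubgroup V} {α : Type*}

lemma relIndex_le_card [Finite α] (f : V → α)
    (h : ∀ x ∈ K, ∀ y ∈ K, f x = f y → x - y ∈ H) :
    H.relIndex K ≠ 0 ∧ H.relIndex K ≤ Nat.card α := by
  have hinj : Function.Injective (fun q : K ⧸ H.addSubgroupOf K => f q.out) := by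
    intro a b hab
    have := h _ a.out.2 _ b.out.2 hab
    rw [← QuotientAddGroup.out_eq' a, ← QuotientAddGroup.out_eq' b, eq_comm, QuotientAddGroup.eq,
      AddSubgroup.mem_addSubgroupOf]
    simpa [neg_add_eq_sub] using this
  have := Finite.of_injective _ hinj
  exact ⟨Nat.card_pos.ne', Nat.card_le_card_of_injective _ hinj⟩

lemma card_le_relIndex (f : α → V) (hf : ∀ a, f a ∈ K) (h : ∀ a b, f a - f b ∈ H → a = b)
    (h0 : H.relIndex K ≠ 0) : Nat.card α ≤ H.relIndex K := by
  have : Finite (K ⧸ H.addSubgroupOf K) := Nat.finite_of_card_ne_zero h0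
  refine Nat.card_le_card_of_injective (fun a =>
    (QuotientAddGroup.mk (⟨f a, hf a⟩ : K) : K ⧸ H.addSubgroupOf K)) ?_
  intro a b hab
  have := QuotientAddGroup.eq.1 hab.symm
  rw [AddSubgroup.mem_addSubgroupOf] at this
  apply h
  simpa [neg_add_eq_sub] using this

end indices

section forms

variable {ι : Type} [Fintype ι]

/-- The diagonal quadratic form with coefficients `c`. -/
def Qf (c : ι → F) (z : ι → F) : F := ∑ i, c i * z i ^ 2

/-- The polar form of `Qf c`. -/
def Bf (c : ι → F) (x y : ι → F) : F := ∑ i, 2 * c i * x i * y i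

omit [NumberField F] in
lemma Qf_add (c x y : ι → F) : Qf c (x + y) = Qf c x + Bf c x y + Qf c y := by
  simp only [Qf, Bf, ← Finset.sum_add_distrib, Pi.add_apply]
  exact Finset.sum_congr rfl fun i _ => by ring

omit [NumberField F] in
lemma Qf_smul (c x : ι → F) (t : F) : Qf c (t • x) = t ^ 2 * Qf c x := by
  simp only [Qf, Finset.mul_sum, Pi.smul_apply, smul_eq_mul]
  exact Finset.sum_congr rfl fun i _ => by ring

omit [NumberField F] in
lemma Bf_smul_right (c x y : ι → F) (t : F) : Bf c x (t • y) = t * Bf c x y := by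
  simp only [Bf, Finset.mul_sum, Pi.smul_apply, smul_eq_mul]
  exact Finset.sum_congr rfl fun i _ => by ring

omit [NumberField F] in
lemma Bf_add_left (c x y z : ι → F) : Bf c (x + y) z = Bf c x z + Bf c y z := by
  simp only [Bf, ← Finset.sum_add_distrib, Pi.add_apply]
  exact Finset.sum_congr rfl fun i _ => by ring

omit [NumberField F] in
lemma Bf_symm (c x y : ι → F) : Bf c x y = Bf c y x := by
  simp only [Bf]
  exact Finset.sum_congr rfl fun i _ => by ring

omit [NumberField F] in
lemma Bf_smul_self (c x : ι → F) (t : F) : Bf c (t • x) x = 2 * t * Qf c x := by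
  simp only [Bf, Qf, Finset.mul_sum, Pi.smul_apply, smul_eq_mul]
  exact Finset.sum_congr rfl fun i _ => by ring

lemma exists_exp_bound (f : ι → F) : ∃ n : ℕ, ∀ i, p.valuation F (f i) ≤ WithZero.exp (n : ℤ) := by
  refine ⟨Finset.univ.sup fun i => (WithZero.log (p.valuation F (f i))).toNat, fun i => ?_⟩
  rcases eq_or_ne (p.valuation F (f i)) 0 with h | h
  · rw [h]; exact zero_le
  · rw [← WithZero.exp_log h, WithZero.exp_le_exp]
    have : (WithZero.log (p.valuation F (f i))).toNat ≤ _ :=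
      Finset.le_sup (f := fun i => (WithZero.log (p.valuation F (f i))).toNat) (Finset.mem_univ i)
    omega

lemma exists_le_of_le_sum {f : ι → F} {γ : WithZero (Multiplicative ℤ)} (hγ : 0 < γ)
    (h : γ ≤ p.valuation F (∑ i, f i)) : ∃ i, γ ≤ p.valuation F (f i) := by
  by_contra! hcon
  exact absurd h (not_le.2 (Valuation.map_sum_lt _ hγ.ne' fun i _ => hcon i))

lemma val_polar_le {c : ι → F} {C : ℤ}
    (hC : ∀ z : ι → F, ∀ i, WithZero.exp C * p.valuation F (z i) ^ 2 ≤ p.valuation F (Qf c z))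
    (x y : ι → F) (hy : p.valuation F (Qf c y) ≤ p.valuation F (Bf c x y)) :
    p.valuation F (Bf c x y) ≤ p.valuation F (Qf c x) := by
  by_contra! hx
  obtain ⟨b, hb⟩ : ∃ b, b = Bf c x y := ⟨_, rfl⟩
  rw [← hb] at hx hy
  have hb0 : b ≠ 0 := by
    intro h; rw [h, map_zero] at hx; exact absurd hx (not_lt.2 zero_le)
  have hvb : 0 < p.valuation F b := by rw [zero_lt_iff]; simpa using hb0
  obtain ⟨t, ht0, hts⟩ : ∃ t : ℕ → F, t 0 = 0 ∧
      ∀ n, t (n + 1) = -(Qf c x + Qf c y * t n ^ 2) / b :=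
    ⟨fun n => Nat.rec 0 (fun _ s => -(Qf c x + Qf c y * s ^ 2) / b) n, rfl, fun _ => rfl⟩
  have ht : ∀ n, p.valuation F (t n) < 1 := by
    intro n
    induction n with
    | zero => rw [ht0, map_zero]; exact zero_lt_one
    | succ n ih =>
      rw [hts, map_div₀, Valuation.map_neg, div_lt_one₀ hvb]
      refine Valuation.map_add_lt _ hx ?_
      rw [map_mul, map_pow]
      calc _ ≤ p.valuation F b * p.valuation F (t n) ^ 2 := by gcongr
        _ < p.valuation F b * 1 := by
          gcongr
          exact pow_lt_one₀ zero_le ih two_ne_zero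
        _ = _ := mul_one _
  have hexp : p.valuation F (Qf c y) / p.valuation F b ≤ 1 := by
    rw [div_le_one₀ hvb]; exact hy
  have hdiff : ∀ n : ℕ, p.valuation F (t (n + 1) - t n) ≤ WithZero.exp (-(n : ℤ)) := by
    intro n
    induction n with
    | zero =>
      simp only [Nat.cast_zero, neg_zero, WithZero.exp_zero]
      exact Valuation.map_sub_le _ (ht _).le (ht _).le
    | succ n ih =>
      have e : t (n + 1 + 1) - t (n + 1) =
          -((Qf c y / b) * (t (n + 1) - t n) * (t (n + 1) + t n)) := by
        have e1 := hts n
        have e2 := hts (n + 1)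
        rw [eq_div_iff hb0] at e1 e2
        have e3 : (Qf c y / b) * b = Qf c y := div_mul_cancel₀ _ hb0
        refine mul_right_cancel₀ hb0 ?_
        linear_combination e2 - e1 + (t (n + 1) - t n) * (t (n + 1) + t n) * e3
      rw [e, Valuation.map_neg, map_mul, map_mul, map_div₀]
      have h1 : p.valuation F (t (n + 1) + t n) ≤ WithZero.exp (-1 : ℤ) :=
        lt_one_iff_le_exp.1 (Valuation.map_add_lt _ (ht _) (ht _))
      calc _ ≤ 1 * WithZero.exp (-(n : ℤ)) * WithZero.exp (-1 : ℤ) := by gcongr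
        _ = _ := by rw [one_mul, ← WithZero.exp_add]; congr 1; push_cast; ring
  have hQ : ∀ n, Qf c (x + t n • y) = - (b * (t (n + 1) - t n)) := by
    intro n
    have e1 := hts n
    rw [eq_div_iff hb0] at e1
    rw [Qf_add, Qf_smul, Bf_smul_right, ← hb]
    linear_combination e1
  obtain ⟨m, hm⟩ := exists_exp_bound (p := p) (fun i => 2 * c i * y i)
  have key : ∀ n : ℕ, p.valuation F b ≤ WithZero.exp ((2 * m : ℤ) - C - n) := by
    intro n
    set w := x + t n • y with hw
    have h1 : p.valuation F (Bf c w y) = p.valuation F b := by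
      rw [hw, Bf_add_left, Bf_smul_self, ← hb]
      apply Valuation.map_add_eq_of_lt_left
      rw [map_mul, map_mul]
      calc _ ≤ 1 * p.valuation F (t n) * p.valuation F b := by
            gcongr
            exact valuation_two_le_one p
        _ < 1 * 1 * p.valuation F b := by
          gcongr
          · exact zero_lt_one
          · exact ht n
        _ = _ := by rw [one_mul, one_mul]
    obtain ⟨i, hi⟩ := exists_le_of_le_sum (f := fun i => 2 * c i * w i * y i) hvb h1.ge
    have h2 : p.valuation F b ≤ WithZero.exp (m : ℤ) * p.valuation F (w i) := by
      refine hi.trans ?_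
      rw [show 2 * c i * w i * y i = (2 * c i * y i) * w i by ring, map_mul]
      gcongr
      exact hm i
    have h3 := hC w i
    rw [hQ, Valuation.map_neg, map_mul] at h3
    have h4 : WithZero.exp C * p.valuation F b ^ 2 ≤
        WithZero.exp ((2 * m : ℤ) - n) * p.valuation F b := by
      calc _ ≤ WithZero.exp C * (WithZero.exp (m : ℤ) * p.valuation F (w i)) ^ 2 := by gcongr
        _ = WithZero.exp (2 * m : ℤ) * (WithZero.exp C * p.valuation F (w i) ^ 2) := by
          rw [mul_pow, ← WithZero.exp_nsmul, nsmul_eq_mul]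
          push_cast
          ac_rfl
        _ ≤ WithZero.exp (2 * m : ℤ) * (p.valuation F b * WithZero.exp (-(n : ℤ))) := by
          exact mul_le_mul_right (h3.trans (mul_le_mul_right (hdiff n) _)) _
        _ = _ := by rw [sub_eq_add_neg, WithZero.exp_add]; ac_rfl
    have h5 : WithZero.exp C * p.valuation F b ≤ WithZero.exp ((2 * m : ℤ) - n) := by
      rw [pow_two, ← mul_assoc] at h4
      exact le_of_mul_le_mul_right h4 hvb
    calc p.valuation F b = WithZero.exp (-C) * (WithZero.exp C * p.valuation F b) := by
          rw [← mul_assoc, ← WithZero.exp_add, neg_add_cancel, WithZero.exp_zero, one_mul]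
      _ ≤ WithZero.exp (-C) * WithZero.exp ((2 * m : ℤ) - n) := by gcongr
      _ = _ := by rw [← WithZero.exp_add]; congr 1; ring
  have h6 := key ((2 * m - C - WithZero.log (p.valuation F b)).toNat + 1)
  rw [← WithZero.exp_log hvb.ne', WithZero.exp_le_exp, WithZero.log_exp] at h6
  omega

/-- If values of the form are uniformly bounded below, they define a nonarchimedean norm. -/
lemma ultrametric {c : ι → F} {C : ℤ}
    (hC : ∀ z : ι → F, ∀ i, WithZero.exp C * p.valuation F (z i) ^ 2 ≤ p.valuation F (Qf c z))
    (x y : ι → F) : p.valuation F (Bf c x y) ≤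
      max (p.valuation F (Qf c x)) (p.valuation F (Qf c y)) := by
  by_contra! hlt
  obtain ⟨hx, hy⟩ := max_lt_iff.1 hlt
  exact absurd (val_polar_le hC x y hy.le) (not_le.2 hx)

end forms

end

section

variable {F : Type} [Field F] [NumberField F] {p : HeightOneSpectrum (𝓞 F)}
  {ι : Type} [Fintype ι]

/-- Values of the form at a vector are bounded below in terms of the coordinates. -/
def Aniso (p : HeightOneSpectrum (𝓞 F)) (c : ι → F) : Prop :=
  ∃ C : ℤ, ∀ z : ι → F, ∀ i, WithZero.exp C * p.valuation F (z i) ^ 2 ≤ p.valuation F (Qf c z)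

lemma Aniso.ultra {c : ι → F} (hc : Aniso p c) (x y : ι → F) : p.valuation F (Bf c x y) ≤
      max (p.valuation F (Qf c x)) (p.valuation F (Qf c y)) := by
  obtain ⟨C, hC⟩ := hc
  exact ultrametric hC x y

lemma Aniso.add_le {c : ι → F} (hc : Aniso p c) (x y : ι → F) :
    p.valuation F (Qf c (x + y)) ≤ max (p.valuation F (Qf c x)) (p.valuation F (Qf c y)) := by
  rw [Qf_add]
  exact Valuation.map_add_le _ (Valuation.map_add_le _ (le_max_left _ _) (hc.ultra x y))
    (le_max_right _ _)

omit [NumberField F] in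
lemma Qf_neg (c x : ι → F) : Qf c (-x) = Qf c x := by
  simp [Qf]

omit [NumberField F] in
lemma Qf_mul_left (c x : ι → F) (t : F) : Qf (fun i => t * c i) x = t * Qf c x := by
  simp only [Qf, Finset.mul_sum]
  exact Finset.sum_congr rfl fun i _ => by ring

omit [NumberField F] in
lemma Qf_zero (c : ι → F) : Qf c 0 = 0 := by
  simp [Qf]

lemma Aniso.mul_left {c : ι → F} (hc : Aniso p c) (t : Fˣ) : Aniso p (fun i => (t : F) * c i) := by
  obtain ⟨C, hC⟩ := hc
  refine ⟨lv p t + C, fun z i => ?_⟩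
  rw [Qf_mul_left, map_mul, WithZero.exp_add, exp_lv, mul_assoc]
  exact mul_le_mul_right (hC z i) _

/-- The lattice of vectors on which the form is integral. -/
def latLe {c : ι → F} (hc : Aniso p c) : AddSubgroup (ι → F) where
  carrier := {z | p.valuation F (Qf c z) ≤ 1}
  add_mem' := fun {x y} hx hy => (hc.add_le x y).trans (max_le hx hy)
  zero_mem' := by simp [Qf_zero]
  neg_mem' := fun {x} hx => by
    change p.valuation F (Qf c (-x)) ≤ 1
    rw [Qf_neg]; exact hx

/-- The lattice of vectors on which the form is topologically nilpotent. -/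
def latLt {c : ι → F} (hc : Aniso p c) : AddSubgroup (ι → F) where
  carrier := {z | p.valuation F (Qf c z) < 1}
  add_mem' := fun {x y} hx hy => (hc.add_le x y).trans_lt (max_lt hx hy)
  zero_mem' := by simp [Qf_zero]
  neg_mem' := fun {x} hx => by
    change p.valuation F (Qf c (-x)) < 1
    rw [Qf_neg]; exact hx

lemma mem_latLe {c : ι → F} (hc : Aniso p c) {z : ι → F} :
    z ∈ latLe hc ↔ p.valuation F (Qf c z) ≤ 1 := Iff.rfl

lemma mem_latLt {c : ι → F} (hc : Aniso p c) {z : ι → F} :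
    z ∈ latLt hc ↔ p.valuation F (Qf c z) < 1 := Iff.rfl

lemma latLt_le {c : ι → F} (hc : Aniso p c) : latLt hc ≤ latLe hc := fun _ hz =>
  (mem_latLe hc).2 ((mem_latLt hc).1 hz).le

omit [NumberField F] in
lemma Bf_sub_right (c x y z : ι → F) : Bf c x (y - z) = Bf c x y - Bf c x z := by
  simp only [Bf, ← Finset.sum_sub_distrib, Pi.sub_apply]
  exact Finset.sum_congr rfl fun i _ => by ring

omit [NumberField F] in
lemma Bf_zero_right (c x : ι → F) : Bf c x 0 = 0 := by
  simp [Bf]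

lemma latLt_relIndex (hp : ¬ Odd' p) {c : ι → F} (hc : Aniso p c) :
    (latLt hc).relIndex (latLe hc) ≠ 0 ∧
      (latLt hc).relIndex (latLe hc) ≤ Nat.card (ResField p) ^ 2 := by
  have hq : 0 < Nat.card (ResField p) := Nat.card_pos
  by_cases hle : latLe hc ≤ latLt hc
  · rw [AddSubgroup.relIndex_eq_one.2 hle]
    exact ⟨one_ne_zero, Nat.one_le_pow _ _ hq⟩
  obtain ⟨x, hx, hx'⟩ := SetLike.not_le_iff_exists.1 hle
  rw [mem_latLe] at hx
  have hx1 : p.valuation F (Qf c x) = 1 := by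
    rw [mem_latLt, not_lt] at hx'; exact le_antisymm hx hx'
  have hBle : ∀ z ∈ latLe hc, p.valuation F (Bf c x z) ≤ 1 := fun z hz =>
    (hc.ultra x z).trans (max_le hx hz)
  let M' : AddSubgroup (ι → F) :=
    { carrier := {z | z ∈ latLe hc ∧ p.valuation F (Bf c x z) < 1}
      add_mem' := fun {y z} hy hz => ⟨add_mem hy.1 hz.1, by
        rw [Bf_symm, Bf_add_left, Bf_symm c y, Bf_symm c z]
        exact Valuation.map_add_lt _ hy.2 hz.2⟩
      zero_mem' := ⟨zero_mem _, by rw [Bf_zero_right, map_zero]; exact zero_lt_one⟩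
      neg_mem' := fun {y} hy => ⟨neg_mem hy.1, by
        rw [← neg_one_smul F y, Bf_smul_right, neg_one_mul, Valuation.map_neg]; exact hy.2⟩ }
  have hM' : M' ≤ latLe hc := fun z hz => hz.1
  have hlt : latLt hc ≤ M' := by
    intro z hz
    refine ⟨latLt_le hc hz, ?_⟩
    by_contra hcon
    have hB1 : p.valuation F (Bf c x z) = 1 :=
      le_antisymm (hBle z (latLt_le hc hz)) (not_lt.1 hcon)
    rw [mem_latLt] at hz
    obtain ⟨C, hC⟩ := hc
    have h := val_polar_le hC z x (by rw [Bf_symm, hB1, hx1])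
    rw [Bf_symm, hB1] at h
    exact absurd hz (not_lt.2 h)
  have h1 := relIndex_le_card (H := M') (K := latLe hc) (fun z => rs p (Bf c x z)) (by
    intro y hy z hz h
    refine ⟨sub_mem hy hz, ?_⟩
    rw [Bf_sub_right, ← rs_eq_zero_iff (Valuation.map_sub_le _ (hBle y hy) (hBle z hz)),
      rs_sub (hBle y hy) (hBle z hz), h, sub_self])
  have hsq : ∀ w ∈ M', ∃ a : 𝓞 F, p.valuation F (Qf c (algebraMap (𝓞 F) F a • x + w)) < 1 := by
    intro w hw
    have hne : rs p (Qf c x) ≠ 0 := by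
      rw [Ne, rs_eq_zero_iff hx, hx1]; exact lt_irrefl _
    have hchar : ringChar (ResField p) = 2 := by
      have h2 : ((2 : ℕ) : ResField p) = 0 := by
        rw [odd'_iff_char, not_not] at hp
        exact_mod_cast hp
      have := ringChar.dvd h2
      exact ((Nat.dvd_prime Nat.prime_two).1 this).resolve_left CharP.ringChar_ne_one
    obtain ⟨k, hk⟩ := FiniteField.isSquare_of_char_two hchar (-rs p (Qf c w) / rs p (Qf c x))
    obtain ⟨a, ha⟩ := rs_surjective k
    refine ⟨a, ?_⟩
    have hal := p.valuation_le_one (K := F) a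
    have hw1 : p.valuation F (Qf c w) ≤ 1 := hw.1
    set α := algebraMap (𝓞 F) F a
    have hα2 : p.valuation F (α * α) ≤ 1 := by rw [map_mul]; exact mul_le_one₀ hal zero_le hal
    have hα3 : p.valuation F (α * α * Qf c x) ≤ 1 := by rw [map_mul, hx1, mul_one]; exact hα2
    have e : Qf c (α • x + w) = (α * α * Qf c x + Qf c w) + α * Bf c x w := by
      rw [Qf_add, Qf_smul, Bf_symm, Bf_smul_right, Bf_symm]; ring
    rw [e]
    refine Valuation.map_add_lt _ ?_ ?_
    · rw [← rs_eq_zero_iff (Valuation.map_add_le _ hα3 hw1), rs_add hα3 hw1, rs_mul hα2 hx,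
        rs_mul hal hal, ha, ← hk, div_mul_cancel₀ _ hne, neg_add_cancel]
    · rw [map_mul]; exact (mul_le_of_le_one_left zero_le hal).trans_lt hw.2
  choose! s hs using hsq
  have h2 := relIndex_le_card (H := latLt hc) (K := M')
    (fun z => (Ideal.Quotient.mk p.asIdeal (s z) : ResField p)) (by
    intro y hy z hz h
    have hm := sub_mem ((mem_latLt hc).2 (hs y hy)) ((mem_latLt hc).2 (hs z hz))
    have hd : (algebraMap (𝓞 F) F (s y) - algebraMap (𝓞 F) F (s z)) • x ∈ latLt hc := by
      rw [mem_latLt, Qf_smul, map_mul, map_pow, hx1, mul_one]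
      refine pow_lt_one₀ zero_le ?_ two_ne_zero
      rw [← map_sub, ← mk_eq_zero_iff, map_sub, sub_eq_zero]; exact h
    have := sub_mem hm hd
    convert this using 1
    rw [sub_smul]; abel)
  rw [← AddSubgroup.relIndex_mul_relIndex _ _ _ hlt hM', pow_two]
  exact ⟨mul_ne_zero h2.1 h1.1, Nat.mul_le_mul h2.2 h1.2⟩

end

section

variable {F : Type} [Field F] [NumberField F] {p : HeightOneSpectrum (𝓞 F)}
  {ι : Type} [Fintype ι]

variable (p ι) in
/-- The box of vectors all of whose coordinates have valuation at most `exp k`. -/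
def box (k : ℤ) : AddSubgroup (ι → F) where
  carrier := {z | ∀ i, p.valuation F (z i) ≤ WithZero.exp k}
  add_mem' := fun hx hy i => Valuation.map_add_le _ (hx i) (hy i)
  zero_mem' := fun i => by simp
  neg_mem' := fun {x} hx i => by
    change p.valuation F (-x i) ≤ _
    rw [Valuation.map_neg]; exact hx i

omit [Fintype ι] in
lemma box_mono {k l : ℤ} (h : k ≤ l) : box p ι k ≤ box (F := F) p ι l := fun _ hz i =>
  (hz i).trans (WithZero.exp_le_exp.2 h)

lemma exp_mul_le_exp_iff {a b : ℤ} {x : WithZero (Multiplicative ℤ)} :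
    WithZero.exp a * x ≤ WithZero.exp b ↔ x ≤ WithZero.exp (b - a) := by
  constructor
  · intro h
    have := mul_le_mul_right h (WithZero.exp (-a))
    rwa [← mul_assoc, ← WithZero.exp_add, ← WithZero.exp_add, neg_add_cancel, WithZero.exp_zero,
      one_mul, neg_add_eq_sub] at this
  · intro h
    have := mul_le_mul_right h (WithZero.exp a)
    rwa [← WithZero.exp_add, add_sub_cancel] at this

lemma exists_val_eq (p : HeightOneSpectrum (𝓞 F)) (k : ℤ) :
    ∃ g : Fˣ, p.valuation F (g : F) = WithZero.exp k := by
  obtain ⟨π, hπ⟩ := exists_uniformizer p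
  refine ⟨π ^ (-k), ?_⟩
  rw [← exp_lv, lv_zpow, hπ]
  congr 1; ring

lemma box_relIndex_ne_zero (k : ℤ) : (box p ι (k - 1)).relIndex (box (F := F) p ι k) ≠ 0 := by
  obtain ⟨g, hg⟩ := exists_val_eq p (-k)
  have hle : ∀ z ∈ box (F := F) p ι k, ∀ i, p.valuation F (g * z i) ≤ 1 := by
    intro z hz i
    rw [map_mul, hg]
    calc _ ≤ WithZero.exp (-k) * WithZero.exp k := by gcongr; exact hz i
      _ = 1 := by rw [← WithZero.exp_add, neg_add_cancel, WithZero.exp_zero]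
  refine (relIndex_le_card (fun z i => rs p (g * z i)) ?_).1
  intro x hx y hy h i
  have h1 : p.valuation F (g * x i - g * y i) < 1 := by
    rw [← rs_eq_zero_iff (Valuation.map_sub_le _ (hle x hx i) (hle y hy i)),
      rs_sub (hle x hx i) (hle y hy i), sub_eq_zero]
    exact congrFun h i
  rw [← mul_sub, map_mul, hg, lt_one_iff_le_exp] at h1
  calc p.valuation F (x i - y i)
      = WithZero.exp k * (WithZero.exp (-k) * p.valuation F (x i - y i)) := by
        rw [← mul_assoc, ← WithZero.exp_add, add_neg_cancel, WithZero.exp_zero, one_mul]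
    _ ≤ WithZero.exp k * WithZero.exp (-1) := by gcongr
    _ = _ := by rw [← WithZero.exp_add]; rfl

lemma box_relIndex_ne_zero' (k : ℤ) (n : ℕ) :
    (box p ι (k - n)).relIndex (box (F := F) p ι k) ≠ 0 := by
  induction n with
  | zero => simp
  | succ n ih =>
    rw [← AddSubgroup.relIndex_mul_relIndex (box p ι (k - (n + 1 : ℕ))) (box p ι (k - n)) _
      (box_mono (by push_cast; omega)) (box_mono (by omega))]
    refine mul_ne_zero ?_ ih
    have := box_relIndex_ne_zero (p := p) (ι := ι) (F := F) (k - n)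
    convert this using 3
    push_cast; ring

lemma card_le_box (k : ℤ) : Nat.card (ResField p) ^ Fintype.card ι ≤
    (box p ι (k - 1)).relIndex (box (F := F) p ι k) := by
  obtain ⟨g, hg⟩ := exists_val_eq p k
  have hsurj : ∀ a : ResField p, ∃ s : 𝓞 F, (Ideal.Quotient.mk p.asIdeal s : ResField p) = a :=
    Ideal.Quotient.mk_surjective
  choose s hs using hsurj
  rw [← Nat.card_eq_fintype_card, ← Nat.card_fun]
  refine card_le_relIndex (fun (a : ι → ResField p) i => g * algebraMap (𝓞 F) F (s (a i)))
    ?_ ?_ (box_relIndex_ne_zero k)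
  · intro a i
    rw [map_mul, hg]
    exact mul_le_of_le_one_right zero_le (p.valuation_le_one _)
  · intro a b h
    funext i
    have h1 := h i
    simp only [Pi.sub_apply] at h1
    rw [← mul_sub, map_mul, hg, ← map_sub, exp_mul_le_exp_iff] at h1
    rw [← hs (a i), ← hs (b i), ← sub_eq_zero, ← map_sub, mk_eq_zero_iff, lt_one_iff_le_exp]
    convert h1 using 2
    ring

lemma not_aniso (hp : ¬ Odd' p) (hι : 5 ≤ Fintype.card ι) (c : ι → F) : ¬ Aniso p c := by
  intro hc
  obtain ⟨π, hπ⟩ := exists_val_eq p (-1)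
  obtain ⟨π', hπ'⟩ := exists_val_eq p 1
  have hc1 := hc.mul_left π'
  have e1 : latLe hc1 = latLt hc := by
    ext z
    rw [mem_latLe, mem_latLt, Qf_mul_left, map_mul, hπ', lt_one_iff_le_exp, ← WithZero.exp_zero,
      exp_mul_le_exp_iff]
    rfl
  have e2 : latLt hc1 = (latLe hc).map (DistribSMul.toAddMonoidHom (ι → F) (π : F)) := by
    ext z
    rw [mem_latLt, Qf_mul_left, map_mul, hπ', AddSubgroup.mem_map, lt_one_iff_le_exp,
      exp_mul_le_exp_iff]
    have hQ : ∀ y, p.valuation F (Qf c ((π : F) • y)) ≤ WithZero.exp (-1 - 1) ↔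
        p.valuation F (Qf c y) ≤ 1 := by
      intro y
      rw [Qf_smul, map_mul, map_pow, hπ, ← WithZero.exp_nsmul, exp_mul_le_exp_iff]
      rfl
    constructor
    · intro h
      have hz : (π : F) • ((π : F)⁻¹ • z) = z := smul_inv_smul₀ π.ne_zero z
      refine ⟨(π : F)⁻¹ • z, ?_, hz⟩
      rw [mem_latLe, ← hQ, hz]; exact h
    · rintro ⟨y, hy, rfl⟩
      exact (hQ y).2 hy
  have hinj : Function.Injective (DistribSMul.toAddMonoidHom (ι → F) (π : F)) := by
    intro x y h
    exact smul_right_injective _ π.ne_zero h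
  have hbox : ∀ k, (box p ι k).map (DistribSMul.toAddMonoidHom (ι → F) (π : F)) =
      box p ι (k - 1) := by
    intro k
    ext z
    rw [AddSubgroup.mem_map]
    have hQ : ∀ y : ι → F, (π : F) • y ∈ box p ι (k - 1) ↔ y ∈ box p ι k := by
      intro y
      refine forall_congr' fun i => ?_
      rw [Pi.smul_apply, smul_eq_mul, map_mul, hπ, exp_mul_le_exp_iff]
      congr! 2; ring
    constructor
    · rintro ⟨y, hy, rfl⟩
      exact (hQ y).2 hy
    · intro h
      have hz : (π : F) • ((π : F)⁻¹ • z) = z := smul_inv_smul₀ π.ne_zero z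
      refine ⟨(π : F)⁻¹ • z, ?_, hz⟩
      rw [← hQ, hz]; exact h
  obtain ⟨k, hk⟩ : ∃ k, latLe hc ≤ box p ι k := by
    obtain ⟨C, hC⟩ := hc
    refine ⟨C.natAbs, fun z hz i => ?_⟩
    have h1 := (hC z i).trans hz
    rw [← WithZero.exp_zero, exp_mul_le_exp_iff] at h1
    rcases eq_or_ne (p.valuation F (z i)) 0 with h | h
    · rw [h]; exact zero_le
    rw [← WithZero.exp_log h] at h1 ⊢
    rw [← WithZero.exp_nsmul, WithZero.exp_le_exp] at h1
    rw [WithZero.exp_le_exp]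
    rw [nsmul_eq_mul] at h1
    push_cast at h1
    omega
  obtain ⟨j, hj⟩ : ∃ j : ℕ, box p ι (k - j) ≤ latLe hc := by
    obtain ⟨m, hm⟩ := exists_exp_bound (p := p) c
    refine ⟨m + k.natAbs, fun z hz => ?_⟩
    rw [mem_latLe]
    refine Valuation.map_sum_le _ fun i _ => ?_
    rw [map_mul, map_pow]
    calc _ ≤ WithZero.exp (m : ℤ) * WithZero.exp (k - (m + k.natAbs : ℕ)) ^ 2 := by
          gcongr
          · exact hm i
          · exact hz i
      _ = WithZero.exp (m + 2 * (k - (m + k.natAbs : ℕ))) := by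
        rw [← WithZero.exp_nsmul, ← WithZero.exp_add, nsmul_eq_mul]
        push_cast; rfl
      _ ≤ WithZero.exp 0 := by
        have := le_abs_self k; rw [WithZero.exp_le_exp]; push_cast; omega
      _ = 1 := WithZero.exp_zero
  have hne : (latLe hc).relIndex (box p ι k) ≠ 0 := by
    intro h
    have := AddSubgroup.relIndex_dvd_of_le_left (box p ι k) hj
    rw [h, zero_dvd_iff] at this
    exact box_relIndex_ne_zero' _ _ this
  obtain ⟨-, b1⟩ := latLt_relIndex hp hc
  obtain ⟨-, b2⟩ := latLt_relIndex hp hc1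
  have hlele := latLt_le hc1
  rw [e1, e2] at b2 hlele
  set f := DistribSMul.toAddMonoidHom (ι → F) (π : F)
  have t1 := AddSubgroup.relIndex_mul_relIndex _ _ _ hlele (latLt_le hc)
  have t2 := AddSubgroup.relIndex_mul_relIndex _ _ _ (hlele.trans (latLt_le hc)) hk
  have hbb : box p ι (k - 1) ≤ box (F := F) p ι k := box_mono (by omega)
  have hmb : (latLe hc).map f ≤ box p ι (k - 1) := by
    rw [← hbox]; exact AddSubgroup.map_mono hk
  have t3 := AddSubgroup.relIndex_mul_relIndex _ _ _ hmb hbb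
  rw [← hbox, AddSubgroup.relIndex_map_map_of_injective _ _ hinj, hbox, ← t2, mul_comm] at t3
  have t4 := Nat.eq_of_mul_eq_mul_right (Nat.pos_of_ne_zero hne) t3
  have hq : 2 ≤ Nat.card (ResField p) := Finite.one_lt_card
  have := card_le_box (p := p) (ι := ι) (F := F) k
  rw [t4, ← t1] at this
  have h5 : Nat.card (ResField p) ^ 5 ≤ Nat.card (ResField p) ^ Fintype.card ι :=
    Nat.pow_le_pow_right (by omega) hι
  have h6 := Nat.mul_le_mul b2 b1
  have h7 : Nat.card (ResField p) ^ 4 < Nat.card (ResField p) ^ 5 :=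
    Nat.pow_lt_pow_right (by omega) (by norm_num)
  have h8 : Nat.card (ResField p) ^ 2 * Nat.card (ResField p) ^ 2 = Nat.card (ResField p) ^ 4 := by
    ring
  omega

/-- A form in at least five variables takes arbitrarily small values at primitive vectors. -/
lemma exists_small (hp : ¬ Odd' p) (hι : 5 ≤ Fintype.card ι) (c : ι → F) (C : ℤ) :
    ∃ z : ι → F, (∀ i, p.valuation F (z i) ≤ 1) ∧ (∃ i, p.valuation F (z i) = 1) ∧
      p.valuation F (Qf c z) < WithZero.exp C := by
  have h := not_aniso hp hι c
  simp only [Aniso, not_exists, not_forall, not_le] at h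
  obtain ⟨z, i, hz⟩ := h C
  have : Nonempty ι := ⟨i⟩
  obtain ⟨j, hj⟩ := Finite.exists_max (fun i => p.valuation F (z i))
  have hz0 : z j ≠ 0 := by
    intro h0
    rw [h0, map_zero] at hj
    rw [le_antisymm (hj i) zero_le] at hz
    simp at hz
  refine ⟨(z j)⁻¹ • z, ?_, ⟨j, ?_⟩, ?_⟩
  · intro i
    rw [Pi.smul_apply, smul_eq_mul, map_mul, map_inv₀, mul_comm, ← div_eq_mul_inv,
      div_le_one₀ (by rw [zero_lt_iff]; simpa using hz0)]
    exact hj i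
  · simp [hz0]
  · have hv : 0 < p.valuation F (z j) ^ 2 := by
      rw [zero_lt_iff]; simpa using hz0
    rw [Qf_smul, map_mul, map_pow, map_inv₀, inv_pow, mul_comm, ← div_eq_mul_inv,
      div_lt_iff₀ hv]
    refine hz.trans_le ?_
    gcongr
    exact hj i

end

section

variable {F : Type} [Field F] [NumberField F] {p : HeightOneSpectrum (𝓞 F)}
  {ι : Type} [Fintype ι]

lemma exists_mem_locSq_of_near {a : Fˣ} {e s : F}
    (h : p.valuation F (e - a * s ^ 2) < p.valuation F (4 * (a * s ^ 2))) :
    ∃ u : Fˣ, (u : F) = a * e ∧ u ∈ LocSq p := by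
  have hs : s ≠ 0 := by
    rintro rfl
    simp at h
  have has : (a : F) * s ^ 2 ≠ 0 := mul_ne_zero a.ne_zero (pow_ne_zero _ hs)
  have he : e ≠ 0 := by
    rintro rfl
    rw [zero_sub, Valuation.map_neg, map_mul _ (4 : F)] at h
    exact absurd (h.trans_le (mul_le_of_le_one_left zero_le (valuation_four_le_one p)))
      (lt_irrefl _)
  refine ⟨a * Units.mk0 e he, rfl, ?_⟩
  rw [mem_locSq]
  refine ⟨1 / (a * s), ?_⟩
  have e1 : ((a * Units.mk0 e he : Fˣ) : F) * (1 / (a * s)) ^ 2 - 1 =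
      (e - a * s ^ 2) / (a * s ^ 2) := by
    rw [Units.val_mul, Units.val_mk0]
    have := a.ne_zero
    field_simp
  rw [e1, map_div₀, div_lt_iff₀ (by rw [zero_lt_iff]; simpa using has), ← map_mul]
  exact h

lemma exists_locSq_dyadic (hp : ¬ Odd' p) (c : Fin 4 → Fˣ) (a : Fˣ) :
    ∃ z : Fin 4 → F, ∃ u : Fˣ, (u : F) = a * Qf (fun i => (c i : F)) z ∧ u ∈ LocSq p := by
  obtain ⟨m, hm⟩ := exists_exp_bound (p := p) (fun i => (a : F) / (16 * c i))
  obtain ⟨g, hg⟩ := exists_val_eq p (-(m + 1 : ℤ))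
  have h2 : (2 : F) ≠ 0 := two_ne_zero
  have hpos : ∀ {x : F}, x ≠ 0 → 0 < p.valuation F x := by
    intro x hx; rw [zero_lt_iff]; simpa using hx
  have hg1 : p.valuation F (g : F) ≤ 1 := by
    rw [hg, ← WithZero.exp_zero, WithZero.exp_le_exp]; omega
  have hgc : ∀ i, p.valuation F (a * g ^ 2 : F) < p.valuation F (16 * c i : F) := by
    intro i
    have h16 : (16 * c i : F) ≠ 0 := mul_ne_zero (by norm_num) (c i).ne_zero
    rw [← div_lt_one₀ (hpos h16), ← map_div₀, mul_div_right_comm, map_mul, map_pow, hg]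
    calc _ ≤ WithZero.exp (m : ℤ) * WithZero.exp (-(m + 1 : ℤ)) ^ 2 := by gcongr; exact hm i
      _ < WithZero.exp 0 := by
        rw [← WithZero.exp_nsmul, ← WithZero.exp_add, WithZero.exp_lt_exp, nsmul_eq_mul]
        push_cast; omega
      _ = 1 := WithZero.exp_zero
  have h16 : p.valuation F (16 * a * g ^ 2 : F) ≠ 0 := by
    simp
  obtain ⟨z, hz1, ⟨j, hj⟩, hz⟩ := exists_small hp (ι := Fin 5) (by simp)
    (Fin.cons (-(a : F)) fun i => (c i : F)) (WithZero.log (p.valuation F (16 * a * g ^ 2 : F)))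
  rw [WithZero.exp_log h16] at hz
  obtain ⟨z', hz'⟩ : ∃ z' : Fin 4 → F, z' = fun i => z i.succ := ⟨_, rfl⟩
  have hQ : Qf (Fin.cons (-(a : F)) fun i => (c i : F)) z =
      Qf (fun i => (c i : F)) z' - a * z 0 ^ 2 := by
    simp only [Qf, Fin.sum_univ_succ (n := 4), Fin.cons_zero, Fin.cons_succ, hz']
    ring
  rw [hQ] at hz
  set q := Qf (fun i => (c i : F)) z' with hq
  by_cases hcase : p.valuation F (q - a * z 0 ^ 2) < p.valuation F (4 * (a * z 0 ^ 2))
  · obtain ⟨u, hu⟩ := exists_mem_locSq_of_near hcase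
    exact ⟨z', u, hu⟩
  rw [not_lt] at hcase
  have hz0 : p.valuation F (a * z 0 ^ 2) < p.valuation F (4 * (a * g ^ 2)) := by
    have h := hcase.trans_lt hz
    rw [show (16 * a * g ^ 2 : F) = 4 * (4 * (a * g ^ 2)) by ring, map_mul, map_mul _ 4 (_ : F)] at h
    exact lt_of_mul_lt_mul_left h zero_le
  have hz0' : p.valuation F (z 0) < 1 := by
    have h := hz0.trans_le (b := p.valuation F (4 * (a * g ^ 2))) (c := p.valuation F (a : F)) (by
      rw [map_mul, map_mul, map_pow]
      exact (mul_le_of_le_one_left zero_le (valuation_four_le_one p)).trans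
        (mul_le_of_le_one_right zero_le (pow_le_one₀ zero_le hg1)))
    by_contra hcon
    rw [map_mul, map_pow, le_antisymm (hz1 0) (not_lt.1 hcon)] at h
    simp at h
  obtain ⟨i, rfl⟩ : ∃ i : Fin 4, j = i.succ := by
    refine ⟨j.pred ?_, (Fin.succ_pred _ _).symm⟩
    rintro rfl
    exact absurd hj hz0'.ne
  have hzi : z' i ≠ 0 := by
    intro h
    rw [hz'] at h
    simp only at h
    rw [h, map_zero] at hj
    exact zero_ne_one hj
  have hzi' : p.valuation F (z' i) = 1 := by rw [hz']; exact hj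
  obtain ⟨t, ht⟩ : ∃ t : F, t = a * g ^ 2 / (2 * c i * z' i) := ⟨_, rfl⟩
  have hci := (c i).ne_zero
  have e1 : Qf (fun i => (c i : F)) (z' + t • Pi.single i 1) - a * g ^ 2 = q + c i * t ^ 2 := by
    rw [Qf_add, Qf_smul, Bf_smul_right, ← hq]
    have e2 : Qf (fun i => (c i : F)) (Pi.single i 1) = c i := by
      simp [Qf, Pi.single_apply]
    have e3 : Bf (fun i => (c i : F)) z' (Pi.single i 1) = 2 * c i * z' i := by
      simp [Bf, Pi.single_apply]
    rw [e2, e3, ht]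
    field_simp
    ring
  have h1 : p.valuation F q < p.valuation F (4 * (a * g ^ 2) : F) := by
    have h3 : p.valuation F (q - a * z 0 ^ 2) < p.valuation F (4 * (a * g ^ 2) : F) := by
      refine hz.trans_le ?_
      rw [show (16 * a * g ^ 2 : F) = 4 * (4 * (a * g ^ 2)) by ring, map_mul]
      exact mul_le_of_le_one_left zero_le (valuation_four_le_one p)
    have := Valuation.map_add_lt _ h3 hz0
    rwa [sub_add_cancel] at this
  have h4 : p.valuation F (c i * t ^ 2) < p.valuation F (4 * (a * g ^ 2) : F) := by
    have e4 : c i * t ^ 2 = (a * g ^ 2) * (a * g ^ 2) / (4 * c i) * (1 / (z' i) ^ 2) := by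
      rw [ht]; field_simp; norm_num
    have hag : (a * g ^ 2 : F) ≠ 0 := mul_ne_zero a.ne_zero (pow_ne_zero _ g.ne_zero)
    rw [e4, map_mul, map_div₀ _ (1 : F), map_one, map_pow, hzi', one_pow, div_one, mul_one,
      map_div₀, div_lt_iff₀ (hpos (mul_ne_zero (by norm_num : (4 : F) ≠ 0) hci)), ← map_mul,
      show (4 * (a * g ^ 2) * (4 * c i) : F) = (16 * c i) * (a * g ^ 2) by ring, map_mul,
      map_mul _ (16 * c i : F)]
    exact mul_lt_mul_of_pos_right (hgc i) (hpos hag)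
  obtain ⟨u, hu⟩ := exists_mem_locSq_of_near (p := p) (a := a)
    (e := Qf (fun i => (c i : F)) (z' + t • Pi.single i 1)) (s := (g : F))
    (by rw [e1]; exact Valuation.map_add_lt _ h1 h4)
  exact ⟨_, u, hu⟩

lemma Qf_continuous (c z : ι → F) (D : ℤ) : ∃ n : ℕ, ∀ y : ι → F,
    (∀ i, p.valuation F (y i - z i) ≤ WithZero.exp (-(n : ℤ))) →
      p.valuation F (Qf c y - Qf c z) < WithZero.exp D := by
  obtain ⟨m, hm⟩ := exists_exp_bound (p := p) z
  obtain ⟨l, hl⟩ := exists_exp_bound (p := p) c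
  refine ⟨m + l + D.natAbs + 1, fun y hy => ?_⟩
  rw [Qf, Qf, ← Finset.sum_sub_distrib]
  refine Valuation.map_sum_lt _ WithZero.exp_ne_zero fun i _ => ?_
  have e : c i * y i ^ 2 - c i * z i ^ 2 = c i * ((y i - z i) * (y i - z i + 2 * z i)) := by ring
  have h1 : p.valuation F (y i - z i + 2 * z i) ≤ WithZero.exp (m : ℤ) := by
    refine Valuation.map_add_le _ ((hy i).trans (WithZero.exp_le_exp.2 (by omega))) ?_
    rw [map_mul]
    exact (mul_le_of_le_one_left zero_le (valuation_two_le_one p)).trans (hm i)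
  rw [e, map_mul, map_mul]
  calc _ ≤ WithZero.exp (l : ℤ) * (WithZero.exp (-((m + l + D.natAbs + 1 : ℕ) : ℤ)) *
        WithZero.exp (m : ℤ)) := by
        gcongr
        · exact hl i
        · exact hy i
    _ < WithZero.exp D := by
      rw [← WithZero.exp_add, ← WithZero.exp_add, WithZero.exp_lt_exp]
      push_cast
      have := neg_abs_le D
      omega

/-- A quaternary form times a given scalar is simultaneously a square at all dyadic primes. -/
lemma exists_locSq_all_dyadic (c : Fin 4 → Fˣ) (a : Fˣ) :
    ∃ z : Fin 4 → F, ∃ u : Fˣ, (u : F) = a * Qf (fun i => (c i : F)) z ∧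
      ∀ p : HeightOneSpectrum (𝓞 F), ¬ Odd' p → u ∈ LocSq p := by
  obtain ⟨S, hS⟩ := (finite_not_odd (F := F)).exists_finset
  choose! z u hu hmem using fun (p : HeightOneSpectrum (𝓞 F)) (hp : ¬ Odd' p) =>
    exists_locSq_dyadic hp c a
  choose n hn using fun p : HeightOneSpectrum (𝓞 F) =>
    Qf_continuous (p := p) (fun i => (c i : F)) (z p)
      (WithZero.log (p.valuation F (4 * ((u p : F) / a))))
  choose y hy using fun i => exists_approx S (fun p => z p i) (S.sup n)
  have key : ∀ p : HeightOneSpectrum (𝓞 F), ¬ Odd' p →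
      p.valuation F (a * Qf (fun i => (c i : F)) y - u p) < p.valuation F (4 * (u p : F)) := by
    intro p hp
    have hpS : p ∈ S := (hS p).2 hp
    have h1 := hn p y fun i => (hy i p hpS).trans (WithZero.exp_le_exp.2 (by
      have := Finset.le_sup (f := n) hpS
      omega))
    rw [WithZero.exp_log (by simp)] at h1
    rw [hu p hp, ← mul_sub, map_mul]
    calc _ < p.valuation F (a : F) * p.valuation F (4 * ((u p : F) / a)) :=
          mul_lt_mul_of_pos_left h1 (by rw [zero_lt_iff]; simp)
      _ = _ := by
        rw [← map_mul, ← hu p hp]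
        congr 1
        have := a.ne_zero
        field_simp
  by_cases hne : (a : F) * Qf (fun i => (c i : F)) y = 0
  · have hno : ∀ p : HeightOneSpectrum (𝓞 F), Odd' p := by
      intro p
      by_contra hp
      have := key p hp
      rw [hne, zero_sub, Valuation.map_neg, map_mul _ (4 : F)] at this
      exact absurd (this.trans_le (mul_le_of_le_one_left zero_le (valuation_four_le_one p)))
        (lt_irrefl _)
    refine ⟨Pi.single 0 1, a * c 0, ?_, fun p hp => absurd (hno p) hp⟩
    simp [Qf, Pi.single_apply]
  · refine ⟨y, Units.mk0 _ hne, rfl, fun p hp => ?_⟩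
    rw [locSq_congr (w := u p)]
    · exact hmem p hp
    · exact key p hp

end

section

variable {F : Type} [Field F] [NumberField F] {p : HeightOneSpectrum (𝓞 F)}

open Polynomial in
lemma exists_residue_norm (hp : Odd' p) {a b : ResField p} (hb : b ≠ 0) :
    ∃ x y : ResField p, x ^ 2 - b * y ^ 2 = a := by
  have := Fintype.ofFinite (ResField p)
  obtain ⟨x, y, h⟩ := FiniteField.exists_root_sum_quadratic (R := ResField p)
    (f := X ^ 2 - C a) (g := C (-b) * X ^ 2) (degree_X_pow_sub_C (by norm_num) a)
    (by rw [degree_C_mul_X_pow 2 (neg_ne_zero.2 hb)]; rfl)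
    (FiniteField.odd_card_of_char_ne_two (ringChar_ne_two hp))
  refine ⟨x, y, ?_⟩
  simp only [eval_sub, eval_pow, eval_X, eval_C, eval_mul] at h
  linear_combination h

lemma mem_locNm_of_units (hp : Odd' p) {a b : Fˣ} (ha : lv p a = 0) (hb : lv p b = 0) :
    a ∈ locNm p (b : F) := by
  have ha1 := lv_eq_zero_iff.1 ha
  have hb1 := lv_eq_zero_iff.1 hb
  have hb0 : rs p (b : F) ≠ 0 := by
    rw [Ne, rs_eq_zero_iff hb1.le, hb1]; exact lt_irrefl _
  obtain ⟨k, l, hkl⟩ := exists_residue_norm hp (a := rs p (a : F)) hb0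
  obtain ⟨x, rfl⟩ := rs_surjective k
  obtain ⟨y, rfl⟩ := rs_surjective l
  set x' := algebraMap (𝓞 F) F x
  set y' := algebraMap (𝓞 F) F y
  have hx : p.valuation F x' ≤ 1 := p.valuation_le_one x
  have hy : p.valuation F y' ≤ 1 := p.valuation_le_one y
  have hxx : p.valuation F (x' * x') ≤ 1 := by rw [map_mul]; exact mul_le_one₀ hx zero_le hx
  have hyy : p.valuation F (y' * y') ≤ 1 := by rw [map_mul]; exact mul_le_one₀ hy zero_le hy
  have hby : p.valuation F (b * (y' * y')) ≤ 1 := by rw [map_mul, hb1, one_mul]; exact hyy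
  have hd : p.valuation F (x' * x' - b * (y' * y')) ≤ 1 := Valuation.map_sub_le _ hxx hby
  have hnear : p.valuation F ((x' * x' - b * (y' * y')) - a) < 1 := by
    rw [← rs_eq_zero_iff (Valuation.map_sub_le _ hd ha1.le), rs_sub hd ha1.le,
      rs_sub hxx hby, rs_mul hx hx, rs_mul hb1.le hyy, rs_mul hy hy, ← hkl]
    ring
  have hn0 : x' * x' - b * (y' * y') ≠ 0 := by
    intro h
    rw [h, zero_sub, Valuation.map_neg, ha1] at hnear
    exact lt_irrefl _ hnear
  have hmem : a * (Units.mk0 _ hn0)⁻¹ ∈ LocSq p := by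
    have h1 : Units.mk0 _ hn0 * a⁻¹ ∈ LocSq p := by
      apply mem_locSq_of_sub_one_lt
      have e : ((Units.mk0 _ hn0 * a⁻¹ : Fˣ) : F) - 1 = (x' * x' - b * (y' * y') - a) / a := by
        rw [Units.val_mul, Units.val_mk0, Units.val_inv_eq_inv_val]
        have := a.ne_zero
        field_simp
      rw [e, map_div₀, ha1, div_one, valuation_four_of_odd hp]
      exact hnear
    have := (LocSq p).inv_mem h1
    rwa [mul_inv_rev, inv_inv] at this
  have h2 : Units.mk0 _ hn0 ∈ normGrp (b : F) :=
    ⟨x', y', by rw [Units.val_mk0]; ring⟩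
  have := mul_mem (locSq_le_locNm hmem) (normGrp_le_locNm (p := p) h2)
  rwa [inv_mul_cancel_right] at this

lemma normGrp_mul_sq (b w : Fˣ) : normGrp ((b * w ^ 2 : Fˣ) : F) = normGrp (b : F) := by
  ext u
  rw [mem_normGrp, mem_normGrp]
  have := w.ne_zero
  constructor
  · rintro ⟨x, y, h⟩
    exact ⟨x, w * y, by rw [h]; push_cast; ring⟩
  · rintro ⟨x, y, h⟩
    exact ⟨x, (w : F)⁻¹ * y, by rw [h]; push_cast; field_simp⟩

lemma mem_locNm_of_even (hp : Odd' p) {a b : Fˣ} (ha : Even (lv p a)) (hb : Even (lv p b)) :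
    a ∈ locNm p (b : F) := by
  obtain ⟨s, hs⟩ := exists_unit_of_even ha
  obtain ⟨w, hw⟩ := exists_unit_of_even hb
  have h := mem_locNm_of_units hp hs hw
  rw [locNm, normGrp_mul_sq, ← locNm] at h
  exact ((locNm p (b : F)).mul_mem_cancel_right (locSq_le_locNm (sq_mem_locSq s))).1 h

omit [NumberField F] in
lemma neg_mem_normGrp (b : Fˣ) : -b ∈ normGrp (b : F) := ⟨0, 1, by push_cast; ring⟩

section lift

variable {E : Type} [Field E] [NumberField E] [Algebra F E]

lemma ui_mem_locSq {P : HeightOneSpectrum (𝓞 E)} {w : Fˣ}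
    (h : w ∈ LocSq (QuadExt.below (F := F) P)) : QuadExt.ui F E w ∈ LocSq P := by
  obtain ⟨x, hx⟩ := h
  refine ⟨algebraMap F E x, ?_⟩
  rw [← QuadExt.valuation_lt_iff (E := E)] at hx
  simp only [map_sub, map_mul, map_pow, map_one, map_ofNat] at hx
  exact hx

lemma odd'_below_iff {P : HeightOneSpectrum (𝓞 E)} :
    Odd' (QuadExt.below (F := F) P) ↔ Odd' P := by
  have := QuadExt.valuation_eq_one_iff (F := F) (P := P) (x := 2)
  rw [map_ofNat] at this
  exact this.symm

lemma lv_ui (P : HeightOneSpectrum (𝓞 E)) : ∃ e : ℕ, e ≠ 0 ∧ ∀ u : Fˣ,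
    lv P (QuadExt.ui F E u) = e * lv (QuadExt.below (F := F) P) u := by
  obtain ⟨e, he, h⟩ := QuadExt.valuation_below F P
  refine ⟨e, he, fun u => ?_⟩
  have h1 := h u
  change P.valuation E ((QuadExt.ui F E u : Eˣ) : E) = _ at h1
  rw [lv, h1, ← exp_lv, ← WithZero.exp_nsmul, WithZero.log_exp, nsmul_eq_mul]

/-- The local condition in the norm theorem, over a quadratic extension `F(√d)` with `d` chosen
nonsquare at the bad primes. -/
lemma lift_condition {d : Fˣ} (Q : QuadExt (d : F) E) (P : HeightOneSpectrum (𝓞 E))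
    (hP : Odd' P) {f b : Fˣ}
    (h : (lv (QuadExt.below (F := F) P) f = 0 ∧ lv (QuadExt.below (F := F) P) b = 0) ∨
      d ∉ LocSq (QuadExt.below (F := F) P)) :
    QuadExt.ui F E b ∈ LocSq P ∨
      QuadExt.ui F E f ∈ locNm P ((QuadExt.ui F E b : Eˣ) : E) := by
  have hp : Odd' (QuadExt.below (F := F) P) := odd'_below_iff.2 hP
  obtain ⟨e, -, he⟩ := lv_ui (F := F) P
  have hr0 : Q.r ≠ 0 := by
    intro h
    have := Q.r_sq
    rw [h, zero_pow two_ne_zero] at this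
    exact d.ne_zero ((map_eq_zero _).1 this.symm)
  have hrd : QuadExt.ui F E d = Units.mk0 Q.r hr0 ^ 2 := by
    ext
    push_cast
    rw [Units.val_mk0, Q.r_sq]
    rfl
  rcases h with ⟨h1, h2⟩ | hd
  · right
    exact mem_locNm_of_even hP (by rw [he, h1, mul_zero]; exact Even.zero)
      (by rw [he, h2, mul_zero]; exact Even.zero)
  by_cases hev : Even (lv (QuadExt.below (F := F) P) d)
  · have key : ∀ u : Fˣ, Even (lv (QuadExt.below (F := F) P) u) → QuadExt.ui F E u ∈ LocSq P := by
      intro u hu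
      by_cases hus : u ∈ LocSq (QuadExt.below (F := F) P)
      · exact ui_mem_locSq hus
      obtain ⟨s, hs⟩ := exists_unit_of_even hu
      obtain ⟨w, hw⟩ := exists_unit_of_even hev
      have h3 := mul_mem_locSq_of_units hp hs hw (by rwa [mul_sq_mem_locSq_iff])
        (by rwa [mul_sq_mem_locSq_iff])
      rw [← mul_assoc, mul_sq_mem_locSq_iff, mul_right_comm, mul_sq_mem_locSq_iff] at h3
      have h4 := ui_mem_locSq h3
      rwa [map_mul, hrd, mul_sq_mem_locSq_iff] at h4
    by_cases hb : Even (lv (QuadExt.below (F := F) P) b)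
    · exact Or.inl (key b hb)
    right
    by_cases hf : Even (lv (QuadExt.below (F := F) P) f)
    · exact locSq_le_locNm (key f hf)
    have h5 : Even (lv (QuadExt.below (F := F) P) (f * -b)) := by
      have hneg : lv (QuadExt.below (F := F) P) (-b) = lv (QuadExt.below (F := F) P) b := by
        rw [lv, lv, Units.val_neg, Valuation.map_neg]
      rw [lv_mul, hneg]
      exact (Int.not_even_iff_odd.1 hf).add_odd (Int.not_even_iff_odd.1 hb)
    have h6 := locSq_le_locNm (b := ((QuadExt.ui F E b : Eˣ) : E)) (key _ h5)
    rw [map_mul] at h6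
    refine ((locNm P _).mul_mem_cancel_right (normGrp_le_locNm ?_)).1 h6
    have h7 : QuadExt.ui F E (-b) = - QuadExt.ui F E b := by
      ext; simp
    rw [h7]
    exact neg_mem_normGrp _
  · right
    have hee : Even e := by
      have h8 := he d
      rw [hrd, lv_pow] at h8
      have h9 : Even ((e : ℤ) * lv (QuadExt.below (F := F) P) d) := by
        rw [← h8]; simp
      rw [Int.even_mul] at h9
      exact_mod_cast h9.resolve_right hev
    have hee' : Even (e : ℤ) := by exact_mod_cast hee
    exact mem_locNm_of_even hP (by rw [he]; exact hee'.mul_right _)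
      (by rw [he]; exact hee'.mul_right _)

end lift

end

section

variable {F : Type} [Field F] [NumberField F] {p : HeightOneSpectrum (𝓞 F)}

lemma exists_form_near {ι : Type} [Fintype ι] (S : Finset (HeightOneSpectrum (𝓞 F))) (c : ι → F)
    (z : HeightOneSpectrum (𝓞 F) → ι → F) (hz : ∀ p ∈ S, Qf c (z p) ≠ 0) :
    ∃ y : ι → F, ∀ p ∈ S,
      p.valuation F (Qf c y - Qf c (z p)) < p.valuation F (4 * Qf c (z p)) := by
  choose n hn using fun p : HeightOneSpectrum (𝓞 F) =>
    Qf_continuous (p := p) c (z p) (WithZero.log (p.valuation F (4 * Qf c (z p))))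
  choose y hy using fun i => exists_approx S (fun p => z p i) (S.sup n)
  refine ⟨y, fun p hp => ?_⟩
  have h1 := hn p y fun i => (hy i p hp).trans (WithZero.exp_le_exp.2 (by
      have := Finset.le_sup (f := n) hp
      omega))
  rwa [WithZero.exp_log (by simpa using hz p hp)] at h1

lemma exists_binary_local (hp : Odd' p) (x y g : Fˣ) : ∃ z : Fin 2 → F, ∃ t : Fˣ,
    (t : F) = Qf ![(x : F), y] z ∧ g * t ∉ LocSq p := by
  by_cases hx : g * x ∈ LocSq p
  · by_cases hy : g * y ∈ LocSq p
    · obtain ⟨z, u, hu, hu0, hun⟩ := exists_one_add_sq hp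
      have hxy : y * x⁻¹ ∈ LocSq p := by
        have := (LocSq p).mul_mem hy ((LocSq p).inv_mem hx)
        have e : g * y * (g * x)⁻¹ = y * x⁻¹ := by
          rw [mul_inv_rev]
          rw [mul_assoc, mul_comm, mul_assoc, mul_assoc, inv_mul_cancel, mul_one, mul_comm]
        rwa [e] at this
      obtain ⟨r, hr⟩ := hxy
      rw [valuation_four_of_odd hp] at hr
      set ζ := algebraMap (𝓞 F) F z
      have hζ : p.valuation F ζ ≤ 1 := p.valuation_le_one z
      have hu1 : p.valuation F (u : F) = 1 := lv_eq_zero_iff.1 hu0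
      have hx0 := x.ne_zero
      have e1 : (x : F) * 1 ^ 2 + y * (r * ζ) ^ 2 - x * u =
          x * (ζ ^ 2 * (((y * x⁻¹ : Fˣ) : F) * r ^ 2 - 1)) := by
        rw [hu, Units.val_mul, Units.val_inv_eq_inv_val]; field_simp; ring
      have hnear : p.valuation F (x * 1 ^ 2 + y * (r * ζ) ^ 2 - x * u) <
          p.valuation F (4 * (x * u : F)) := by
        rw [e1, map_mul, map_mul, map_mul _ (4 : F), valuation_four_of_odd hp, one_mul, map_mul,
          hu1]
        refine mul_lt_mul_of_pos_left ?_ (by rw [zero_lt_iff]; simp)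
        rw [map_pow]
        exact (mul_le_of_le_one_left zero_le (pow_le_one₀ zero_le hζ)).trans_lt hr
      have hne : (x : F) * 1 ^ 2 + y * (r * ζ) ^ 2 ≠ 0 := by
        intro h
        rw [h, zero_sub, Valuation.map_neg, map_mul _ (4 : F), valuation_four_of_odd hp,
          one_mul] at hnear
        exact lt_irrefl _ hnear
      refine ⟨![1, r * ζ], Units.mk0 _ hne, by simp [Qf], fun hmem => hun ?_⟩
      have h2 : Units.mk0 _ hne ∈ LocSq p ↔ x * u ∈ LocSq p := locSq_congr hnear
      have h3 : Units.mk0 _ hne * (x * u) ∈ LocSq p := by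
        have h4 : Units.mk0 _ hne * (x * u) ∈ LocSq p ↔ (x * u) * (x * u) ∈ LocSq p := by
          apply locSq_congr
          have e2 : ((Units.mk0 _ hne * (x * u) : Fˣ) : F) - ((x * u * (x * u) : Fˣ) : F) =
            (x * 1 ^ 2 + y * (r * ζ) ^ 2 - x * u) * (x * u) := by
            push_cast [Units.val_mk0]; ring
          rw [e2, show (4 * ((x * u * (x * u) : Fˣ) : F)) = (4 * (x * u)) * (x * u) by
            push_cast; ring, map_mul, map_mul _ (4 * (x * u : F))]
          exact mul_lt_mul_of_pos_right hnear (by rw [zero_lt_iff]; simp)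
        rw [h4]; exact mul_self_mem_locSq _
      have h5 := (LocSq p).mul_mem ((LocSq p).mul_mem hmem h3) hx
      have e3 : g * Units.mk0 _ hne * (Units.mk0 _ hne * (x * u)) * (g * x) =
          u * (g * Units.mk0 _ hne * x) ^ 2 := by
        generalize Units.mk0 _ hne = U
        rw [pow_two]; ac_rfl
      rwa [e3, mul_sq_mem_locSq_iff] at h5
    · exact ⟨![0, 1], y, by simp [Qf], hy⟩
  · exact ⟨![1, 0], x, by simp [Qf], hx⟩

lemma exists_binary (S : Finset (HeightOneSpectrum (𝓞 F))) (hS : ∀ p ∈ S, Odd' p) (x y g : Fˣ) :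
    ∃ z : Fin 2 → F, ∃ t : Fˣ, (t : F) = Qf ![(x : F), y] z ∧ ∀ p ∈ S, g * t ∉ LocSq p := by
  rcases S.eq_empty_or_nonempty with rfl | ⟨p0, hp0⟩
  · exact ⟨![1, 0], x, by simp [Qf], by simp⟩
  choose! z t ht hmem using fun (p : HeightOneSpectrum (𝓞 F)) (hp : p ∈ S) =>
    exists_binary_local (hS p hp) x y g
  obtain ⟨w, hw⟩ := exists_form_near S ![(x : F), y] z fun p hp => by
    rw [← ht p hp]; exact (t p).ne_zero
  have hne : Qf ![(x : F), y] w ≠ 0 := by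
    intro h
    have := hw p0 hp0
    rw [h, zero_sub, Valuation.map_neg, map_mul, valuation_four_of_odd (hS p0 hp0), one_mul] at this
    exact lt_irrefl _ this
  refine ⟨w, Units.mk0 _ hne, rfl, fun p hp => ?_⟩
  rw [locSq_congr (w := g * t p)]
  · exact hmem p hp
  · have h := hw p hp
    rw [← ht p hp] at h
    rw [Units.val_mul, Units.val_mul, Units.val_mk0, ← mul_sub, map_mul,
      show (4 * (g * t p) : F) = g * (4 * t p) by ring, map_mul]
    exact mul_lt_mul_of_pos_left h (by rw [zero_lt_iff]; simp)

/-- An isotropic vector of a ternary form over `F(√(a₁a₂a₃a₄))` gives one of `⟨a₁, a₂, a₃, a₄⟩`. -/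
lemma isotropic_descent {K E : Type} [Field K] [CharZero K] [Field E] [Algebra K E]
    {d a₁ a₂ a₃ a₄ : K}
    (h₁ : a₁ ≠ 0) (h₂ : a₂ ≠ 0) (h₃ : a₃ ≠ 0)
    (hd : d = a₁ * a₂ * a₃ * a₄) (Q : QuadExt d E) {x y z : E} (hne : ¬ (x = 0 ∧ y = 0 ∧ z = 0))
    (h : algebraMap K E a₁ * x ^ 2 + algebraMap K E a₂ * y ^ 2 + algebraMap K E a₃ * z ^ 2 = 0) :
    ∃ n₁ n₂ n₃ n₄ : K, ¬ (n₁ = 0 ∧ n₂ = 0 ∧ n₃ = 0 ∧ n₄ = 0) ∧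
      a₁ * n₁ ^ 2 + a₂ * n₂ ^ 2 + a₃ * n₃ ^ 2 + a₄ * n₄ ^ 2 = 0 := by
  obtain ⟨u₁, w₁, rfl⟩ := Q.rep x
  obtain ⟨u₂, w₂, rfl⟩ := Q.rep y
  obtain ⟨u₃, w₃, rfl⟩ := Q.rep z
  have hr := Q.r_sq
  obtain ⟨e1, e2⟩ := Q.eq_zero
    (u := a₁ * u₁ ^ 2 + a₂ * u₂ ^ 2 + a₃ * u₃ ^ 2 +
      d * (a₁ * w₁ ^ 2 + a₂ * w₂ ^ 2 + a₃ * w₃ ^ 2))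
    (w := 2 * (a₁ * u₁ * w₁ + a₂ * u₂ * w₂ + a₃ * u₃ * w₃)) (by
      simp only [map_add, map_mul, map_pow, map_ofNat]
      linear_combination h - (algebraMap K E a₁ * algebraMap K E w₁ ^ 2 +
        algebraMap K E a₂ * algebraMap K E w₂ ^ 2 + algebraMap K E a₃ * algebraMap K E w₃ ^ 2) * hr)
  have e2' := (mul_eq_zero.1 e2).resolve_left two_ne_zero
  by_cases hw : a₁ * w₁ ^ 2 + a₂ * w₂ ^ 2 + a₃ * w₃ ^ 2 = 0
  · rw [hw, mul_zero, add_zero] at e1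
    by_cases hw0 : w₁ = 0 ∧ w₂ = 0 ∧ w₃ = 0
    · refine ⟨u₁, u₂, u₃, 0, fun h0 => hne ?_, by linear_combination e1⟩
      obtain ⟨rfl, rfl, rfl⟩ := hw0
      obtain ⟨rfl, rfl, rfl, -⟩ := h0
      simp
    · exact ⟨w₁, w₂, w₃, 0, fun h0 => hw0 ⟨h0.1, h0.2.1, h0.2.2.1⟩, by linear_combination hw⟩
  · refine ⟨(u₂ * w₃ - u₃ * w₂) * (a₂ * a₃), (u₃ * w₁ - u₁ * w₃) * (a₃ * a₁),
      (u₁ * w₂ - u₂ * w₁) * (a₁ * a₂), a₁ * a₂ * a₃ * (a₁ * w₁ ^ 2 + a₂ * w₂ ^ 2 + a₃ * w₃ ^ 2),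
      fun h0 => mul_ne_zero (mul_ne_zero (mul_ne_zero h₁ h₂) h₃) hw h0.2.2.2, ?_⟩
    have key : a₁ * ((u₂ * w₃ - u₃ * w₂) * (a₂ * a₃)) ^ 2 +
        a₂ * ((u₃ * w₁ - u₁ * w₃) * (a₃ * a₁)) ^ 2 + a₃ * ((u₁ * w₂ - u₂ * w₁) * (a₁ * a₂)) ^ 2 =
        a₁ * a₂ * a₃ * ((a₁ * u₁ ^ 2 + a₂ * u₂ ^ 2 + a₃ * u₃ ^ 2) *
          (a₁ * w₁ ^ 2 + a₂ * w₂ ^ 2 + a₃ * w₃ ^ 2) -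
          (a₁ * u₁ * w₁ + a₂ * u₂ * w₂ + a₃ * u₃ * w₃) ^ 2) := by ring
    rw [hd] at e1
    rw [key, e2']
    linear_combination a₁ * a₂ * a₃ * (a₁ * w₁ ^ 2 + a₂ * w₂ ^ 2 + a₃ * w₃ ^ 2) * e1

end

section

variable {F : Type} [Field F] [NumberField F]

omit [NumberField F] in
lemma isotropic_of_mem_normGrp {a e₂ e₃ : Fˣ} (h : a * e₃ ∈ normGrp ((a * e₂ : Fˣ) : F)) :
    ∃ n₁ n₂ : F, -(a : F) * n₁ ^ 2 + e₂ * n₂ ^ 2 + e₃ * 1 ^ 2 = 0 := by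
  obtain ⟨X, Y, h⟩ := h
  have := a.ne_zero
  refine ⟨X / a, Y, ?_⟩
  push_cast at h
  field_simp
  linear_combination h

lemma exists_isotropic {a e₂ e₃ : Fˣ} (x y : Fˣ) (hpos : RealPos ((a * e₂ : Fˣ) : F))
    (hdy : ∀ p : HeightOneSpectrum (𝓞 F), ¬ Odd' p → a * e₂ ∈ LocSq p) :
    ∃ z : Fin 2 → F, ∃ t : Fˣ, (t : F) = Qf ![(x : F), y] z ∧
      ∃ n₁ n₂ n₃ n₄ : F, ¬ (n₁ = 0 ∧ n₂ = 0 ∧ n₃ = 0 ∧ n₄ = 0) ∧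
        -(a : F) * n₁ ^ 2 + e₂ * n₂ ^ 2 + e₃ * n₃ ^ 2 + t * n₄ ^ 2 = 0 := by
  have hfin : {p : HeightOneSpectrum (𝓞 F) | Odd' p ∧
      ¬ (lv p a = 0 ∧ lv p e₂ = 0 ∧ lv p e₃ = 0)}.Finite := by
    refine (((finite_lv_ne_zero a).union (finite_lv_ne_zero e₂)).union
      (finite_lv_ne_zero e₃)).subset fun p hp => ?_
    have := hp.2
    by_contra hn
    simp only [Set.mem_union, Set.mem_ofPred_eq, not_or, not_not] at hn
    exact this ⟨hn.1.1, hn.1.2, hn.2⟩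
  obtain ⟨S, hS⟩ := hfin.exists_finset
  simp only [Set.mem_ofPred_eq] at hS
  obtain ⟨z, t, ht, hz⟩ := exists_binary S (fun p hp => ((hS p).1 hp).1) x y (-(a * e₂ * e₃))
  refine ⟨z, t, ht, ?_⟩
  obtain ⟨d, hd⟩ : ∃ d : Fˣ, d = -(a * e₂ * e₃) * t := ⟨_, rfl⟩
  rw [← hd] at hz
  have hunit : ∀ p : HeightOneSpectrum (𝓞 F), Odd' p → d ∈ LocSq p →
      lv p (a * e₃) = 0 ∧ lv p (a * e₂) = 0 := by
    intro p hp hdp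
    have : ¬ p ∈ S := fun h => hz p h hdp
    rw [hS, not_and, not_not] at this
    obtain ⟨h1, h2, h3⟩ := this hp
    rw [lv_mul, lv_mul, h1, h2, h3]
    exact ⟨rfl, rfl⟩
  by_cases hsq : IsSquare (d : F)
  · obtain ⟨n₁, n₂, h⟩ := isotropic_of_mem_normGrp (e₃ := e₃) (mem_normGrp_of_local hpos fun p => by
      by_cases hp : Odd' p
      · obtain ⟨h1, h2⟩ := hunit p hp (mem_locSq_of_isSquare_val hsq)
        exact Or.inr ⟨hp, mem_locNm_of_units hp h1 h2⟩
      · exact Or.inl (hdy p hp))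
    exact ⟨n₁, n₂, 1, 0, by simp, by linear_combination h⟩
  · obtain ⟨E, _, _, _, _, ⟨Q⟩⟩ := exists_quadExt hsq
    obtain ⟨n₁, n₂, h⟩ := isotropic_of_mem_normGrp (a := QuadExt.ui F E a)
      (e₂ := QuadExt.ui F E e₂) (e₃ := QuadExt.ui F E e₃) (by
      rw [← map_mul, ← map_mul]
      refine mem_normGrp_of_local (fun φ => hpos (φ.comp (algebraMap F E))) fun P => ?_
      by_cases hP : Odd' P
      · have h1 := lift_condition Q P hP (f := a * e₃) (b := a * e₂) (by
          by_cases hdp : d ∈ LocSq (QuadExt.below (F := F) P)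
          · exact Or.inl (hunit _ (odd'_below_iff.2 hP) hdp)
          · exact Or.inr hdp)
        exact h1.imp_right fun h => ⟨hP, h⟩
      · exact Or.inl (ui_mem_locSq (hdy _ fun h => hP (odd'_below_iff.1 h))))
    refine isotropic_descent (E := E) (d := (d : F)) (x := n₁) (y := n₂) (z := 1)
      (neg_ne_zero.2 a.ne_zero) e₂.ne_zero e₃.ne_zero (by rw [hd]; push_cast; ring) Q (by simp) ?_
    rw [map_neg]
    exact h

section posdef

variable {ι : Type} [Fintype ι]

omit [NumberField F] in
lemma realPos_Qf {c : ι → F} (hc : ∀ i, RealPos (c i)) {v : ι → F} (hv : v ≠ 0) :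
    RealPos (Qf c v) := by
  intro φ
  obtain ⟨i, hi⟩ := Function.ne_iff.1 hv
  rw [Qf, map_sum]
  refine Finset.sum_pos' (fun j _ => ?_) ⟨i, Finset.mem_univ i, ?_⟩
  · rw [map_mul, map_pow]
    have := hc j φ
    positivity
  · rw [map_mul, map_pow]
    have := hc i φ
    have h2 : φ (v i) ≠ 0 := by simpa using hi
    positivity

omit [NumberField F] in
lemma exists_orthogonal (c : ι → F) {k : ℕ} (hk : k < Fintype.card ι) (v : Fin k → ι → F) :
    ∃ w : ι → F, w ≠ 0 ∧ ∀ j, Bf c (v j) w = 0 := by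
  let f : (ι → F) →ₗ[F] (Fin k → F) :=
    { toFun := fun w j => Bf c (v j) w
      map_add' := fun x y => by
        funext j
        simp only [Pi.add_apply]
        rw [Bf_symm, Bf_add_left, Bf_symm, Bf_symm c y]
      map_smul' := fun t x => by
        funext j
        rw [Bf_smul_right]; rfl }
  have h := LinearMap.ker_ne_bot_of_finrank_lt (f := f) (by simpa using hk)
  obtain ⟨w, hw, hw0⟩ := Submodule.exists_mem_ne_zero_of_ne_bot h
  exact ⟨w, hw0, fun j => congrFun (LinearMap.mem_ker.1 hw) j⟩

omit [NumberField F] in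
lemma Qf_add_of_orthogonal {c x y : ι → F} (h : Bf c x y = 0) :
    Qf c (x + y) = Qf c x + Qf c y := by
  rw [Qf_add, h, add_zero]

omit [NumberField F] in
lemma Bf_add_right (c x y z : ι → F) : Bf c x (y + z) = Bf c x y + Bf c x z := by
  rw [Bf_symm, Bf_add_left, Bf_symm, Bf_symm c z]

omit [NumberField F] in
lemma Bf_smul_left (c x y : ι → F) (t : F) : Bf c (t • x) y = t * Bf c x y := by
  rw [Bf_symm, Bf_smul_right, Bf_symm]

end posdef

/-- A totally positive quaternary form represents all totally positive elements. -/
theorem exists_representation [Nonempty (F →+* ℝ)] {c : Fin 4 → F} (hc : ∀ i, RealPos (c i))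
    {a : F} (ha : RealPos a) : ∃ z : Fin 4 → F, Qf c z = a := by
  obtain ⟨φ⟩ := ‹Nonempty (F →+* ℝ)›
  have hne : ∀ {x : F}, RealPos x → x ≠ 0 := by
    rintro x hx rfl
    exact absurd (hx φ) (by simp)
  obtain ⟨v₁, u, hu, hloc⟩ := exists_locSq_all_dyadic (fun i => Units.mk0 (c i) (hne (hc i)))
    (Units.mk0 a (hne ha))
  simp only [Units.val_mk0] at hu
  have hv₁ : v₁ ≠ 0 := by
    rintro rfl
    rw [Qf_zero, mul_zero] at hu
    exact u.ne_zero hu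
  obtain ⟨v₂, hv₂, h₂⟩ := exists_orthogonal c (by simp) ![v₁]
  obtain ⟨v₃, hv₃, h₃⟩ := exists_orthogonal c (by simp) ![v₁, v₂]
  obtain ⟨v₄, hv₄, h₄⟩ := exists_orthogonal c (by simp) ![v₁, v₂, v₃]
  have h12 : Bf c v₁ v₂ = 0 := h₂ 0
  have h13 : Bf c v₁ v₃ = 0 := h₃ 0
  have h23 : Bf c v₂ v₃ = 0 := h₃ 1
  have h14 : Bf c v₁ v₄ = 0 := h₄ 0
  have h24 : Bf c v₂ v₄ = 0 := h₄ 1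
  have h34 : Bf c v₃ v₄ = 0 := h₄ 2
  have q₁ := realPos_Qf hc hv₁
  have q₂ := realPos_Qf hc hv₂
  have q₃ := realPos_Qf hc hv₃
  have q₄ := realPos_Qf hc hv₄
  have hau : u = Units.mk0 a (hne ha) * Units.mk0 _ (hne q₁) := Units.ext hu
  rw [hau] at hloc
  obtain ⟨z, t, ht, n₁, n₂, n₃, n₄, hn, h⟩ := exists_isotropic (e₃ := Units.mk0 _ (hne q₂))
    (Units.mk0 _ (hne q₃)) (Units.mk0 _ (hne q₄)) (by
      rw [Units.val_mul]; exact ha.mul q₁) hloc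
  simp only [Units.val_mk0] at h ht
  have hz : z ≠ 0 := by
    rintro rfl
    rw [Qf_zero] at ht
    exact t.ne_zero ht
  have hpt : RealPos (t : F) := by
    rw [ht]
    refine realPos_Qf (fun i => ?_) hz
    fin_cases i
    · exact q₃
    · exact q₄
  have hn1 : n₁ ≠ 0 := by
    rintro rfl
    apply hn
    have h' := congrArg φ h
    simp only [map_add, map_mul, map_pow, map_neg, map_zero] at h'
    have p1 := q₁ φ
    have p2 := q₂ φ
    have p3 := hpt φ
    have s1 := mul_nonneg p1.le (sq_nonneg (φ n₂))
    have s2 := mul_nonneg p2.le (sq_nonneg (φ n₃))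
    have s3 := mul_nonneg p3.le (sq_nonneg (φ n₄))
    have t1 : φ (Qf c v₁) * φ n₂ ^ 2 = 0 := by linarith
    have t2 : φ (Qf c v₂) * φ n₃ ^ 2 = 0 := by linarith
    have t3 : φ (t : F) * φ n₄ ^ 2 = 0 := by linarith
    rw [mul_eq_zero_iff_left p1.ne', pow_eq_zero_iff two_ne_zero, map_eq_zero] at t1
    rw [mul_eq_zero_iff_left p2.ne', pow_eq_zero_iff two_ne_zero, map_eq_zero] at t2
    rw [mul_eq_zero_iff_left p3.ne', pow_eq_zero_iff two_ne_zero, map_eq_zero] at t3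
    exact ⟨rfl, t1, t2, t3⟩
  have ht' : (t : F) = Qf c v₃ * z 0 ^ 2 + Qf c v₄ * z 1 ^ 2 := by
    rw [ht]; simp [Qf]
  refine ⟨n₁⁻¹ • (n₂ • v₁ + (n₃ • v₂ + n₄ • (z 0 • v₃ + z 1 • v₄))), ?_⟩
  rw [Qf_smul, Qf_add_of_orthogonal, Qf_add_of_orthogonal, Qf_smul, Qf_smul, Qf_smul,
    Qf_add_of_orthogonal, Qf_smul, Qf_smul]
  · field_simp
    rw [ht'] at h
    linear_combination h
  · simp [Bf_smul_left, Bf_smul_right, h34]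
  · simp [Bf_smul_left, Bf_smul_right, Bf_add_right, h23, h24]
  · simp [Bf_smul_left, Bf_smul_right, Bf_add_right, h12, h13, h14]

end

section

variable {F : Type} [Field F] [NumberField F] {ι : Type} [Fintype ι]

omit [NumberField F] in
lemma Bf_one (x y : ι → F) : Bf 1 x y = 2 * (x ⬝ᵥ y) := by
  simp only [Bf, dotProduct, Finset.mul_sum, Pi.one_apply]
  exact Finset.sum_congr rfl fun i _ => by ring

omit [NumberField F] in
lemma Qf_one (x : ι → F) : Qf 1 x = x ⬝ᵥ x := by
  simp only [Qf, dotProduct, Pi.one_apply]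
  exact Finset.sum_congr rfl fun i _ => by ring

/-- A nonzero vector orthogonal to `k` given vectors. -/
lemma exists_dotProduct_eq_zero {k : ℕ} (hk : k < Fintype.card ι) (v : Fin k → ι → F) :
    ∃ w : ι → F, w ≠ 0 ∧ ∀ j, v j ⬝ᵥ w = 0 := by
  obtain ⟨w, hw, h⟩ := exists_orthogonal 1 hk v
  refine ⟨w, hw, fun j => ?_⟩
  have := h j
  rw [Bf_one] at this
  simpa using this

/-- A totally positive number is a sum of squares along a vector orthogonal to given ones,
as long as the complement has dimension at least four. -/
lemma exists_dotProduct_self_eq [Nonempty (F →+* ℝ)] {k : ℕ} (hk : k + 4 ≤ Fintype.card ι)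
    (w : Fin k → ι → F) {a : F} (ha : RealPos a) :
    ∃ y : ι → F, (∀ j, w j ⬝ᵥ y = 0) ∧ y ⬝ᵥ y = a := by
  obtain ⟨v₁, n₁, h₁⟩ := exists_dotProduct_eq_zero (by omega) w
  obtain ⟨v₂, n₂, h₂⟩ := exists_dotProduct_eq_zero (by omega) (Fin.cons v₁ w : Fin (k + 1) → ι → F)
  obtain ⟨v₃, n₃, h₃⟩ := exists_dotProduct_eq_zero (by omega)
    (Fin.cons v₂ (Fin.cons v₁ w : Fin (k + 1) → ι → F) : Fin (k + 1 + 1) → ι → F)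
  obtain ⟨v₄, n₄, h₄⟩ := exists_dotProduct_eq_zero (by omega)
    (Fin.cons v₃ (Fin.cons v₂ (Fin.cons v₁ w : Fin (k + 1) → ι → F) : Fin (k + 1 + 1) → ι → F) :
      Fin (k + 1 + 1 + 1) → ι → F)
  simp only [Fin.forall_fin_succ, Fin.cons_zero, Fin.cons_succ] at h₂ h₃ h₄
  have hone : ∀ i : ι, RealPos ((1 : ι → F) i) := fun i φ => by simp
  have q : ∀ {v : ι → F}, v ≠ 0 → RealPos (v ⬝ᵥ v) := fun {v} hv => by
    rw [← Qf_one]; exact realPos_Qf hone hv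
  obtain ⟨z, hz⟩ := exists_representation
    (c := ![v₁ ⬝ᵥ v₁, v₂ ⬝ᵥ v₂, v₃ ⬝ᵥ v₃, v₄ ⬝ᵥ v₄]) (by
      intro i
      fin_cases i
      exacts [q n₁, q n₂, q n₃, q n₄]) ha
  refine ⟨z 0 • v₁ + z 1 • v₂ + z 2 • v₃ + z 3 • v₄, fun j => ?_, ?_⟩
  · simp [dotProduct_add, h₁ j, h₂.2 j, h₃.2.2 j, h₄.2.2.2 j]
  · obtain ⟨h12, -⟩ := h₂
    obtain ⟨h23, h13, -⟩ := h₃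
    obtain ⟨h34, h24, h14, -⟩ := h₄
    rw [← hz]
    simp only [Qf, Fin.sum_univ_four, dotProduct_add, add_dotProduct, smul_dotProduct,
      dotProduct_smul, smul_eq_mul, h12, h23, h13, h34, h24, h14, dotProduct_comm v₂ v₁,
      dotProduct_comm v₃ v₁, dotProduct_comm v₃ v₂, dotProduct_comm v₄ v₁, dotProduct_comm v₄ v₂,
      dotProduct_comm v₄ v₃]
    simp
    ring

lemma exists_orthogonal_family [Nonempty (F →+* ℝ)] {k : ℕ} (hk : k + 3 ≤ Fintype.card ι)
    (a : Fin k → F) (ha : ∀ i, RealPos (a i)) :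
    ∃ w : Fin k → ι → F, (∀ i j, i ≠ j → w i ⬝ᵥ w j = 0) ∧ ∀ i, w i ⬝ᵥ w i = a i := by
  induction k with
  | zero => exact ⟨Fin.elim0, fun i => i.elim0, fun i => i.elim0⟩
  | succ k ih =>
    obtain ⟨w, h, h'⟩ := ih (by omega) (fun i => a i.succ) fun i => ha _
    obtain ⟨y, hy, hy'⟩ := exists_dotProduct_self_eq (by omega) w (ha 0)
    refine ⟨Fin.cons y w, fun i j => ?_, fun i => ?_⟩
    · refine Fin.cases ?_ (fun i => ?_) i <;> refine Fin.cases ?_ (fun j => ?_) j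
      · intro h; exact absurd rfl h
      · intro _; simpa [dotProduct_comm y] using hy j
      · intro _; simpa using hy i
      · intro hij
        simpa using h i j fun e => hij (by rw [e])
    · refine Fin.cases ?_ (fun i => ?_) i
      · simpa using hy'
      · simpa using h' i

/-- A totally positive definite quadratic space of dimension `n` embeds into the sum of `n + 3`
squares. -/
theorem exists_isometric_embedding [Nonempty (F →+* ℝ)] {V : Type} [AddCommGroup V] [Module F V]
    [FiniteDimensional F V] (B : LinearMap.BilinForm F V) (hB : ∀ x y, B x y = B y x)
    (hpos : ∀ v, v ≠ 0 → RealPos (B v v)) (hι : Module.finrank F V + 3 ≤ Fintype.card ι) :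
    ∃ f : V →ₗ[F] (ι → F), ∀ x y, f x ⬝ᵥ f y = B x y := by
  have : Invertible (2 : F) := invertibleOfNonzero two_ne_zero
  obtain ⟨b, hb⟩ := LinearMap.BilinForm.exists_orthogonal_basis (B := B) ⟨fun x y => hB x y⟩
  obtain ⟨w, hw, hw'⟩ := exists_orthogonal_family hι (fun i => B (b i) (b i)) fun i =>
    hpos _ (b.ne_zero i)
  let f : V →ₗ[F] (ι → F) := b.constr F w
  have hf : ∀ i, f (b i) = w i := fun i => b.constr_basis F w i
  have h : (dotProductBilin F F : LinearMap.BilinForm F (ι → F)).compl₁₂ f f = B := by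
    refine LinearMap.BilinForm.ext_basis b fun i j => ?_
    change f (b i) ⬝ᵥ f (b j) = _
    rw [hf, hf]
    by_cases hij : i = j
    · subst hij; exact hw' i
    · rw [hw i j hij]; exact (hb hij).symm
  exact ⟨f, fun x y => by rw [← h]; rfl⟩

end

section

open scoped nonZeroDivisors

section Lattice

variable {R K : Type} [CommRing R] [IsDedekindDomain R] [Field K] [Algebra R K] [IsFractionRing R K]
variable {ι : Type} [Fintype ι]

/-- The dot product as a bilinear form. -/
abbrev dotForm (K ι : Type) [Field K] [Fintype ι] : LinearMap.BilinForm K (ι → K) :=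
  dotProductBilin K K

omit [IsDedekindDomain R] [Fintype ι] in
lemma isLocalizedModule_subtype {V : Type} [AddCommGroup V] [Module R V] [Module K V]
    [IsScalarTower R K V] {N : Submodule R V}
    (hN : ∀ v : V, ∃ d : R, d ≠ 0 ∧ d • v ∈ N) [IsDomain R] : IsLocalizedModule R⁰ N.subtype where
  map_units d := by
    have hd : algebraMap R K d ≠ 0 := by
      simp
    rw [Module.End.isUnit_iff]
    constructor
    · intro x y hxy
      have h : (d : R) • x = (d : R) • y := hxy
      rw [← algebraMap_smul K (d : R) x, ← algebraMap_smul K (d : R) y] at h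
      exact smul_right_injective _ hd h
    · intro y
      refine ⟨(algebraMap R K d)⁻¹ • y, ?_⟩
      change (d : R) • ((algebraMap R K d)⁻¹ • y) = y
      rw [← algebraMap_smul K (d : R), smul_inv_smul₀ hd]
  surj v := by
    obtain ⟨d, hd, h⟩ := hN v
    exact ⟨(⟨_, h⟩, ⟨d, mem_nonZeroDivisors_of_ne_zero hd⟩), rfl⟩
  exists_of_eq h := ⟨1, by rw [Subtype.coe_injective h]⟩

omit [IsDedekindDomain R] [Fintype ι] in
lemma isBaseChange_subtype {V : Type} [AddCommGroup V] [Module R V] [Module K V]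
    [IsScalarTower R K V] {N : Submodule R V}
    (hN : ∀ v : V, ∃ d : R, d ≠ 0 ∧ d • v ∈ N) [IsDomain R] : IsBaseChange K N.subtype :=
  (isLocalizedModule_iff_isBaseChange R⁰ K _).1 (isLocalizedModule_subtype (K := K) hN)

omit [IsDedekindDomain R] in
/-- Functionals on a full submodule are given by elements of its dual. -/
lemma exists_dual_eq [IsDomain R] {N : Submodule R (ι → K)}
    (hN : ∀ v : ι → K, ∃ d : R, d ≠ 0 ∧ d • v ∈ N) (φ : N →ₗ[R] R) :
    ∃ y : ι → K, ∀ x : N, y ⬝ᵥ x = algebraMap R K (φ x) := by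
  classical
  have hb := isBaseChange_subtype (K := K) hN
  let ψ : (ι → K) →ₗ[K] K := hb.lift (Algebra.linearMap R K ∘ₗ φ)
  refine ⟨fun i => ψ (Pi.single i 1), fun x => ?_⟩
  have h : ψ (N.subtype x) = algebraMap R K (φ x) := hb.lift_eq _ x
  rw [← h, LinearMap.pi_apply_eq_sum_univ ψ]
  simp only [dotProduct, Submodule.subtype_apply, smul_eq_mul]
  exact Finset.sum_congr rfl fun i _ => by
    rw [mul_comm]
    congr 2
    funext j
    simp [Pi.single_apply, eq_comm]

omit [Fintype ι] in
lemma projective_of_fg {N : Submodule R (ι → K)} (hfg : N.FG) : Module.Projective R N := by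
  have : Module.Finite R N := Module.Finite.of_fg hfg
  have : Module.FinitePresentation R N := Module.finitePresentation_of_finite R N
  have : Module.IsTorsionFree R K := inferInstance
  have : Module.IsTorsionFree R N := inferInstance
  have : Module.Flat R N := by
    rw [IsDedekindDomain.flat_iff_torsion_eq_bot, ← Submodule.isTorsionFree_iff_torsion_eq_bot]
    infer_instance
  exact Module.Flat.projective_of_finitePresentation

/-- The double dual of a full lattice is the lattice itself. -/
theorem dualSubmodule_dualSubmodule_le {N : Submodule R (ι → K)} (hfg : N.FG)
    (hN : ∀ v : ι → K, ∃ d : R, d ≠ 0 ∧ d • v ∈ N) :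
    (dotForm K ι).dualSubmodule ((dotForm K ι).dualSubmodule N) ≤ N := by
  have : Module.Finite R N := Module.Finite.of_fg hfg
  have := projective_of_fg hfg
  obtain ⟨n, f, g, -, -, hfg⟩ := Module.Finite.exists_comp_eq_id_of_projective R N
  choose y hy using fun i : Fin n => exists_dual_eq hN (LinearMap.proj i ∘ₗ g)
  have key : ∀ x : N, (x : ι → K) = ∑ i, (y i ⬝ᵥ x) • (f (Pi.single i 1) : ι → K) := by
    intro x
    have h : x = f (g x) := (LinearMap.congr_fun hfg x).symm
    rw [LinearMap.pi_apply_eq_sum_univ f] at h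
    conv_lhs => rw [h]
    rw [Submodule.coe_sum]
    refine Finset.sum_congr rfl fun i _ => ?_
    rw [hy, algebraMap_smul]
    simp only [Submodule.coe_smul, LinearMap.comp_apply, LinearMap.proj_apply]
    congr 3
    funext j
    simp [Pi.single_apply, eq_comm]
  have key' : ∀ v : ι → K, v = ∑ i, (y i ⬝ᵥ v) • (f (Pi.single i 1) : ι → K) := by
    intro v
    obtain ⟨d, hd, hv⟩ := hN v
    have hd' : algebraMap R K d ≠ 0 := by simpa using hd
    have h := key ⟨_, hv⟩
    simp only [← algebraMap_smul K d v, dotProduct_smul, smul_eq_mul, mul_smul,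
      ← Finset.smul_sum] at h
    exact smul_right_injective _ hd' h
  intro v hv
  rw [key' v]
  refine N.sum_mem fun i _ => ?_
  have h : v ⬝ᵥ y i ∈ (1 : Submodule R K) := hv (y i) fun x hx => by
    change y i ⬝ᵥ x ∈ _
    have := hy i ⟨x, hx⟩
    rw [this]
    exact Submodule.mem_one.2 ⟨_, rfl⟩
  obtain ⟨r, hr⟩ := Submodule.mem_one.1 h
  rw [dotProduct_comm, ← hr, algebraMap_smul]
  exact N.smul_mem _ (Subtype.property _)

/-- The standard lattice in `ι → K`. -/
def stdLattice (R K ι : Type) [CommRing R] [Field K] [Algebra R K] : Submodule R (ι → K) :=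
  LinearMap.range ((Algebra.linearMap R K).compLeft ι)

omit [IsDedekindDomain R] [IsFractionRing R K] [Fintype ι] in
lemma mem_stdLattice {v : ι → K} :
    v ∈ stdLattice R K ι ↔ ∀ i, v i ∈ (1 : Submodule R K) := by
  constructor
  · rintro ⟨w, rfl⟩ i
    exact Submodule.mem_one.2 ⟨w i, rfl⟩
  · intro h
    choose w hw using fun i => Submodule.mem_one.1 (h i)
    exact ⟨w, funext hw⟩

omit [IsDedekindDomain R] [IsFractionRing R K] in
lemma stdLattice_fg : (stdLattice R K ι).FG := by
  rw [stdLattice, LinearMap.range_eq_map]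
  exact (Module.Finite.fg_top).map _

omit [IsDedekindDomain R] [IsFractionRing R K] in
lemma dotProduct_mem_one {v w : ι → K} (hv : v ∈ stdLattice R K ι) (hw : w ∈ stdLattice R K ι) :
    v ⬝ᵥ w ∈ (1 : Submodule R K) := by
  rw [mem_stdLattice] at hv hw
  refine Submodule.sum_mem _ fun i _ => ?_
  obtain ⟨a, ha⟩ := Submodule.mem_one.1 (hv i)
  obtain ⟨b, hb⟩ := Submodule.mem_one.1 (hw i)
  exact Submodule.mem_one.2 ⟨a * b, by rw [map_mul, ha, hb]⟩

omit [IsDedekindDomain R] [IsFractionRing R K] in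
lemma mem_stdLattice_of_dual {v : ι → K}
    (h : ∀ w ∈ stdLattice R K ι, v ⬝ᵥ w ∈ (1 : Submodule R K)) : v ∈ stdLattice R K ι := by
  classical
  rw [mem_stdLattice]
  intro i
  have := h (Pi.single i 1) (by
    rw [mem_stdLattice]
    intro j
    rcases eq_or_ne j i with rfl | hj
    · simpa using Submodule.mem_one.2 ⟨1, map_one _⟩
    · simp [hj])
  simpa using this

omit [IsDedekindDomain R] in
lemma exists_smul_mem_stdLattice [IsDomain R] (s : Finset (ι → K)) :
    ∃ d : R, d ≠ 0 ∧ ∀ v ∈ s, d • v ∈ stdLattice R K ι := by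
  classical
  obtain ⟨d, hd⟩ := IsLocalization.exist_integer_multiples_of_finset R⁰
    (s.biUnion fun v => Finset.univ.image v)
  refine ⟨d, nonZeroDivisors.ne_zero d.2, fun v hv => mem_stdLattice.2 fun i => ?_⟩
  exact Submodule.mem_one.2 (hd (v i) (Finset.mem_biUnion.2 ⟨v, hv, by simp⟩))

/-- An integral lattice in the sum-of-squares space is contained in a full self-dual lattice. -/
theorem exists_selfDual {N : Submodule R (ι → K)} (hfg : N.FG)
    (h_int : ∀ x ∈ N, ∀ y ∈ N, x ⬝ᵥ y ∈ (1 : Submodule R K)) :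
    ∃ M : Submodule R (ι → K), N ≤ M ∧ M.FG ∧ (∀ v : ι → K, ∃ d : R, d ≠ 0 ∧ d • v ∈ M) ∧
      (dotForm K ι).dualSubmodule M = M := by
  classical
  obtain ⟨s, rfl⟩ := hfg
  obtain ⟨c, hc, hcs⟩ := exists_smul_mem_stdLattice (R := R) s
  have hcK : algebraMap R K c ≠ 0 := by simpa using hc
  set N := Submodule.span R (s : Set (ι → K)) with hNdef
  have hcN : ∀ v ∈ N, c • v ∈ stdLattice R K ι := by
    intro v hv
    have : N ≤ (stdLattice R K ι).comap (LinearMap.lsmul R _ c) :=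
      Submodule.span_le.2 fun v hv => hcs v hv
    exact this hv
  let P : Set (Submodule R (ι → K)) :=
    {M | (∀ v ∈ stdLattice R K ι, c • v ∈ M) ∧ ∀ x ∈ M, ∀ y ∈ M, x ⬝ᵥ y ∈ (1 : Submodule R K)}
  let N₀ := N ⊔ (stdLattice R K ι).map (LinearMap.lsmul R _ c)
  have hN₀ : N₀ ∈ P := by
    refine ⟨fun v hv => Submodule.mem_sup_right ⟨v, hv, rfl⟩, fun x hx y hy => ?_⟩
    obtain ⟨a, ha, b, hb, rfl⟩ := Submodule.mem_sup.1 hx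
    obtain ⟨a', ha', b', hb', rfl⟩ := Submodule.mem_sup.1 hy
    obtain ⟨b, hb, rfl⟩ := hb
    obtain ⟨b', hb', rfl⟩ := hb'
    simp only [LinearMap.lsmul_apply, dotProduct_add, add_dotProduct]
    refine add_mem (add_mem (h_int _ ha _ ha') ?_) (add_mem ?_ ?_)
    · rw [smul_dotProduct, ← dotProduct_smul]
      exact dotProduct_mem_one hb (hcN _ ha')
    · rw [dotProduct_smul, ← smul_dotProduct]
      exact dotProduct_mem_one (hcN _ ha) hb'
    · rw [dotProduct_smul, smul_dotProduct]
      exact Submodule.smul_mem _ _ (Submodule.smul_mem _ _ (dotProduct_mem_one hb hb'))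
  obtain ⟨M, hNM, hM⟩ := zorn_le_nonempty₀ P (by
    intro C hC hchain M₁ hM₁
    refine ⟨sSup C, ⟨fun v hv => ?_, fun x hx y hy => ?_⟩, fun z hz => le_sSup hz⟩
    · exact le_sSup hM₁ ((hC hM₁).1 v hv)
    · rw [Submodule.mem_sSup_of_directed ⟨M₁, hM₁⟩ hchain.directedOn] at hx hy
      obtain ⟨A, hA, hxA⟩ := hx
      obtain ⟨B, hB, hyB⟩ := hy
      rcases hchain.total hA hB with h | h
      · exact (hC hB).2 x (h hxA) y hyB
      · exact (hC hA).2 x hxA y (h hyB)) N₀ hN₀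
  obtain ⟨hMc, hMint⟩ : M ∈ P := hM.prop
  have hMD : M ≤ (dotForm K ι).dualSubmodule M := fun x hx y hy => hMint x hx y hy
  have hMfull : ∀ v : ι → K, ∃ d : R, d ≠ 0 ∧ d • v ∈ M := by
    intro v
    obtain ⟨d, hd, h⟩ := exists_smul_mem_stdLattice (R := R) {v}
    exact ⟨c * d, mul_ne_zero hc hd, by
      rw [mul_smul]; exact hMc _ (h v (by simp))⟩
  have hMfg : M.FG := by
    let g : (ι → R) →ₗ[R] (ι → K) :=
      { toFun := fun w => (algebraMap R K c)⁻¹ • ((Algebra.linearMap R K).compLeft ι w)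
        map_add' := fun x y => by rw [map_add, smul_add]
        map_smul' := fun r x => by
          rw [map_smul, smul_comm]; rfl }
    have hle : M ≤ LinearMap.range g := by
      intro x hx
      have : c • x ∈ stdLattice R K ι := mem_stdLattice_of_dual fun w hw => by
        rw [smul_dotProduct, ← dotProduct_smul]
        exact hMint x hx _ (hMc w hw)
      obtain ⟨w, hw⟩ := this
      refine ⟨w, ?_⟩
      change (algebraMap R K c)⁻¹ • _ = x
      rw [hw, ← algebraMap_smul K c x, inv_smul_smul₀ hcK]
    have : IsNoetherian R (LinearMap.range g) := 
      isNoetherian_of_surjective g.rangeRestrict g.range_rangeRestrict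
    have : IsNoetherian R M := isNoetherian_of_le hle
    exact (Submodule.fg_top M).1 (IsNoetherian.noetherian _)
  have h_int : stdLattice R K ι ⊓ (dotForm K ι).dualSubmodule M ≤ M := by
    set T := stdLattice R K ι ⊓ (dotForm K ι).dualSubmodule M with hT
    have hmem : M ⊔ T ∈ P := by
      refine ⟨fun v hv => Submodule.mem_sup_left (hMc v hv), fun x hx y hy => ?_⟩
      obtain ⟨a, ha, b, hb, rfl⟩ := Submodule.mem_sup.1 hx
      obtain ⟨a', ha', b', hb', rfl⟩ := Submodule.mem_sup.1 hy
      simp only [dotProduct_add, add_dotProduct]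
      refine add_mem (add_mem (hMint _ ha _ ha') (hb.2 _ ha')) (add_mem ?_ ?_)
      · rw [dotProduct_comm]; exact hb'.2 _ ha
      · exact dotProduct_mem_one hb.1 hb'.1
    exact le_sup_right.trans (hM.le_of_ge hmem le_sup_left)
  refine ⟨M, le_sup_left.trans hNM, hMfg, hMfull, le_antisymm (fun x hx => ?_) hMD⟩
  have h1 : x ∈ stdLattice R K ι ⊔ M := by
    refine dualSubmodule_dualSubmodule_le (stdLattice_fg.sup hMfg) (fun v => ?_) ?_
    · obtain ⟨d, hd, h⟩ := hMfull v
      exact ⟨d, hd, Submodule.mem_sup_right h⟩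
    · intro y hy
      refine hx y (h_int ⟨mem_stdLattice_of_dual fun w hw => ?_, fun w hw => ?_⟩)
      · exact hy w (Submodule.mem_sup_left hw)
      · exact hy w (Submodule.mem_sup_right hw)
  obtain ⟨a, ha, b, hb, rfl⟩ := Submodule.mem_sup.1 h1
  refine add_mem (h_int ⟨ha, ?_⟩) hb
  have := sub_mem hx (hMD hb)
  rwa [add_sub_cancel_right] at this

end Lattice

end

section

open scoped nonZeroDivisors

lemma nonempty_ringHom_real {K : Type} [Field K] [NumberField K] (h : TotallyReal K) :
    Nonempty (K →+* ℝ) := by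
  obtain ⟨φ⟩ : Nonempty (K →+* ℂ) := inferInstance
  refine ⟨(RingHom.codRestrict φ Complex.ofRealHom.fieldRange fun x => ⟨(φ x).re, ?_⟩) |>
    (Complex.ofRealHom.rangeRestrictFieldEquiv).symm.toRingHom.comp⟩
  exact Complex.ext rfl (h φ x).symm

/-- The bilinear form on `K ⊗ L`. -/
abbrev _root_.OKLattice.formK {K : Type} [Field K] (L : OKLattice K) :
    LinearMap.BilinForm K (K ⊗[𝓞 K] L.carrier) :=
  LinearMap.BilinForm.baseChange K L.form

variable {K : Type} [Field K] [NumberField K] (L : OKLattice K)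

omit [NumberField K] in
lemma formK_one_tmul (x y : L.carrier) :
    L.formK (1 ⊗ₜ x) (1 ⊗ₜ y) = algebraMap (𝓞 K) K (L.form x y) := by
  rw [OKLattice.formK, LinearMap.BilinForm.baseChange_tmul, mul_one, Algebra.algebraMap_eq_smul_one]

lemma exists_smul_eq_one_tmul (x : K ⊗[𝓞 K] L.carrier) :
    ∃ (d : K) (y : L.carrier), d ≠ 0 ∧ d • x = 1 ⊗ₜ y := by
  have := (isLocalizedModule_iff_isBaseChange (𝓞 K)⁰ K
    (TensorProduct.mk (𝓞 K) K L.carrier 1)).2 (TensorProduct.isBaseChange _ _ _)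
  obtain ⟨⟨y, d⟩, h⟩ := this.surj x
  refine ⟨algebraMap (𝓞 K) K d, y, by simp, ?_⟩
  rw [algebraMap_smul]
  exact h

lemma formK_symm (x y : K ⊗[𝓞 K] L.carrier) : L.formK x y = L.formK y x := by
  obtain ⟨d, a, hd, ha⟩ := exists_smul_eq_one_tmul L x
  obtain ⟨e, b, he, hb⟩ := exists_smul_eq_one_tmul L y
  have h : L.formK (d • x) (e • y) = L.formK (e • y) (d • x) := by
    rw [ha, hb, formK_one_tmul, formK_one_tmul, L.symm]
  simp only [map_smul, LinearMap.smul_apply, smul_eq_mul] at h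
  refine mul_left_cancel₀ (mul_ne_zero hd he) ?_
  linear_combination h

lemma realPos_formK {x : K ⊗[𝓞 K] L.carrier} (hx : x ≠ 0) : RealPos (L.formK x x) := by
  intro φ
  obtain ⟨d, a, hd, ha⟩ := exists_smul_eq_one_tmul L x
  have ha0 : a ≠ 0 := by
    rintro rfl
    rw [TensorProduct.tmul_zero] at ha
    exact (smul_ne_zero hd hx) ha
  have h : d ^ 2 * L.formK x x = algebraMap (𝓞 K) K (L.form a a) := by
    rw [← formK_one_tmul, ← ha]
    simp only [map_smul, LinearMap.smul_apply, smul_eq_mul]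
    ring
  have hp := L.posDef a ha0 φ
  rw [← h, map_mul, map_pow] at hp
  exact pos_of_mul_pos_right hp (sq_nonneg _)

/-- A self-dual full submodule of the sum-of-squares space, as a lattice. -/
def latticeOfSelfDual {ι : Type} [Fintype ι] (M : Submodule (𝓞 K) (ι → K)) (hfg : M.FG)
    (hM : (dotForm K ι).dualSubmodule M = M) : OKLattice K :=
  { carrier := M
    finite := Module.Finite.of_fg hfg
    torsionFree := ⟨fun {c x} h => by
      have h' : algebraMap (𝓞 K) K c • (x : ι → K) = 0 := by
        rw [algebraMap_smul]; exact congrArg Subtype.val h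
      refine (smul_eq_zero.1 h').imp (fun h => ?_) fun h => Subtype.ext h
      exact FaithfulSMul.algebraMap_injective (𝓞 K) K (h.trans (map_zero _).symm)⟩
    form := (dotForm K ι).dualSubmoduleToDual M ∘ₗ Submodule.inclusion hM.ge
    symm := fun x y => FaithfulSMul.algebraMap_injective (𝓞 K) K (by
      simp only [LinearMap.comp_apply, LinearMap.BilinForm.dualSubmoduleToDual_apply_apply,
        LinearMap.BilinForm.dualSubmoduleParing_spec]
      exact dotProduct_comm _ _)
    posDef := fun v hv σ => by
      simp only [LinearMap.comp_apply, LinearMap.BilinForm.dualSubmoduleToDual_apply_apply,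
        LinearMap.BilinForm.dualSubmoduleParing_spec]
      have h := realPos_Qf (c := (1 : ι → K)) (fun i φ => by simp)
        (v := (v : ι → K)) (by simpa using hv) σ
      rw [Qf_one] at h
      exact h }

section

variable {ι : Type} [Fintype ι] {M : Submodule (𝓞 K) (ι → K)} (hfg : M.FG)
    (hM : (dotForm K ι).dualSubmodule M = M)

omit [NumberField K] in
lemma latticeOfSelfDual_form (x y : M) :
    algebraMap (𝓞 K) K ((latticeOfSelfDual M hfg hM).form x y) = (x : ι → K) ⬝ᵥ (y : ι → K) :=
  LinearMap.BilinForm.dualSubmoduleParing_spec _ _ _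

lemma latticeOfSelfDual_isUnimodular [Nonempty (K →+* ℝ)]
    (hfull : ∀ v : ι → K, ∃ d : 𝓞 K, d ≠ 0 ∧ d • v ∈ M) :
    (latticeOfSelfDual M hfg hM).IsUnimodular := by
  constructor
  · intro x y hxy
    by_contra hne
    obtain ⟨σ⟩ := ‹Nonempty (K →+* ℝ)›
    have h := (latticeOfSelfDual M hfg hM).posDef (x - y) (sub_ne_zero.2 hne) σ
    have h0 : (latticeOfSelfDual M hfg hM).form (x - y) = 0 := by rw [map_sub, hxy, sub_self]
    rw [h0, LinearMap.zero_apply, map_zero, map_zero] at h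
    exact lt_irrefl _ h
  · intro φ
    obtain ⟨y, hy⟩ := exists_dual_eq hfull φ
    have hyM : y ∈ M := by
      rw [← hM]
      intro x hx
      exact Submodule.mem_one.2 ⟨_, (hy ⟨x, hx⟩).symm⟩
    refine ⟨⟨y, hyM⟩, LinearMap.ext fun x => FaithfulSMul.algebraMap_injective (𝓞 K) K ?_⟩
    exact (latticeOfSelfDual_form hfg hM ⟨y, hyM⟩ x).trans (hy x)

lemma exists_latticeOfSelfDual_equiv
    (hfull : ∀ v : ι → K, ∃ d : 𝓞 K, d ≠ 0 ∧ d • v ∈ M) :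
    ∃ e : (K ⊗[𝓞 K] (latticeOfSelfDual M hfg hM).carrier) ≃ₗ[K] (ι → K),
      ∀ x, (latticeOfSelfDual M hfg hM).formK x x = ∑ i, (e x i) ^ 2 := by
  let e : (K ⊗[𝓞 K] (latticeOfSelfDual M hfg hM).carrier) ≃ₗ[K] (ι → K) :=
    (isBaseChange_subtype (K := K) hfull).equiv
  refine ⟨e, fun x => ?_⟩
  obtain ⟨d, a, hd, ha⟩ := exists_smul_eq_one_tmul (latticeOfSelfDual M hfg hM) x
  have hea : d • e x = M.subtype a := by
    rw [← map_smul]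
    refine (congrArg e ha).trans ?_
    exact ((isBaseChange_subtype (K := K) hfull).equiv_tmul 1 _).trans (one_smul _ _)
  have h1 : d ^ 2 * (latticeOfSelfDual M hfg hM).formK x x = (d • e x) ⬝ᵥ (d • e x) := by
    rw [hea]
    refine Eq.trans ?_ (latticeOfSelfDual_form hfg hM a a)
    rw [← formK_one_tmul, ← ha]
    simp only [map_smul, LinearMap.smul_apply, smul_eq_mul]
    ring
  have h2 : (d • e x) ⬝ᵥ (d • e x) = d ^ 2 * ∑ i, (e x i) ^ 2 := by
    rw [smul_dotProduct, dotProduct_smul, smul_eq_mul, smul_eq_mul, ← mul_assoc, ← pow_two]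
    simp only [dotProduct, pow_two]
  exact mul_left_cancel₀ (pow_ne_zero 2 hd) (h1.trans h2)

end

end

end LocalSquares

theorem stmt10 (K : Type) [Field K] [NumberField K] (htr : TotallyReal K)
    (L : OKLattice K) :
    ∃ L' : OKLattice K, L'.IsUnimodular ∧ L'.rank = L.rank + 3 ∧ L'.Represents L ∧
      ∃ e : (K ⊗[𝓞 K] L'.carrier) ≃ₗ[K] (Fin (L.rank + 3) → K),
        ∀ x : K ⊗[𝓞 K] L'.carrier,
          (LinearMap.BilinForm.baseChange K L'.form) x x = ∑ i, (e x i) ^ 2 := by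
  have := LocalSquares.nonempty_ringHom_real htr
  obtain ⟨f, hf⟩ := LocalSquares.exists_isometric_embedding (ι := Fin (L.rank + 3)) L.formK
    (LocalSquares.formK_symm L) (fun v hv => LocalSquares.realPos_formK L hv)
    (by rw [Fintype.card_fin]; exact le_rfl)
  let g : L.carrier →ₗ[𝓞 K] (Fin (L.rank + 3) → K) :=
    f.restrictScalars (𝓞 K) ∘ₗ TensorProduct.mk (𝓞 K) K L.carrier 1
  have hg : ∀ x y, g x ⬝ᵥ g y = algebraMap (𝓞 K) K (L.form x y) := fun x y => by
    rw [← LocalSquares.formK_one_tmul]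
    exact hf _ _
  obtain ⟨M, hgM, hfg, hfull, hM⟩ := LocalSquares.exists_selfDual (N := LinearMap.range g)
    (by rw [LinearMap.range_eq_map]; exact (Module.Finite.fg_top).map _) (by
      rintro _ ⟨x, rfl⟩ _ ⟨y, rfl⟩
      exact Submodule.mem_one.2 ⟨_, (hg x y).symm⟩)
  obtain ⟨e, he⟩ := LocalSquares.exists_latticeOfSelfDual_equiv hfg hM hfull
  refine ⟨LocalSquares.latticeOfSelfDual M hfg hM,
    LocalSquares.latticeOfSelfDual_isUnimodular hfg hM hfull, ?_, ?_, e, he⟩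
  · rw [OKLattice.rank, e.finrank_eq, Module.finrank_fin_fun]
  · refine ⟨g.codRestrict M fun x => hgM ⟨x, rfl⟩, fun x => ?_⟩
    apply FaithfulSMul.algebraMap_injective (𝓞 K) K
    exact (LocalSquares.latticeOfSelfDual_form hfg hM ⟨g x, hgM ⟨x, rfl⟩⟩
      ⟨g x, hgM ⟨x, rfl⟩⟩).trans (hg x x)
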